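/- Assume additionally that φ(x) → 0 as |x| → ∞ and that a is normalized by ∫_{ℝ^d} a(x) dx = (∫_Γ exp[(s−1) Σ_{u∈γ} φ(u)] μ(dγ))^{−1}. Then for every f ∈ C_0(ℝ^d), with F(γ) := e^{⟨f,γ⟩}, one has H_ε^− F → H_0^− F in L²(Γ,μ) as ε → 0+. -/

import Mathlib

open MeasureTheory Set Filter
open scoped ENNReal NNReal BigOperators Topology Classical

noncomputable section

abbrev EucSp (d : ℕ) := EuclideanSpace ℝ (Fin d)

/-- The configuration space `Γ` over `ℝ^d`: locally finite subsets. -/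
def Config (d : ℕ) : Type :=
  {γ : Set (EucSp d) // ∀ Λ : Set (EucSp d), IsCompact Λ → (γ ∩ Λ).Finite}

/-- The σ-algebra on `Γ` generated by the maps `γ ↦ |γ ∩ B|`, `B` Borel. -/
instance Config.instMS (d : ℕ) : MeasurableSpace (Config d) :=
  ⨆ (B : Set (EucSp d)) (_ : MeasurableSet B),
    MeasurableSpace.comap (fun γ : Config d => (γ.1 ∩ B).encard) (⊤ : MeasurableSpace ℕ∞)

/-- `γ ∪ {x}`. -/
def Config.ins {d : ℕ} (γ : Config d) (x : EucSp d) : Config d :=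
  ⟨insert x γ.1, fun Λ hΛ => ((γ.2 Λ hΛ).insert x).subset fun y hy => by
    rcases hy with ⟨h1, h2⟩
    rcases h1 with rfl | h1
    · exact Set.mem_insert _ _
    · exact Set.mem_insert_of_mem _ ⟨h1, h2⟩⟩

/-- `γ ∖ {x}`. -/
def Config.del {d : ℕ} (γ : Config d) (x : EucSp d) : Config d :=
  ⟨γ.1 \ {x}, fun Λ hΛ => (γ.2 Λ hΛ).subset fun y hy => ⟨hy.1.1, hy.2⟩⟩

/-- The pairing `⟨f, γ⟩ = ∑_{x ∈ γ} f x`. -/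
def cpair {d : ℕ} (f : EucSp d → ℝ) (γ : Config d) : ℝ := ∑' x : γ.1, f x.1

/-- `exp : [-∞,∞] → [0,∞]`. -/
def eexp (x : EReal) : ℝ≥0∞ :=
  if x = ⊤ then ⊤ else if x = ⊥ then 0 else ENNReal.ofReal (Real.exp x.toReal)

/-- real-valued exponential of an extended real (with `exp(±∞)` sent to junk value `0`). -/
def rexp (x : EReal) : ℝ := (eexp x).toReal

/-- The relative energy `E(x,γ) = ∑_{y ∈ γ} φ(x-y)` if absolutely convergent, `+∞` otherwise. -/
def energy {d : ℕ} (φ : EucSp d → EReal) (x : EucSp d) (γ : Set (EucSp d)) : EReal :=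
  if (∀ y ∈ γ, φ (x - y) ≠ ⊤) ∧ Summable (fun y : γ => (φ (x - y.1)).toReal)
  then (((∑' y : γ, (φ (x - y.1)).toReal) : ℝ) : EReal)
  else ⊤

/-- `∑_{u ∈ γ} φ(u)` if absolutely convergent, `+∞` otherwise. -/
def totPhi {d : ℕ} (φ : EucSp d → EReal) (γ : Set (EucSp d)) : EReal :=
  if (∀ y ∈ γ, φ y ≠ ⊤) ∧ Summable (fun y : γ => (φ y.1).toReal)
  then (((∑' y : γ, (φ y.1).toReal) : ℝ) : EReal)
  else ⊤

/-- A pair potential: Borel, even, with `φ(x) ∈ ℝ` off the origin. -/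
structure IsPairPotential {d : ℕ} (φ : EucSp d → EReal) : Prop where
  meas : Measurable φ
  even : ∀ x : EucSp d, x ≠ 0 → φ (-x) = φ x
  finite_off : ∀ x : EucSp d, x ≠ 0 → φ x ≠ ⊤
  ne_bot : ∀ x, φ x ≠ ⊥

/-- Stability (S): `∑_{{x,y} ⊆ η} φ(x-y) ≥ -B|η|` for all finite `η`
(stated with the sum over ordered pairs, which doubles both sides). -/
def Stable {d : ℕ} (φ : EucSp d → EReal) (B : ℝ) : Prop :=
  ∀ η : Finset (EucSp d),
    ((-(2 * B * η.card) : ℝ) : EReal) ≤ ∑ p ∈ η.offDiag, φ (p.1 - p.2)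

/-- Low activity–high temperature (LA-HT): `∫ |e^{-φ} - 1| z dx < (2 e^{1+2B})⁻¹`. -/
def LAHT {d : ℕ} (φ : EucSp d → EReal) (z B : ℝ) : Prop :=
  ∫⁻ x : EucSp d, ENNReal.ofReal (|rexp (-(φ x)) - 1| * z)
    < ENNReal.ofReal (2 * Real.exp (1 + 2 * B))⁻¹

/-- The Georgii–Nguyen–Zessin identity characterizing `μ ∈ G(z,φ)`. -/
def GNZ {d : ℕ} (z : ℝ) (φ : EucSp d → EReal) (μ : Measure (Config d)) : Prop :=
  ∀ F : Config d → EucSp d → ℝ≥0∞,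
    Measurable (Function.uncurry F) →
    ∫⁻ γ, ∑' x : γ.1, F γ x.1 ∂μ
      = ∫⁻ γ, ∫⁻ x, ENNReal.ofReal z * eexp (-(energy φ x γ.1)) * F (γ.ins x) x ∂volume ∂μ

/-- Ordered `n`-tuples of distinct points of `γ`. -/
def injTuples {d : ℕ} (n : ℕ) (γ : Set (EucSp d)) : Set (Fin n → EucSp d) :=
  {p | Function.Injective p ∧ ∀ i, p i ∈ γ}

/-- `(k_μ^{(n)})` is the family of correlation functions of `μ`: each `k n` is measurable,
nonnegative and symmetric, and for every measurable symmetric `f : (ℝ^d)^n → [0,∞]`,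
`∫_Γ ∑_{{x_1,…,x_n} ⊆ γ} f dμ = (1/n!) ∫ f·kₙ dx` (stated equivalently via the sum over
ordered tuples of distinct points, which absorbs the factor `1/n!`). -/
def HasCorrFns {d : ℕ} (μ : Measure (Config d)) (k : ∀ n : ℕ, (Fin n → EucSp d) → ℝ) : Prop :=
  (∀ n : ℕ, Measurable (k n) ∧ (∀ x, 0 ≤ k n x) ∧
      ∀ (σ : Equiv.Perm (Fin n)) (x : Fin n → EucSp d), k n (x ∘ σ) = k n x) ∧
  ∀ n : ℕ, 0 < n → ∀ f : (Fin n → EucSp d) → ℝ≥0∞, Measurable f →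
    (∀ (σ : Equiv.Perm (Fin n)) (x : Fin n → EucSp d), f (x ∘ σ) = f x) →
    ∫⁻ γ, ∑' p : injTuples n γ.1, f p.1 ∂μ
      = ∫⁻ x : Fin n → EucSp d, f x * ENNReal.ofReal (k n x)

/-- The Ruelle bound `k^{(n)} ≤ ξⁿ`. -/
def RuelleBound {d : ℕ} (k : ∀ n : ℕ, (Fin n → EucSp d) → ℝ) (ξ : ℝ) : Prop :=
  ∀ n : ℕ, 0 < n → ∀ x : Fin n → EucSp d, k n x ≤ ξ ^ n

/-- Translation invariance of a family of functions on tuples. -/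
def TransInvFns {d : ℕ} (k : ∀ n : ℕ, (Fin n → EucSp d) → ℝ) : Prop :=
  ∀ (n : ℕ) (a : EucSp d) (x : Fin n → EucSp d), k n (fun i => x i + a) = k n x

/-- `P` is a partition of `{0,…,n-1}` into nonempty pairwise disjoint blocks. -/
def IsPartOfUniv {n : ℕ} (P : Finset (Finset (Fin n))) : Prop :=
  (∀ b ∈ P, b.Nonempty) ∧ (P : Set (Finset (Fin n))).PairwiseDisjoint id ∧
    P.sup id = Finset.univ

/-- `u` is the family of Ursell functions of `k`:
`k(η) = ∑ u(η_1) ⋯ u(η_j)`, summing over all partitions of `η`. -/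
def IsUrsell {d : ℕ} (k u : ∀ n : ℕ, (Fin n → EucSp d) → ℝ) : Prop :=
  ∀ n : ℕ, 0 < n → ∀ x : Fin n → EucSp d,
    k n x = ∑ P : Finset (Finset (Fin n)),
      if IsPartOfUniv P then ∏ b ∈ P, u b.card (fun i => x (b.orderIsoOfFin rfl i).1) else 0

/-- `f ∈ C_0(ℝ^d)`: continuous with compact support. -/
def IsC0 {d : ℕ} (f : EucSp d → ℝ) : Prop := Continuous f ∧ HasCompactSupport f

/-- Cylinder functions `FC_b(C_0(ℝ^d),Γ)`. -/
def Cyl {d : ℕ} (F : Config d → ℝ) : Prop :=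
  ∃ (N : ℕ) (f : Fin N → EucSp d → ℝ) (g : (Fin N → ℝ) → ℝ),
    (∀ i, IsC0 (f i)) ∧ Continuous g ∧ (∃ C, ∀ y, |g y| ≤ C) ∧
    ∀ γ, F γ = g fun i => cpair (f i) γ

/-- `(D_x^- F)(γ) = F(γ∖x) - F(γ)`. -/
def Dminus {d : ℕ} (F : Config d → ℝ) (x : EucSp d) (γ : Config d) : ℝ := F (γ.del x) - F γ

/-- `(D_x^+ F)(γ) = F(γ∪x) - F(γ)`. -/
def Dplus {d : ℕ} (F : Config d → ℝ) (x : EucSp d) (γ : Config d) : ℝ := F (γ.ins x) - F γ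

/-- `(D_{xy}^{-+} F)(γ) = F(γ∖x∪y) - F(γ)`. -/
def Dpm {d : ℕ} (F : Config d → ℝ) (x y : EucSp d) (γ : Config d) : ℝ :=
  F ((γ.del x).ins y) - F γ

/-- The Glauber bilinear form `E_G`. -/
def glauberForm {d : ℕ} (s : ℝ) (φ : EucSp d → EReal) (μ : Measure (Config d))
    (F G : Config d → ℝ) : ℝ :=
  ∫ γ, (∑' x : γ.1,
      rexp ((s : EReal) * energy φ x.1 (γ.1 \ {x.1})) * Dminus F x.1 γ * Dminus G x.1 γ) ∂μ

/-- The Kawasaki bilinear form `E_K`. -/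
def kawasakiForm {d : ℕ} (s : ℝ) (a : EucSp d → ℝ) (φ : EucSp d → EReal)
    (μ : Measure (Config d)) (F G : Config d → ℝ) : ℝ :=
  (1 / 2) * ∫ γ, (∑' x : γ.1, ∫ y : EucSp d,
      a (x.1 - y) *
        rexp ((s : EReal) * energy φ x.1 (γ.1 \ {x.1}) +
          ((s - 1 : ℝ) : EReal) * energy φ y (γ.1 \ {x.1})) *
        Dpm F x.1 y γ * Dpm G x.1 y γ) ∂μ

/-- The Glauber generator `H_G`. -/
def HG {d : ℕ} (s z : ℝ) (φ : EucSp d → EReal) (F : Config d → ℝ) (γ : Config d) : ℝ :=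
  -(∑' x : γ.1, rexp ((s : EReal) * energy φ x.1 (γ.1 \ {x.1})) * Dminus F x.1 γ)
    - ∫ x : EucSp d, z * rexp (((s - 1 : ℝ) : EReal) * energy φ x γ.1) * Dplus F x γ

/-- The Kawasaki generator `H_K`. -/
def HK {d : ℕ} (s : ℝ) (a : EucSp d → ℝ) (φ : EucSp d → EReal) (F : Config d → ℝ)
    (γ : Config d) : ℝ :=
  -(∑' x : γ.1, ∫ y : EucSp d,
      a (x.1 - y) * rexp ((s : EReal) * energy φ x.1 (γ.1 \ {x.1}) +
        ((s - 1 : ℝ) : EReal) * energy φ y (γ.1 \ {x.1})) * Dpm F x.1 y γ)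

/-- The scaled jump kernel `a_ε(x) = ε^d a(ε x)`. -/
def aScaled {d : ℕ} (a : EucSp d → ℝ) (ε : ℝ) (x : EucSp d) : ℝ := ε ^ d * a (ε • x)

/-- `H_ε^-` (death part of the Kawasaki generator with kernel `aa`). -/
def HepsMinus {d : ℕ} (s : ℝ) (aa : EucSp d → ℝ) (φ : EucSp d → EReal)
    (F : Config d → ℝ) (γ : Config d) : ℝ :=
  -(∑' x : γ.1, Dminus F x.1 γ * ∫ y : EucSp d,
      aa (x.1 - y) * rexp ((s : EReal) * energy φ x.1 (γ.1 \ {x.1}) +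
        ((s - 1 : ℝ) : EReal) * energy φ y (γ.1 \ {x.1})))

/-- `H_ε^+` (birth part of the Kawasaki generator with kernel `aa`). -/
def HepsPlus {d : ℕ} (s : ℝ) (aa : EucSp d → ℝ) (φ : EucSp d → EReal)
    (F : Config d → ℝ) (γ : Config d) : ℝ :=
  -(∑' x : γ.1, ∫ y : EucSp d,
      aa (x.1 - y) * rexp ((s : EReal) * energy φ x.1 (γ.1 \ {x.1}) +
        ((s - 1 : ℝ) : EReal) * energy φ y (γ.1 \ {x.1})) * Dplus F y (γ.del x.1))

/-- `H_0^-` (death part of the Glauber generator). -/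
def H0Minus {d : ℕ} (s : ℝ) (φ : EucSp d → EReal) (F : Config d → ℝ) (γ : Config d) : ℝ :=
  -(∑' x : γ.1, rexp ((s : EReal) * energy φ x.1 (γ.1 \ {x.1})) * Dminus F x.1 γ)

/-- `H_0^+` (birth part of the Glauber generator). -/
def H0Plus {d : ℕ} (s z : ℝ) (φ : EucSp d → EReal) (F : Config d → ℝ) (γ : Config d) : ℝ :=
  -∫ x : EucSp d, z * rexp (((s - 1 : ℝ) : EReal) * energy φ x γ.1) * Dplus F x γ

/-- The standing assumptions of the paper: `s ∈ [0,1/2]`, a stable pair potential in the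
low activity–high temperature regime, bounded outside a ball, and `μ` the Gibbs measure
from Ruelle's theorem with its correlation and Ursell functions. -/
structure Setting (d : ℕ) (s z B ξ : ℝ) (φ : EucSp d → EReal) (μ : Measure (Config d))
    (k u : ∀ n : ℕ, (Fin n → EucSp d) → ℝ) : Prop where
  hd : 0 < d
  hs0 : 0 ≤ s
  hs1 : s ≤ 1 / 2
  pp : IsPairPotential φ
  hB : 0 ≤ B
  stable : Stable φ B
  hz : 0 < z
  laht : LAHT φ z B
  bddOutside : ∃ R C : ℝ, ∀ x : EucSp d, R ≤ ‖x‖ → ∃ r : ℝ, φ x = (r : EReal) ∧ |r| ≤ C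
  prob : IsProbabilityMeasure μ
  gnz : GNZ z φ μ
  corr : HasCorrFns μ k
  ti : TransInvFns k
  hξ : 0 < ξ
  ruelle : RuelleBound k ξ
  ursell : IsUrsell k u
  ursellInt : ∀ m : ℕ,
    Integrable (fun y : Fin (m + 1) → EucSp d => u (m + 2) (Fin.cons 0 y)) volume

/-- The jump kernel `a`: bounded, nonnegative, even, integrable. -/
structure GoodA {d : ℕ} (a : EucSp d → ℝ) : Prop where
  meas : Measurable a
  nonneg : ∀ x, 0 ≤ a x
  bdd : ∃ C, ∀ x, a x ≤ C
  even : ∀ x, a (-x) = a x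
  int : Integrable a volume

/-- `φ(x) → 0` as `|x| → ∞`. -/
def PhiVanishes {d : ℕ} (φ : EucSp d → EReal) : Prop :=
  Tendsto φ (cocompact (EucSp d)) (nhds (0 : EReal))

/-- The normalization `∫ a dx = (∫_Γ exp[(s-1) ∑_{u∈γ} φ(u)] dμ(γ))⁻¹`. -/
def NormalizedA {d : ℕ} (s : ℝ) (a : EucSp d → ℝ) (φ : EucSp d → EReal)
    (μ : Measure (Config d)) : Prop :=
  (∫ x : EucSp d, a x) = (∫ γ, rexp (((s - 1 : ℝ) : EReal) * totPhi φ γ.1) ∂μ)⁻¹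

/-- The counting measure of a configuration. -/
def cfgCount {d : ℕ} (γ : Config d) : Measure (EucSp d) :=
  Measure.sum fun u : γ.1 => Measure.dirac u.1

lemma lintegral_cfgCount {d : ℕ} (γ : Config d) (g : EucSp d → ℝ≥0∞) :
    ∫⁻ x, g x ∂(cfgCount γ) = ∑' u : γ.1, g u.1 := by
  simp [cfgCount, lintegral_sum_measure, lintegral_dirac]

lemma cfgCount_apply {d : ℕ} (γ : Config d) {S : Set (EucSp d)} (hS : MeasurableSet S) :
    cfgCount γ S = ((γ.1 ∩ S).encard : ℝ≥0∞) := by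
  rw [← lintegral_indicator_one hS, lintegral_cfgCount, ← ENNReal.tsum_set_one,
    tsum_subtype γ.1 (S.indicator 1), tsum_subtype (γ.1 ∩ S) (fun _ => (1 : ℝ≥0∞))]
  congr 1
  rw [Set.indicator_indicator]
  rfl

lemma cfgCount_lt_top_of_isBounded {d : ℕ} (γ : Config d) {S : Set (EucSp d)}
    (hS : MeasurableSet S) (hb : Bornology.IsBounded S) : cfgCount γ S < ⊤ := by
  rw [cfgCount_apply γ hS]
  have : (γ.1 ∩ S).Finite :=
    (γ.2 _ hb.isCompact_closure).subset (inter_subset_inter_right _ subset_closure)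
  rw [ENat.toENNReal_lt_top]
  exact Set.encard_lt_top_iff.2 this

lemma measurable_cfgCount {d : ℕ} : Measurable (cfgCount (d := d)) := by
  refine Measure.measurable_of_measurable_coe _ fun S hS => ?_
  simp_rw [cfgCount_apply _ hS]
  have h1 : @Measurable (Config d) ℕ∞ (Config.instMS d) ⊤ fun γ : Config d => (γ.1 ∩ S).encard := by
    rw [measurable_iff_comap_le]
    exact le_iSup₂_of_le S hS le_rfl
  exact (@measurable_from_top ℕ∞ ℝ≥0∞ _ (fun n : ℕ∞ => (n : ℝ≥0∞))).comp h1

lemma measurable_to_config {d : ℕ} {α : Type*} [MeasurableSpace α] {c : α → Config d}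
    (h : ∀ S, MeasurableSet S → Measurable fun a => cfgCount (c a) S) : Measurable c := by
  rw [measurable_iff_comap_le]
  simp only [Config.instMS, MeasurableSpace.comap_iSup, MeasurableSpace.comap_comp]
  refine iSup₂_le fun S hS => ?_
  rintro _ ⟨T, -, rfl⟩
  have h2 : MeasurableSet ((fun a => cfgCount (c a) S) ⁻¹' ((fun n : ℕ∞ => (n : ℝ≥0∞)) '' T)) := by
    refine h S hS ?_
    exact (T.to_countable.image _).measurableSet
  convert h2 using 1
  ext a
  simp only [mem_preimage, Function.comp_apply, cfgCount_apply _ hS, mem_image]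
  constructor
  · intro ha
    exact ⟨_, ha, rfl⟩
  · rintro ⟨n, hn, h⟩
    rw [ENat.toENNReal_inj] at h
    rwa [← h]

lemma measurable_lintegral_of_finite {α β : Type*} [MeasurableSpace α] [MeasurableSpace β]
    {κ : α → Measure β} (hκ : Measurable κ) (hfin : ∀ a, IsFiniteMeasure (κ a))
    {f : α → β → ℝ≥0∞} (hf : Measurable (Function.uncurry f)) :
    Measurable fun a => ∫⁻ b, f a b ∂(κ a) := by
  let K : ProbabilityTheory.Kernel α β := ⟨κ, hκ⟩
  suffices h : ∀ g : α × β → ℝ≥0∞, Measurable g →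
      Measurable fun a => ∫⁻ b, g (a, b) ∂(κ a) from h _ hf
  intro g hg
  refine Measurable.ennreal_induction
    (motive := fun g => Measurable fun a => ∫⁻ b, g (a, b) ∂(κ a)) ?_ ?_ ?_ hg
  · intro c s hs
    have h0 : ∀ a, ∫⁻ b, s.indicator (fun _ => c) (a, b) ∂(κ a) = c * κ a (Prod.mk a ⁻¹' s) := by
      intro a
      have : (fun b => s.indicator (fun _ => c) (a, b))
          = (Prod.mk a ⁻¹' s).indicator (fun _ => c) := by
        ext b; simp [Set.indicator]
      rw [this, lintegral_indicator_const (measurable_prodMk_left hs)]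
    simp_rw [h0]
    exact (ProbabilityTheory.Kernel.measurable_kernel_prodMk_left_of_finite (κ := K) hs
      hfin).const_mul _
  · intro f g _ hf hg hf' hg'
    have h0 : ∀ a, ∫⁻ b, (f + g) (a, b) ∂(κ a)
        = ∫⁻ b, f (a, b) ∂(κ a) + ∫⁻ b, g (a, b) ∂(κ a) := fun a =>
      lintegral_add_left (hf.comp measurable_prodMk_left) _
    simp_rw [h0]
    exact hf'.add hg'
  · intro f hf hm hf'
    have h0 : ∀ a, ∫⁻ b, (⨆ n, f n (a, b)) ∂(κ a) = ⨆ n, ∫⁻ b, f n (a, b) ∂(κ a) := fun a =>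
      lintegral_iSup (fun n => (hf n).comp measurable_prodMk_left) (fun i j hij b => hm hij _)
    simp_rw [h0]
    exact Measurable.iSup hf'

/-- Sums of jointly measurable functions over measurably varying configurations are measurable. -/
lemma measurable_tsum_config {d : ℕ} {α : Type*} [MeasurableSpace α] {c : α → Config d}
    (hc : Measurable c) {f : α → EucSp d → ℝ≥0∞} (hf : Measurable (Function.uncurry f)) :
    Measurable fun a => ∑' u : (c a).1, f a u.1 := by
  simp_rw [← lintegral_cfgCount]
  let b : ℕ → Set (EucSp d) := fun n => disjointed (fun n : ℕ => Metric.ball 0 (n : ℝ)) n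
  have hb : ∀ n, MeasurableSet (b n) :=
    fun n => MeasurableSet.disjointed (fun _ => Metric.isOpen_ball.measurableSet) n
  have hbd : ∀ n, Bornology.IsBounded (b n) := fun n =>
    Metric.isBounded_ball.subset (disjointed_subset _ n)
  have hU : (⋃ n, b n) = univ := by
    rw [iUnion_disjointed]
    exact Metric.iUnion_ball_nat 0
  have h0 : ∀ a, ∫⁻ x, f a x ∂(cfgCount (c a))
      = ∑' n, ∫⁻ x, f a x ∂((cfgCount (c a)).restrict (b n)) := by
    intro a
    rw [← lintegral_iUnion hb (disjoint_disjointed _), hU, Measure.restrict_univ]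
  simp_rw [h0]
  refine Measurable.tsum fun n => ?_
  refine measurable_lintegral_of_finite ?_ (fun a => ⟨?_⟩) hf
  · refine Measure.measurable_of_measurable_coe _ fun S hS => ?_
    simp_rw [Measure.restrict_apply hS]
    exact (Measure.measurable_coe (hS.inter (hb n))).comp (measurable_cfgCount.comp hc)
  · rw [Measure.restrict_apply_univ]
    exact cfgCount_lt_top_of_isBounded _ (hb n) (hbd n)

lemma measurable_del {d : ℕ} {α : Type*} [MeasurableSpace α] {c : α → Config d}
    (hc : Measurable c) {g : α → EucSp d} (hg : Measurable g) :
    Measurable fun a => (c a).del (g a) := by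
  refine measurable_to_config fun S hS => ?_
  have h0 : ∀ a, cfgCount ((c a).del (g a)) S
      = ∑' u : (c a).1, ({p : α × EucSp d | p.2 ≠ g p.1 ∧ p.2 ∈ S}.indicator 1 (a, u.1) : ℝ≥0∞) := by
    intro a
    rw [cfgCount_apply _ hS, ← ENNReal.tsum_set_one,
      tsum_subtype _ (fun _ => (1 : ℝ≥0∞)),
      tsum_subtype (c a).1 (fun u => ({p : α × EucSp d | p.2 ≠ g p.1 ∧ p.2 ∈ S}.indicator 1
        (a, u) : ℝ≥0∞))]
    congr 1
    ext u
    simp only [Config.del, Set.indicator, mem_inter_iff, Set.mem_sdiff, mem_singleton_iff, mem_ofPred_eq,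
      Pi.one_apply]
    by_cases h1 : u ∈ (c a).1 <;> by_cases h2 : u = g a <;> by_cases h3 : u ∈ S <;> simp [h1, h2, h3]
  simp_rw [h0]
  refine measurable_tsum_config hc (f := fun a u =>
    ({p : α × EucSp d | p.2 ≠ g p.1 ∧ p.2 ∈ S}.indicator 1 (a, u) : ℝ≥0∞)) ?_
  refine (measurable_const (a := (1 : ℝ≥0∞))).indicator (MeasurableSet.inter ?_ ?_)
  · exact (measurableSet_eq_fun measurable_snd (hg.comp measurable_fst)).compl
  · exact measurable_snd hS

lemma ofReal_posPart_sub_toReal_tsum {ι : Type*} (g : ι → ℝ) :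
    Summable g ↔ (∑' i, ENNReal.ofReal (g i)) ≠ ⊤ ∧ (∑' i, ENNReal.ofReal (-g i)) ≠ ⊤ := by
  constructor
  · intro h
    exact ⟨h.tsum_ofReal_ne_top, h.neg.tsum_ofReal_ne_top⟩
  · rintro ⟨h1, h2⟩
    have h3 := ENNReal.summable_toReal h1
    have h4 := ENNReal.summable_toReal h2
    refine (h3.sub h4).congr fun i => ?_
    simp only [ENNReal.toReal_ofReal']
    rcases le_total 0 (g i) with h | h
    · rw [max_eq_left h, max_eq_right (by linarith)]; ring
    · rw [max_eq_right h, max_eq_left (by linarith)]; ring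

lemma tsum_eq_toReal_sub_toReal {ι : Type*} {g : ι → ℝ} (h : Summable g) :
    ∑' i, g i = (∑' i, ENNReal.ofReal (g i)).toReal - (∑' i, ENNReal.ofReal (-g i)).toReal := by
  obtain ⟨h1, h2⟩ := (ofReal_posPart_sub_toReal_tsum g).1 h
  have h3 := ENNReal.summable_toReal h1
  have h4 := ENNReal.summable_toReal h2
  rw [ENNReal.tsum_toReal_eq (fun i => ENNReal.ofReal_ne_top),
    ENNReal.tsum_toReal_eq (fun i => ENNReal.ofReal_ne_top), ← h3.tsum_sub h4]
  refine tsum_congr fun i => ?_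
  simp only [ENNReal.toReal_ofReal']
  rcases le_total 0 (g i) with h | h
  · rw [max_eq_left h, max_eq_right (by linarith)]; ring
  · rw [max_eq_right h, max_eq_left (by linarith)]; ring

/-- The relative energy depends measurably on the point and the configuration. -/
lemma measurable_energy {d : ℕ} {φ : EucSp d → EReal} (hφ : Measurable φ)
    {α : Type*} [MeasurableSpace α] {c : α → Config d}
    (hc : Measurable c) {g : α → EucSp d} (hg : Measurable g) :
    Measurable fun a => energy φ (g a) (c a).1 := by
  have hsub : Measurable fun p : α × EucSp d => g p.1 - p.2 :=
    (hg.comp measurable_fst).sub measurable_snd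
  have hr : Measurable fun p : α × EucSp d => (φ (g p.1 - p.2)).toReal :=
    (hφ.comp hsub).ereal_toReal
  have hT : Measurable fun a => ∑' u : (c a).1, (if φ (g a - u.1) = ⊤ then (1 : ℝ≥0∞) else 0) :=
    measurable_tsum_config hc (f := fun a u => if φ (g a - u) = ⊤ then (1 : ℝ≥0∞) else 0)
      (Measurable.ite ((hφ.comp hsub) (measurableSet_singleton ⊤))
        measurable_const measurable_const)
  have hP : Measurable fun a => ∑' u : (c a).1, ENNReal.ofReal (φ (g a - u.1)).toReal :=
    measurable_tsum_config hc (f := fun a u => ENNReal.ofReal (φ (g a - u)).toReal)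
      hr.ennreal_ofReal
  have hN : Measurable fun a => ∑' u : (c a).1, ENNReal.ofReal (-(φ (g a - u.1)).toReal) :=
    measurable_tsum_config hc (f := fun a u => ENNReal.ofReal (-(φ (g a - u)).toReal))
      hr.neg.ennreal_ofReal
  have h0 : (fun a => energy φ (g a) (c a).1) = fun a =>
      if (∑' u : (c a).1, (if φ (g a - u.1) = ⊤ then (1 : ℝ≥0∞) else 0)) = 0 ∧
        (∑' u : (c a).1, ENNReal.ofReal (φ (g a - u.1)).toReal) ≠ ⊤ ∧
        (∑' u : (c a).1, ENNReal.ofReal (-(φ (g a - u.1)).toReal)) ≠ ⊤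
      then ((((∑' u : (c a).1, ENNReal.ofReal (φ (g a - u.1)).toReal).toReal -
        (∑' u : (c a).1, ENNReal.ofReal (-(φ (g a - u.1)).toReal)).toReal : ℝ)) : EReal)
      else ⊤ := by
    ext a
    have e1 : (∀ y ∈ (c a).1, φ (g a - y) ≠ ⊤) ↔
        (∑' u : (c a).1, (if φ (g a - u.1) = ⊤ then (1 : ℝ≥0∞) else 0)) = 0 := by
      rw [ENNReal.tsum_eq_zero]
      simp
    unfold energy
    have e2 := ofReal_posPart_sub_toReal_tsum fun y : (c a).1 => (φ (g a - y.1)).toReal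
    by_cases h : (∀ y ∈ (c a).1, φ (g a - y) ≠ ⊤) ∧
      Summable (fun y : (c a).1 => (φ (g a - y.1)).toReal)
    · rw [if_pos h, if_pos ⟨e1.1 h.1, e2.1 h.2⟩, tsum_eq_toReal_sub_toReal h.2]
    · rw [if_neg h, if_neg fun h' => h ⟨e1.2 h'.1, e2.2 h'.2⟩]
  rw [h0]
  refine Measurable.ite ?_ (measurable_coe_real_ereal.comp
    (hP.ennreal_toReal.sub hN.ennreal_toReal)) measurable_const
  exact (hT (measurableSet_singleton 0)).inter ((hP (measurableSet_singleton ⊤)).compl.inter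
    (hN (measurableSet_singleton ⊤)).compl)

lemma measurable_rexp : Measurable rexp := by
  unfold rexp eexp
  refine Measurable.ennreal_toReal ?_
  refine Measurable.ite (measurableSet_singleton ⊤) measurable_const ?_
  refine Measurable.ite (measurableSet_singleton ⊥) measurable_const ?_
  exact (Real.measurable_exp.comp measurable_ereal_toReal).ennreal_ofReal

lemma measurable_tsum_tuples {d : ℕ} (n : ℕ) : ∀ {α : Type} [MeasurableSpace α] {c : α → Config d}
    (_ : Measurable c) {F : α → (Fin n → EucSp d) → ℝ≥0∞} (_ : Measurable (Function.uncurry F)),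
    Measurable fun a => ∑' p : Fin n → (c a).1, F a fun i => (p i).1 := by
  induction n with
  | zero =>
    intro α _ c hc F hF
    have : ∀ a, ∑' p : Fin 0 → (c a).1, F a (fun i => (p i).1) = F a Fin.elim0 := by
      intro a
      rw [tsum_eq_single (Fin.elim0 : Fin 0 → (c a).1) (fun b hb => absurd (Subsingleton.elim _ _) hb)]
      congr 1
      exact Subsingleton.elim _ _
    simp_rw [this]
    exact hF.comp (measurable_id.prodMk measurable_const)
  | succ n ih =>
    intro α _ c hc F hF
    have : ∀ a, ∑' p : Fin (n + 1) → (c a).1, F a (fun i => (p i).1)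
        = ∑' u : (c a).1, ∑' p : Fin n → (c a).1, F a (Fin.cons u.1 fun i => (p i).1) := by
      intro a
      rw [← (Fin.consEquiv fun _ => (c a).1).tsum_eq, ENNReal.tsum_prod']
      refine tsum_congr fun u => tsum_congr fun p => ?_
      congr 1
      ext i : 1
      refine Fin.cases ?_ (fun j => ?_) i <;> simp [Fin.consEquiv]
    simp_rw [this]
    refine measurable_tsum_config hc (f := fun a u => ∑' p : Fin n → (c a).1,
      F a (Fin.cons u fun i => (p i).1)) ?_
    refine ih (α := α × EucSp d) (c := fun q => c q.1) (hc.comp measurable_fst)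
      (F := fun q p => F q.1 (Fin.cons q.2 p)) ?_
    refine hF.comp ((measurable_fst.comp measurable_fst).prodMk ?_)
    refine measurable_pi_lambda _ fun i => ?_
    refine Fin.cases ?_ (fun j => ?_) i
    · exact measurable_snd.comp measurable_fst
    · exact (measurable_pi_apply j).comp measurable_snd

lemma measurableSet_injective_tuples {d n : ℕ} :
    MeasurableSet {p : Fin n → EucSp d | Function.Injective p} := by
  have : {p : Fin n → EucSp d | Function.Injective p}
      = ⋂ i, ⋂ j, ⋂ (_ : i ≠ j), {p | p i = p j}ᶜ := by
    ext p
    simp only [mem_ofPred_eq, mem_iInter, mem_compl_iff, Function.Injective]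
    exact ⟨fun h i j hij he => hij (h he), fun h i j he => by_contra fun hij => h i j hij he⟩
  rw [this]
  refine MeasurableSet.iInter fun i => MeasurableSet.iInter fun j => MeasurableSet.iInter fun _ => ?_
  exact (measurableSet_eq_fun (measurable_pi_apply i) (measurable_pi_apply j)).compl

lemma tsum_injTuples_eq {d n : ℕ} (γ : Set (EucSp d)) (F : (Fin n → EucSp d) → ℝ≥0∞) :
    ∑' p : injTuples n γ, F p.1
      = ∑' p : Fin n → γ, {p | Function.Injective p}.indicator F fun i => (p i).1 := by
  rw [tsum_subtype (injTuples n γ) F]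
  have hinj : Function.Injective fun (p : Fin n → γ) (i : Fin n) => (p i).1 := by
    intro p q h
    ext i : 2
    exact congrFun h i
  rw [← hinj.tsum_eq (f := (injTuples n γ).indicator F)]
  · refine tsum_congr fun p => ?_
    simp only [Set.indicator, injTuples, mem_ofPred_eq]
    congr 1
    simp
  · intro p hp
    have := mem_of_indicator_ne_zero hp
    exact ⟨fun i => ⟨p i, this.2 i⟩, rfl⟩

lemma measurable_tsum_injTuples {d : ℕ} (n : ℕ) {F : (Fin n → EucSp d) → ℝ≥0∞}
    (hF : Measurable F) : Measurable fun γ : Config d => ∑' p : injTuples n γ.1, F p.1 := by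
  simp_rw [tsum_injTuples_eq]
  exact measurable_tsum_tuples n (α := Config d) measurable_id
    (F := fun _ => {p | Function.Injective p}.indicator F)
    ((hF.indicator measurableSet_injective_tuples).comp measurable_snd)

/-- Embeddings of `Fin n` with image `s` are the bijections of `Fin n` with `s`. -/
def fiberEmbeddingEquiv {ι : Type*} {n : ℕ} (s : Finset ι) (hs : s.card = n) :
    {p : Fin n ↪ ι // Finset.univ.map p = s} ≃ (Fin n ↪ s) where
  toFun p := ⟨fun i => ⟨p.1 i, p.2.subset (Finset.mem_map_of_mem _ (Finset.mem_univ i))⟩,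
    fun i j h => p.1.injective (congrArg Subtype.val h)⟩
  invFun q := ⟨q.trans (Function.Embedding.subtype _), by
    refine Finset.eq_of_subset_of_card_le ?_ (by simp [hs])
    intro x hx
    obtain ⟨i, -, rfl⟩ := Finset.mem_map.1 hx
    exact (q i).2⟩
  left_inv p := by ext; rfl
  right_inv q := by ext; rfl

lemma tsum_embedding_eq {ι : Type*} (n : ℕ) (G : Finset ι → ℝ≥0∞) :
    ∑' p : Fin n ↪ ι, G (Finset.univ.map p)
      = (n.factorial : ℝ≥0∞) * ∑' s : Finset ι, if s.card = n then G s else 0 := by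
  rw [← (Equiv.sigmaFiberEquiv fun p : Fin n ↪ ι => Finset.univ.map p).tsum_eq, ENNReal.tsum_sigma',
    ← ENNReal.tsum_mul_left]
  refine tsum_congr fun s => ?_
  have h1 : ∀ p : {p : Fin n ↪ ι // Finset.univ.map p = s},
      G (Finset.univ.map ((Equiv.sigmaFiberEquiv fun p : Fin n ↪ ι => Finset.univ.map p) ⟨s, p⟩))
        = G s := fun p => congrArg G p.2
  simp_rw [h1]
  split_ifs with hs
  · rw [← (fiberEmbeddingEquiv s hs).symm.tsum_eq (fun _ => G s), tsum_fintype, Finset.sum_const,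
      Finset.card_univ, Fintype.card_embedding_eq, nsmul_eq_mul]
    simp [hs, Nat.descFactorial_self]
  · have : IsEmpty {p : Fin n ↪ ι // Finset.univ.map p = s} :=
      ⟨fun p => hs (by rw [← p.2]; simp)⟩
    simp

/-- A sum over finite subsets of a configuration as a sum over tuples of distinct points. -/
lemma tsum_finset_eq_tsum_injTuples {d : ℕ} (γ : Set (EucSp d)) (h : EucSp d → ℝ) (σ : ℝ → ℝ≥0∞) :
    ∑' s : Finset γ, σ (∏ i ∈ s, h i.1)
      = ∑' n : ℕ, (n.factorial : ℝ≥0∞)⁻¹ * ∑' p : injTuples n γ, σ (∏ i, h (p.1 i)) := by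
  have h1 : ∀ n : ℕ, ∑' p : injTuples n γ, σ (∏ i, h (p.1 i))
      = ∑' p : Fin n ↪ γ, σ (∏ i ∈ Finset.univ.map p, h i.1) := by
    intro n
    let e : (Fin n ↪ γ) ≃ injTuples n γ :=
      { toFun := fun p => ⟨fun i => (p i).1, fun i j hij => p.injective (Subtype.ext hij),
          fun i => (p i).2⟩
        invFun := fun q => ⟨fun i => ⟨q.1 i, q.2.2 i⟩, fun i j hij =>
          q.2.1 (congrArg Subtype.val hij)⟩
        left_inv := fun p => by ext; rfl
        right_inv := fun p => by ext; rfl }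
    rw [← e.tsum_eq]
    refine tsum_congr fun p => ?_
    rw [Finset.prod_map]
    rfl
  simp_rw [h1, tsum_embedding_eq _ (fun s : Finset γ => σ (∏ i ∈ s, h i.1)), ← mul_assoc]
  have h2 : ∀ n : ℕ, (n.factorial : ℝ≥0∞)⁻¹ * (n.factorial : ℝ≥0∞) = 1 := fun n =>
    ENNReal.inv_mul_cancel (by exact_mod_cast n.factorial_ne_zero) (ENNReal.natCast_ne_top _)
  simp_rw [h2, one_mul]
  rw [ENNReal.tsum_comm]
  refine tsum_congr fun s => ?_
  rw [tsum_eq_single s.card]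
  · simp
  · intro n hn
    rw [if_neg (Ne.symm hn)]

/-- Correlation functions, with the convention `k^{(0)} = 1`. -/
def corrExt {d : ℕ} (k : ∀ n : ℕ, (Fin n → EucSp d) → ℝ) (n : ℕ) (x : Fin n → EucSp d) : ℝ :=
  if n = 0 then 1 else k n x

lemma corrExt_measurable {d : ℕ} {k : ∀ n : ℕ, (Fin n → EucSp d) → ℝ} {μ : Measure (Config d)}
    (hk : HasCorrFns μ k) (n : ℕ) : Measurable (corrExt k n) := by
  unfold corrExt
  split_ifs
  · exact measurable_const
  · exact (hk.1 n).1

lemma corrExt_nonneg {d : ℕ} {k : ∀ n : ℕ, (Fin n → EucSp d) → ℝ} {μ : Measure (Config d)}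
    (hk : HasCorrFns μ k) (n : ℕ) (x) : 0 ≤ corrExt k n x := by
  unfold corrExt
  split_ifs
  · exact zero_le_one
  · exact (hk.1 n).2.1 x

lemma corrExt_le {d : ℕ} {k : ∀ n : ℕ, (Fin n → EucSp d) → ℝ} {ξ : ℝ}
    (hk : RuelleBound k ξ) (n : ℕ) (x) : corrExt k n x ≤ ξ ^ n := by
  unfold corrExt
  split_ifs with h
  · simp [h]
  · exact hk n (Nat.pos_of_ne_zero h) x

lemma corrExt_add {d : ℕ} {k : ∀ n : ℕ, (Fin n → EucSp d) → ℝ}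
    (hk : TransInvFns k) (n : ℕ) (a : EucSp d) (x : Fin n → EucSp d) :
    corrExt k n (fun i => x i + a) = corrExt k n x := by
  unfold corrExt
  split_ifs
  · rfl
  · exact hk n a x

lemma lintegral_tsum_injTuples {d : ℕ} {μ : Measure (Config d)} [IsProbabilityMeasure μ]
    {k : ∀ n : ℕ, (Fin n → EucSp d) → ℝ} (hk : HasCorrFns μ k) (n : ℕ)
    (f : (Fin n → EucSp d) → ℝ≥0∞) (hf : Measurable f)
    (hsymm : ∀ (σ : Equiv.Perm (Fin n)) (x : Fin n → EucSp d), f (x ∘ σ) = f x) :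
    ∫⁻ γ, ∑' p : injTuples n γ.1, f p.1 ∂μ
      = ∫⁻ x : Fin n → EucSp d, f x * ENNReal.ofReal (corrExt k n x) := by
  rcases Nat.eq_zero_or_pos n with rfl | hn
  · have h1 : ∀ γ : Config d, ∑' p : injTuples 0 γ.1, f p.1 = f Fin.elim0 := by
      intro γ
      rw [tsum_eq_single (⟨Fin.elim0, fun i => i.elim0, fun i => i.elim0⟩ : injTuples 0 γ.1)
        (fun b hb => absurd (Subsingleton.elim _ _) hb)]
    simp only [h1, lintegral_const, measure_univ, mul_one]
    rw [volume_pi, Measure.pi_of_empty (x := Fin.elim0), lintegral_dirac]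
    simp [corrExt]
  · rw [hk.2 n hn f hf hsymm]
    simp [corrExt, hn.ne']

lemma measurable_tsum_finset {d : ℕ} {h : EucSp d → ℝ} (hh : Measurable h) {σ : ℝ → ℝ≥0∞}
    (hσ : Measurable σ) :
    Measurable fun γ : Config d => ∑' s : Finset γ.1, σ (∏ i ∈ s, h i.1) := by
  simp_rw [tsum_finset_eq_tsum_injTuples]
  refine Measurable.tsum fun n => Measurable.const_mul ?_ _
  exact measurable_tsum_injTuples n (F := fun p => σ (∏ i, h (p i)))
    (hσ.comp (Finset.measurable_prod _ fun i _ => hh.comp (measurable_pi_apply i)))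

lemma lintegral_tsum_finset {d : ℕ} {μ : Measure (Config d)} [IsProbabilityMeasure μ]
    {k : ∀ n : ℕ, (Fin n → EucSp d) → ℝ} (hk : HasCorrFns μ k)
    {h : EucSp d → ℝ} (hh : Measurable h) {σ : ℝ → ℝ≥0∞} (hσ : Measurable σ) :
    ∫⁻ γ, ∑' s : Finset γ.1, σ (∏ i ∈ s, h i.1) ∂μ
      = ∑' n : ℕ, (n.factorial : ℝ≥0∞)⁻¹ *
        ∫⁻ x : Fin n → EucSp d, σ (∏ i, h (x i)) * ENNReal.ofReal (corrExt k n x) := by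
  simp_rw [tsum_finset_eq_tsum_injTuples]
  have hm : ∀ n : ℕ, Measurable fun p : Fin n → EucSp d => σ (∏ i, h (p i)) := fun n =>
    hσ.comp (Finset.measurable_prod _ fun i _ => hh.comp (measurable_pi_apply i))
  rw [lintegral_tsum fun n => ((measurable_tsum_injTuples n (hm n)).const_mul _).aemeasurable]
  refine tsum_congr fun n => ?_
  rw [lintegral_const_mul _ (measurable_tsum_injTuples n (hm n)),
    lintegral_tsum_injTuples hk n (fun p => σ (∏ i, h (p i))) (hm n)]
  intro τ x
  simp only [Function.comp_apply]
  rw [Equiv.prod_comp τ (fun i => h (x i))]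

lemma lintegral_prod_pi_fin {E : Type*} [MeasureSpace E] [SigmaFinite (volume : Measure E)]
    (n : ℕ) : ∀ (f : Fin n → E → ℝ≥0∞) (_ : ∀ i, Measurable (f i)),
    ∫⁻ x : Fin n → E, ∏ i, f i (x i) = ∏ i, ∫⁻ x, f i x := by
  induction n with
  | zero =>
    intro f _
    simp [volume_pi]
  | succ n ih =>
    intro f hf
    have hm : Measurable fun x : Fin n → E => ∏ i : Fin n, f i.succ (x i) :=
      Finset.measurable_prod _ fun i _ => (hf i.succ).comp (measurable_pi_apply i)
    have h1 := (volume_preserving_piFinSuccAbove (fun _ : Fin (n + 1) => E) 0).symm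
    rw [← h1.lintegral_comp_emb (MeasurableEquiv.measurableEmbedding _)]
    simp only [Fin.prod_univ_succ, MeasurableEquiv.piFinSuccAbove_symm_apply]
    have h2 : ∀ a : E × (Fin n → E), f 0 ((Fin.insertNthEquiv (fun _ : Fin (n + 1) => E) 0) a 0)
        * ∏ i : Fin n, f i.succ ((Fin.insertNthEquiv (fun _ : Fin (n + 1) => E) 0) a i.succ)
        = f 0 a.1 * ∏ i : Fin n, f i.succ (a.2 i) := by
      intro a
      simp [Fin.insertNthEquiv]
    simp_rw [h2]
    rw [Measure.volume_eq_prod, lintegral_prod_mul (hf 0).aemeasurable hm.aemeasurable, ih _ fun i => hf i.succ]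

lemma lintegral_prod_pow_fin {E : Type*} [MeasureSpace E] [SigmaFinite (volume : Measure E)]
    (n : ℕ) {f : E → ℝ≥0∞} (hf : Measurable f) :
    ∫⁻ x : Fin n → E, ∏ i, f (x i) = (∫⁻ x, f x) ^ n := by
  rw [lintegral_prod_pi_fin n (fun _ => f) fun _ => hf]
  simp

lemma tsum_inv_factorial_mul_pow (t : ℝ) (ht : 0 ≤ t) :
    ∑' n : ℕ, (n.factorial : ℝ≥0∞)⁻¹ * ENNReal.ofReal t ^ n = ENNReal.ofReal (Real.exp t) := by
  have h := NormedSpace.expSeries_div_hasSum_exp (𝔸 := ℝ) t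
  rw [Real.exp_eq_exp_ℝ, ← h.tsum_eq, ENNReal.ofReal_tsum_of_nonneg (fun n => by positivity)
    h.summable]
  refine tsum_congr fun n => ?_
  rw [div_eq_inv_mul, ENNReal.ofReal_mul (by positivity), ENNReal.ofReal_pow ht,
    ENNReal.ofReal_inv_of_pos (by positivity), ENNReal.ofReal_natCast]

lemma lintegral_prod_mul_corr_le {d : ℕ} {k : ∀ n : ℕ, (Fin n → EucSp d) → ℝ} {ξ : ℝ} (hξ : 0 ≤ ξ)
    (hR : RuelleBound k ξ) {g : EucSp d → ℝ≥0∞} (hg : Measurable g) (n : ℕ) :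
    ∫⁻ x : Fin n → EucSp d, (∏ i, g (x i)) * ENNReal.ofReal (corrExt k n x)
      ≤ (ENNReal.ofReal ξ * ∫⁻ x, g x) ^ n := by
  have hm : Measurable fun x : Fin n → EucSp d => ∏ i, g (x i) :=
    Finset.measurable_prod _ fun i _ => hg.comp (measurable_pi_apply i)
  calc _ ≤ ∫⁻ x : Fin n → EucSp d, (∏ i, g (x i)) * ENNReal.ofReal (ξ ^ n) := by
        gcongr with x
        exact corrExt_le hR n x
    _ = _ := by
        rw [lintegral_mul_const _ hm, lintegral_prod_pow_fin n hg, mul_pow, ENNReal.ofReal_pow hξ,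
          mul_comm]

/-- Bound on the mean of `∏ (1 + |h|)` over a configuration. -/
lemma lintegral_tsum_finset_abs_le {d : ℕ} {μ : Measure (Config d)} [IsProbabilityMeasure μ]
    {k : ∀ n : ℕ, (Fin n → EucSp d) → ℝ} (hk : HasCorrFns μ k) {ξ : ℝ} (hξ : 0 ≤ ξ)
    (hR : RuelleBound k ξ) {h : EucSp d → ℝ} (hh : Measurable h)
    (hintg : ∫⁻ x, ENNReal.ofReal |h x| ≠ ⊤) :
    ∫⁻ γ, ∑' s : Finset γ.1, ENNReal.ofReal |∏ i ∈ s, h i.1| ∂μ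
      ≤ ENNReal.ofReal (Real.exp (ξ * (∫⁻ x, ENNReal.ofReal |h x|).toReal)) := by
  rw [lintegral_tsum_finset hk hh (σ := fun t => ENNReal.ofReal |t|)
    (continuous_abs.measurable.ennreal_ofReal),
    ← tsum_inv_factorial_mul_pow _ (mul_nonneg hξ ENNReal.toReal_nonneg)]
  gcongr with n
  refine le_trans (le_of_eq ?_) ((lintegral_prod_mul_corr_le hξ hR
    (g := fun x => ENNReal.ofReal |h x|) (continuous_abs.measurable.comp hh).ennreal_ofReal n).trans
    (le_of_eq ?_))
  · refine lintegral_congr fun x => ?_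
    rw [Finset.abs_prod, ENNReal.ofReal_prod_of_nonneg fun i _ => abs_nonneg _]
  · rw [ENNReal.ofReal_mul hξ, ENNReal.ofReal_toReal hintg]

lemma ofReal_exp_tsum_le {ι : Type*} {q : ι → ℝ} (hq : ∀ i, 0 ≤ q i) :
    ENNReal.ofReal (Real.exp (∑' i, q i))
      ≤ ∑' s : Finset ι, ENNReal.ofReal |∏ i ∈ s, (Real.exp (q i) - 1)| := by
  have hpos : ∀ i, 0 ≤ Real.exp (q i) - 1 := fun i => by
    have := Real.add_one_le_exp (q i); linarith [hq i]
  have hfin : ∀ s : Finset ι, ENNReal.ofReal (Real.exp (∑ i ∈ s, q i))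
      ≤ ∑' s : Finset ι, ENNReal.ofReal |∏ i ∈ s, (Real.exp (q i) - 1)| := by
    intro s
    have h1 : Real.exp (∑ i ∈ s, q i) = ∑ t ∈ s.powerset, ∏ i ∈ t, (Real.exp (q i) - 1) := by
      rw [Real.exp_sum, ← Finset.prod_one_add]
      simp
    rw [h1, ENNReal.ofReal_sum_of_nonneg fun t _ => Finset.prod_nonneg fun i _ => hpos i]
    refine le_trans (le_of_eq ?_) (ENNReal.sum_le_tsum s.powerset)
    refine Finset.sum_congr rfl fun t _ => ?_
    rw [abs_of_nonneg (Finset.prod_nonneg fun i _ => hpos i)]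
  by_cases hs : Summable q
  · have h2 : Tendsto (fun s : Finset ι => ENNReal.ofReal (Real.exp (∑ i ∈ s, q i))) atTop
        (𝓝 (ENNReal.ofReal (Real.exp (∑' i, q i)))) :=
      (ENNReal.continuous_ofReal.tendsto _).comp ((Real.continuous_exp.tendsto _).comp hs.hasSum)
    exact le_of_tendsto' h2 hfin
  · rw [tsum_eq_zero_of_not_summable hs]
    simpa using hfin ∅

/-- Exponential moments of nonnegative linear statistics. -/
lemma lintegral_exp_tsum_le {d : ℕ} {μ : Measure (Config d)} [IsProbabilityMeasure μ]
    {k : ∀ n : ℕ, (Fin n → EucSp d) → ℝ} (hk : HasCorrFns μ k) {ξ : ℝ} (hξ : 0 ≤ ξ)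
    (hR : RuelleBound k ξ) {q : EucSp d → ℝ} (hq : ∀ x, 0 ≤ q x) (hqm : Measurable q)
    (hintg : ∫⁻ x, ENNReal.ofReal (Real.exp (q x) - 1) ≠ ⊤) :
    ∫⁻ γ, ENNReal.ofReal (Real.exp (∑' u : γ.1, q u.1)) ∂μ
      ≤ ENNReal.ofReal (Real.exp (ξ * (∫⁻ x, ENNReal.ofReal (Real.exp (q x) - 1)).toReal)) := by
  have habs : ∀ x, |Real.exp (q x) - 1| = Real.exp (q x) - 1 := fun x => abs_of_nonneg (by
    have := Real.add_one_le_exp (q x); linarith [hq x])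
  have h := lintegral_tsum_finset_abs_le hk hξ hR (h := fun x => Real.exp (q x) - 1)
    ((Real.measurable_exp.comp hqm).sub_const 1) (by simpa only [habs] using hintg)
  simp only [habs] at h
  exact (lintegral_mono fun γ : Config d => ofReal_exp_tsum_le fun u : γ.1 => hq u.1).trans h

/-- `∏_{u ∈ γ} (1 + h u)`, written as a sum over finite subsets. -/
def cfgProd {d : ℕ} (h : EucSp d → ℝ) (γ : Config d) : ℝ := ∑' s : Finset γ.1, ∏ i ∈ s, h i.1

/-- The value of `∫ ∏_{u ∈ γ} (1 + h u) dμ` in terms of the correlation functions. -/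
def corrGen {d : ℕ} (k : ∀ n : ℕ, (Fin n → EucSp d) → ℝ) (h : EucSp d → ℝ) : ℝ :=
  ∑' n : ℕ, (n.factorial : ℝ)⁻¹ * ∫ x : Fin n → EucSp d, (∏ i, h (x i)) * corrExt k n x

lemma ae_summable {d : ℕ} {μ : Measure (Config d)} [IsProbabilityMeasure μ]
    {k : ∀ n : ℕ, (Fin n → EucSp d) → ℝ} (hk : HasCorrFns μ k) {ξ : ℝ} (hξ : 0 ≤ ξ)
    (hR : RuelleBound k ξ) {h : EucSp d → ℝ} (hh : Measurable h)
    (hintg : ∫⁻ x, ENNReal.ofReal |h x| ≠ ⊤) :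
    ∀ᵐ γ ∂μ, Summable fun u : γ.1 => ‖h u.1‖ := by
  have h1 := lintegral_tsum_finset_abs_le hk hξ hR hh hintg
  have h2 : ∫⁻ γ, ∑' s : Finset γ.1, ENNReal.ofReal |∏ i ∈ s, h i.1| ∂μ ≠ ⊤ :=
    (h1.trans_lt ENNReal.ofReal_lt_top).ne
  have h3 := ae_lt_top (measurable_tsum_finset hh (σ := fun t => ENNReal.ofReal |t|)
    (continuous_abs.measurable.ennreal_ofReal)) h2
  filter_upwards [h3] with γ hγ
  have h4 := ENNReal.summable_toReal hγ.ne
  have h5 := h4.comp_injective (i := fun u : γ.1 => ({u} : Finset γ.1)) Finset.singleton_injective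
  refine h5.congr fun u => ?_
  simp [ENNReal.toReal_ofReal (abs_nonneg _)]

lemma hasProd_cfgProd {d : ℕ} {h : EucSp d → ℝ} {γ : Config d}
    (hs : Summable fun u : γ.1 => ‖h u.1‖) :
    HasProd (fun u : γ.1 => 1 + h u.1) (cfgProd h γ) :=
  hasProd_one_add_of_hasSum_prod (summable_finsetProd_of_summable_norm hs).hasSum

lemma cfgProd_mul {d : ℕ} {h₁ h₂ : EucSp d → ℝ} {γ : Config d}
    (hs₁ : Summable fun u : γ.1 => ‖h₁ u.1‖) (hs₂ : Summable fun u : γ.1 => ‖h₂ u.1‖) :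
    cfgProd h₁ γ * cfgProd h₂ γ = cfgProd (fun x => h₁ x + h₂ x + h₁ x * h₂ x) γ := by
  have h12 : Summable fun u : γ.1 => ‖h₁ u.1 * h₂ u.1‖ := by
    simp_rw [norm_mul]
    exact (hs₁.mul_of_nonneg hs₂ (fun _ => norm_nonneg _) fun _ => norm_nonneg _).comp_injective
      (i := fun u : γ.1 => (u, u)) fun u v huv => (Prod.ext_iff.1 huv).1
  have hs : Summable fun u : γ.1 => ‖h₁ u.1 + h₂ u.1 + h₁ u.1 * h₂ u.1‖ :=
    ((hs₁.add hs₂).add h12).of_nonneg_of_le (fun _ => norm_nonneg _) fun u => norm_add₃_le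
  refine ((hasProd_cfgProd hs₁).mul (hasProd_cfgProd hs₂)).unique ?_
  have he : (fun u : γ.1 => (1 + h₁ u.1) * (1 + h₂ u.1))
      = fun u : γ.1 => 1 + (h₁ u.1 + h₂ u.1 + h₁ u.1 * h₂ u.1) := by
    funext u
    ring
  rw [he]
  exact hasProd_cfgProd (h := fun x => h₁ x + h₂ x + h₁ x * h₂ x) hs

lemma cfgProd_exp {d : ℕ} {q : EucSp d → ℝ} {γ : Config d} (hq : Summable fun u : γ.1 => q u.1)
    (hs : Summable fun u : γ.1 => ‖Real.exp (q u.1) - 1‖) :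
    Real.exp (∑' u : γ.1, q u.1) = cfgProd (fun x => Real.exp (q x) - 1) γ := by
  have h1 : HasProd (fun u : γ.1 => Real.exp (q u.1)) (Real.exp (∑' u : γ.1, q u.1)) := by
    have h := (Real.continuous_exp.tendsto _).comp hq.hasSum
    simp only [HasProd, Function.comp_def, Real.exp_sum] at h ⊢
    exact h
  have he : (fun u : γ.1 => Real.exp (q u.1)) = fun u : γ.1 => 1 + (Real.exp (q u.1) - 1) := by
    funext u
    ring
  rw [he] at h1
  exact h1.unique (hasProd_cfgProd (h := fun x => Real.exp (q x) - 1) hs)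

lemma integrable_prod_mul_corr {d : ℕ} {μ : Measure (Config d)}
    {k : ∀ n : ℕ, (Fin n → EucSp d) → ℝ} (hk : HasCorrFns μ k) {ξ : ℝ}
    (hR : RuelleBound k ξ) {n : ℕ} {h : Fin n → EucSp d → ℝ} (hh : ∀ i, Measurable (h i))
    (hintg : ∀ i, ∫⁻ x, ENNReal.ofReal |h i x| ≠ ⊤) :
    Integrable (fun x : Fin n → EucSp d => (∏ i, h i (x i)) * corrExt k n x) := by
  have h1 : Integrable (fun x : Fin n → EucSp d => ∏ i, h i (x i)) := by
    refine ⟨(Finset.measurable_prod _ fun i _ =>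
      (hh i).comp (measurable_pi_apply i)).aestronglyMeasurable, ?_⟩
    simp only [hasFiniteIntegral_iff_norm, Real.norm_eq_abs, Finset.abs_prod]
    have : ∀ x : Fin n → EucSp d, ENNReal.ofReal (∏ i, |h i (x i)|)
        = ∏ i, ENNReal.ofReal |h i (x i)| := fun x =>
      ENNReal.ofReal_prod_of_nonneg fun i _ => abs_nonneg _
    simp_rw [this]
    rw [lintegral_prod_pi_fin n (fun i x => ENNReal.ofReal |h i x|)
      fun i => (continuous_abs.measurable.comp (hh i)).ennreal_ofReal]
    exact ENNReal.prod_lt_top fun i _ => (hintg i).lt_top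
  refine h1.mul_bdd (c := ξ ^ n) (corrExt_measurable hk n).aestronglyMeasurable
    (Eventually.of_forall fun x => ?_)
  rw [Real.norm_eq_abs, abs_of_nonneg (corrExt_nonneg hk n x)]
  exact corrExt_le hR n x

/-- The generating functional of the correlation functions. -/
lemma integral_cfgProd {d : ℕ} {μ : Measure (Config d)} [IsProbabilityMeasure μ]
    {k : ∀ n : ℕ, (Fin n → EucSp d) → ℝ} (hk : HasCorrFns μ k) {ξ : ℝ} (hξ : 0 ≤ ξ)
    (hR : RuelleBound k ξ) {h : EucSp d → ℝ} (hh : Measurable h)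
    (hintg : ∫⁻ x, ENNReal.ofReal |h x| ≠ ⊤) :
    AEStronglyMeasurable (cfgProd h) μ ∧ ∫ γ, cfgProd h γ ∂μ = corrGen k h := by
  have hle := (lintegral_tsum_finset_abs_le hk hξ hR hh hintg).trans_lt ENNReal.ofReal_lt_top
  have hsum := ae_summable hk hξ hR hh hintg
  have mP := measurable_tsum_finset hh (σ := fun t => ENNReal.ofReal t)
    ENNReal.measurable_ofReal
  have mN := measurable_tsum_finset hh (σ := fun t => ENNReal.ofReal (-t))
    measurable_neg.ennreal_ofReal
  have fP : ∫⁻ γ, ∑' s : Finset γ.1, ENNReal.ofReal (∏ i ∈ s, h i.1) ∂μ ≠ ⊤ := by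
    refine (lt_of_le_of_lt ?_ hle).ne
    gcongr with γ s
    exact le_abs_self _
  have fN : ∫⁻ γ, ∑' s : Finset γ.1, ENNReal.ofReal (-∏ i ∈ s, h i.1) ∂μ ≠ ⊤ := by
    refine (lt_of_le_of_lt ?_ hle).ne
    gcongr with γ s
    exact neg_le_abs _
  have hae : (cfgProd h) =ᵐ[μ] fun γ =>
      (∑' s : Finset γ.1, ENNReal.ofReal (∏ i ∈ s, h i.1)).toReal
        - (∑' s : Finset γ.1, ENNReal.ofReal (-∏ i ∈ s, h i.1)).toReal := by
    filter_upwards [hsum] with γ hγ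
    exact tsum_eq_toReal_sub_toReal (summable_finsetProd_of_summable_norm hγ)
  refine ⟨((mP.ennreal_toReal.sub mN.ennreal_toReal).aestronglyMeasurable).congr hae.symm, ?_⟩
  rw [integral_congr_ae hae, integral_sub (integrable_toReal_of_lintegral_ne_top mP.aemeasurable fP)
    (integrable_toReal_of_lintegral_ne_top mN.aemeasurable fN),
    integral_toReal mP.aemeasurable (ae_lt_top mP fP),
    integral_toReal mN.aemeasurable (ae_lt_top mN fN)]
  rw [lintegral_tsum_finset hk hh (σ := fun t => ENNReal.ofReal t) ENNReal.measurable_ofReal] at fP ⊢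
  rw [lintegral_tsum_finset hk hh (σ := fun t => ENNReal.ofReal (-t))
    measurable_neg.ennreal_ofReal] at fN ⊢
  rw [ENNReal.tsum_toReal_eq (ENNReal.ne_top_of_tsum_ne_top fP),
    ENNReal.tsum_toReal_eq (ENNReal.ne_top_of_tsum_ne_top fN),
    ← (ENNReal.summable_toReal fP).tsum_sub (ENNReal.summable_toReal fN)]
  unfold corrGen
  refine tsum_congr fun n => ?_
  rw [integral_eq_lintegral_pos_part_sub_lintegral_neg_part
    (integrable_prod_mul_corr hk hR (fun _ => hh) fun _ => hintg)]
  rw [ENNReal.toReal_mul, ENNReal.toReal_mul, ← mul_sub, ENNReal.toReal_inv, ENNReal.toReal_natCast]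
  congr 4
  · funext x
    rw [ENNReal.ofReal_mul' (corrExt_nonneg hk n x)]
  · funext x
    rw [← neg_mul, ENNReal.ofReal_mul' (corrExt_nonneg hk n x)]

/-- The pair potential as a real valued function, set to zero at the origin. -/
def realPot {d : ℕ} (φ : EucSp d → EReal) (x : EucSp d) : ℝ := if x = 0 then 0 else (φ x).toReal

lemma measurable_realPot {d : ℕ} {φ : EucSp d → EReal} (hφ : IsPairPotential φ) :
    Measurable (realPot φ) :=
  Measurable.ite (measurableSet_singleton 0) measurable_const hφ.meas.ereal_toReal

lemma coe_realPot {d : ℕ} {φ : EucSp d → EReal} (hφ : IsPairPotential φ) {x : EucSp d}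
    (hx : x ≠ 0) : (realPot φ x : EReal) = φ x := by
  rw [realPot, if_neg hx, EReal.coe_toReal (hφ.finite_off x hx) (hφ.ne_bot x)]

lemma realPot_neg {d : ℕ} {φ : EucSp d → EReal} (hφ : IsPairPotential φ) (x : EucSp d) :
    realPot φ (-x) = realPot φ x := by
  by_cases hx : x = 0
  · simp [hx]
  · rw [realPot, realPot, if_neg hx, if_neg (neg_ne_zero.2 hx), hφ.even x hx]

lemma realPot_lower {d : ℕ} {φ : EucSp d → EReal} {B : ℝ} (hφ : IsPairPotential φ) (hB : 0 ≤ B)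
    (hS : Stable φ B) (x : EucSp d) : -(2 * B) ≤ realPot φ x := by
  by_cases hx : x = 0
  · simp [realPot, hx, hB]
  · have h := hS {x, 0}
    have hoff : ({x, 0} : Finset (EucSp d)).offDiag = {(x, 0), (0, x)} := by
      ext ⟨p, q⟩
      simp only [Finset.mem_offDiag, Finset.mem_insert, Finset.mem_singleton, Prod.mk.injEq]
      constructor
      · rintro ⟨rfl | rfl, rfl | rfl, h⟩ <;> simp_all
      · rintro (⟨rfl, rfl⟩ | ⟨rfl, rfl⟩)
        · exact ⟨Or.inl rfl, Or.inr rfl, hx⟩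
        · exact ⟨Or.inr rfl, Or.inl rfl, Ne.symm hx⟩
    rw [hoff, Finset.sum_pair (by simp [hx]), Finset.card_pair hx] at h
    simp only [sub_zero, zero_sub] at h
    rw [hφ.even x hx, ← coe_realPot hφ hx, ← EReal.coe_add, EReal.coe_le_coe_iff] at h
    push_cast at h
    linarith

/-- The negative part of the potential. -/
def negPot {d : ℕ} (φ : EucSp d → EReal) (x : EucSp d) : ℝ := max (-realPot φ x) 0

lemma measurable_negPot {d : ℕ} {φ : EucSp d → EReal} (hφ : IsPairPotential φ) :
    Measurable (negPot φ) := (measurable_realPot hφ).neg.max measurable_const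

lemma negPot_nonneg {d : ℕ} (φ : EucSp d → EReal) (x : EucSp d) : 0 ≤ negPot φ x :=
  le_max_right _ _

lemma negPot_le {d : ℕ} {φ : EucSp d → EReal} {B : ℝ} (hφ : IsPairPotential φ) (hB : 0 ≤ B)
    (hS : Stable φ B) (x : EucSp d) : negPot φ x ≤ 2 * B :=
  max_le (by linarith [realPot_lower hφ hB hS x]) (by linarith)

lemma neg_realPot_le {d : ℕ} (φ : EucSp d → EReal) (x : EucSp d) : -realPot φ x ≤ negPot φ x :=
  le_max_left _ _

lemma exp_sub_one_le_mul_exp {x : ℝ} : Real.exp x - 1 ≤ x * Real.exp x := by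
  have h := Real.add_one_le_exp (-x)
  have h2 : Real.exp (-x) * Real.exp x = 1 := by rw [← Real.exp_add]; simp
  nlinarith [Real.exp_pos x]

lemma exp_negPot_sub_one_le {d : ℕ} {φ : EucSp d → EReal} {B : ℝ} (hφ : IsPairPotential φ)
    (hB : 0 ≤ B) (hS : Stable φ B) {t : ℝ} (ht : 0 ≤ t) (x : EucSp d) :
    Real.exp (t * negPot φ x) - 1
      ≤ t * Real.exp (t * (2 * B)) * |Real.exp (-realPot φ x) - 1| := by
  have h1 : negPot φ x ≤ |Real.exp (-realPot φ x) - 1| := by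
    refine max_le ?_ (abs_nonneg _)
    have := Real.add_one_le_exp (-realPot φ x)
    exact le_trans (by linarith) (le_abs_self _)
  have h2 : Real.exp (t * negPot φ x) ≤ Real.exp (t * (2 * B)) :=
    Real.exp_le_exp.2 (mul_le_mul_of_nonneg_left (negPot_le hφ hB hS x) ht)
  calc _ ≤ t * negPot φ x * Real.exp (t * negPot φ x) := exp_sub_one_le_mul_exp
    _ ≤ t * |Real.exp (-realPot φ x) - 1| * Real.exp (t * (2 * B)) := by gcongr
    _ = _ := by ring

lemma abs_rpow_sub_one_le {t p : ℝ} (ht : 0 < t) (hp0 : 0 ≤ p) (hp1 : p ≤ 1) :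
    |t ^ p - 1| ≤ |t - 1| := by
  rcases le_total 1 t with h | h
  · have h1 : t ^ p ≤ t := by
      simpa using Real.rpow_le_rpow_of_exponent_le h hp1
    have h2 : 1 ≤ t ^ p := Real.one_le_rpow h hp0
    rw [abs_of_nonneg (by linarith), abs_of_nonneg (by linarith)]
    linarith
  · have h1 : t ≤ t ^ p := by
      simpa using Real.rpow_le_rpow_of_exponent_ge ht h hp1
    have h2 : t ^ p ≤ 1 := Real.rpow_le_one ht.le h hp0
    rw [abs_of_nonpos (by linarith), abs_of_nonpos (by linarith)]
    linarith

/-- The Mayer type function `exp((s - 1) φ) - 1`. -/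
def mayer {d : ℕ} (s : ℝ) (φ : EucSp d → EReal) (x : EucSp d) : ℝ :=
  Real.exp ((s - 1) * realPot φ x) - 1

lemma measurable_mayer {d : ℕ} {s : ℝ} {φ : EucSp d → EReal} (hφ : IsPairPotential φ) :
    Measurable (mayer s φ) :=
  ((measurable_realPot hφ).const_mul _).exp.sub_const _

lemma mayer_neg {d : ℕ} {s : ℝ} {φ : EucSp d → EReal} (hφ : IsPairPotential φ) (x : EucSp d) :
    mayer s φ (-x) = mayer s φ x := by
  rw [mayer, realPot_neg hφ, mayer]

lemma abs_mayer_le {d : ℕ} {s : ℝ} (hs0 : 0 ≤ s) (hs1 : s ≤ 1) (φ : EucSp d → EReal)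
    (x : EucSp d) : |mayer s φ x| ≤ |Real.exp (-realPot φ x) - 1| := by
  have h := abs_rpow_sub_one_le (Real.exp_pos (-realPot φ x)) (p := 1 - s) (by linarith)
    (by linarith)
  rw [← Real.exp_mul] at h
  rw [mayer]
  convert h using 4
  ring

lemma abs_mayer_le_const {d : ℕ} {s B : ℝ} {φ : EucSp d → EReal} (hs0 : 0 ≤ s) (hs1 : s ≤ 1)
    (hφ : IsPairPotential φ) (hB : 0 ≤ B) (hS : Stable φ B) (x : EucSp d) :
    |mayer s φ x| ≤ Real.exp (2 * B) + 1 := by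
  refine (abs_mayer_le hs0 hs1 φ x).trans ?_
  have h1 : Real.exp (-realPot φ x) ≤ Real.exp (2 * B) :=
    Real.exp_le_exp.2 (by linarith [realPot_lower hφ hB hS x])
  have h2 := Real.exp_pos (-realPot φ x)
  rw [abs_le]
  constructor <;> linarith [Real.exp_pos (2 * B)]

lemma nullSingletonClass_eucSp {d : ℕ} (hd : 0 < d) : NullSingletonClass (volume : Measure (EucSp d)) := by
  have : Nonempty (Fin d) := ⟨⟨0, hd⟩⟩
  infer_instance

lemma rexp_coe (r : ℝ) : rexp (r : EReal) = Real.exp r := by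
  rw [rexp, eexp, if_neg (EReal.coe_ne_top r), if_neg (EReal.coe_ne_bot r), EReal.toReal_coe,
    ENNReal.toReal_ofReal (Real.exp_pos r).le]

lemma rexp_top : rexp ⊤ = 0 := by simp [rexp, eexp]

lemma rexp_bot : rexp ⊥ = 0 := by simp [rexp, eexp]

lemma rexp_nonneg (u : EReal) : 0 ≤ rexp u := ENNReal.toReal_nonneg

lemma rexp_add (u v : EReal) : rexp (u + v) = rexp u * rexp v := by
  induction u with
  | bot => simp [rexp_bot]
  | top =>
    induction v with
    | bot => simp [rexp_bot]
    | top => simp [rexp_top]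
    | coe v => simp [rexp_top]
  | coe u =>
    induction v with
    | bot => simp [rexp_bot]
    | top => simp [rexp_top]
    | coe v => rw [← EReal.coe_add, rexp_coe, rexp_coe, rexp_coe, Real.exp_add]

lemma Setting.lintegral_exp_neg_sub_one {d : ℕ} {s z B ξ : ℝ} {φ : EucSp d → EReal}
    {μ : Measure (Config d)} {k u : ∀ n : ℕ, (Fin n → EucSp d) → ℝ}
    (h : Setting d s z B ξ φ μ k u) :
    ∫⁻ x, ENNReal.ofReal |Real.exp (-realPot φ x) - 1| ≠ ⊤ := by
  have := nullSingletonClass_eucSp h.hd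
  have h1 := (h.laht.trans ENNReal.ofReal_lt_top).ne
  have h2 : ∀ᵐ x : EucSp d, ENNReal.ofReal (|rexp (-(φ x)) - 1| * z)
      = ENNReal.ofReal |Real.exp (-realPot φ x) - 1| * ENNReal.ofReal z := by
    filter_upwards [compl_mem_ae_iff.2 (measure_singleton (0 : EucSp d))] with x hx
    rw [← coe_realPot h.pp hx, ← EReal.coe_neg, rexp_coe, ENNReal.ofReal_mul (abs_nonneg _)]
  rw [lintegral_congr_ae h2, lintegral_mul_const' _ _ ENNReal.ofReal_ne_top] at h1
  intro h3
  rw [h3, ENNReal.top_mul (ENNReal.ofReal_pos.2 h.hz).ne'] at h1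
  exact h1 rfl

lemma Setting.lintegral_mayer {d : ℕ} {s z B ξ : ℝ} {φ : EucSp d → EReal}
    {μ : Measure (Config d)} {k u : ∀ n : ℕ, (Fin n → EucSp d) → ℝ}
    (h : Setting d s z B ξ φ μ k u) :
    ∫⁻ x, ENNReal.ofReal |mayer s φ x| ≠ ⊤ :=
  ne_top_of_le_ne_top h.lintegral_exp_neg_sub_one <| lintegral_mono fun x =>
    ENNReal.ofReal_le_ofReal (abs_mayer_le h.hs0 (by linarith [h.hs1]) φ x)

lemma Setting.exp_moment {d : ℕ} {s z B ξ : ℝ} {φ : EucSp d → EReal}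
    {μ : Measure (Config d)} {k u : ∀ n : ℕ, (Fin n → EucSp d) → ℝ}
    (h : Setting d s z B ξ φ μ k u) {t : ℝ} (ht : 0 ≤ t) :
    ∃ m : ℝ, ∀ y : EucSp d,
      ∫⁻ γ : Config d, ENNReal.ofReal (Real.exp (t * ∑' u : γ.1, negPot φ (y - u.1))) ∂μ
        ≤ ENNReal.ofReal m := by
  have := h.prob
  have hfin : ∫⁻ x, ENNReal.ofReal (Real.exp (t * negPot φ x) - 1) ≠ ⊤ := by
    refine ne_top_of_le_ne_top (ENNReal.mul_ne_top (ENNReal.ofReal_ne_top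
      (r := t * Real.exp (t * (2 * B)))) h.lintegral_exp_neg_sub_one) ?_
    rw [← lintegral_const_mul' _ _ ENNReal.ofReal_ne_top]
    refine lintegral_mono fun x => ?_
    rw [← ENNReal.ofReal_mul (mul_nonneg ht (Real.exp_pos _).le)]
    exact ENNReal.ofReal_le_ofReal (exp_negPot_sub_one_le h.pp h.hB h.stable ht x)
  refine ⟨Real.exp (ξ * (∫⁻ x, ENNReal.ofReal (Real.exp (t * negPot φ x) - 1)).toReal),
    fun y => ?_⟩
  have hy : ∫⁻ x, ENNReal.ofReal (Real.exp (t * negPot φ (y - x)) - 1)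
      = ∫⁻ x, ENNReal.ofReal (Real.exp (t * negPot φ x) - 1) :=
    lintegral_sub_left_eq_self (fun x => ENNReal.ofReal (Real.exp (t * negPot φ x) - 1)) y
  have h1 := lintegral_exp_tsum_le h.corr h.hξ.le h.ruelle (q := fun x => t * negPot φ (y - x))
    (fun x => mul_nonneg ht (negPot_nonneg φ _))
    (((measurable_negPot h.pp).comp (measurable_const.sub measurable_id)).const_mul t)
    (by rw [hy]; exact hfin)
  rw [hy] at h1
  simpa only [tsum_mul_left] using h1

lemma Setting.ae_notMem {d : ℕ} {s z B ξ : ℝ} {φ : EucSp d → EReal}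
    {μ : Measure (Config d)} {k u : ∀ n : ℕ, (Fin n → EucSp d) → ℝ}
    (h : Setting d s z B ξ φ μ k u) (y : EucSp d) : ∀ᵐ γ : Config d ∂μ, y ∉ γ.1 := by
  have := nullSingletonClass_eucSp h.hd
  have := h.prob
  have hm : Measurable (({y} : Set (EucSp d)).indicator fun _ => (1 : ℝ≥0∞)) :=
    measurable_const.indicator (measurableSet_singleton y)
  have h1 := h.gnz (fun _ x => ({y} : Set (EucSp d)).indicator (fun _ => (1 : ℝ≥0∞)) x)
    (hm.comp measurable_snd)
  have h2 : ∀ γ : Config d, ∫⁻ x : EucSp d, ENNReal.ofReal z * eexp (-(energy φ x γ.1)) *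
      ({y} : Set (EucSp d)).indicator (fun _ => (1 : ℝ≥0∞)) x = 0 := fun γ => by
    refine lintegral_eq_zero_of_ae_eq_zero ?_
    filter_upwards [compl_mem_ae_iff.2 (measure_singleton y)] with x hx
    simp [Set.indicator_of_notMem hx]
  simp only [h2, lintegral_zero] at h1
  rw [← lintegral_congr fun γ : Config d => lintegral_cfgCount γ
    (({y} : Set (EucSp d)).indicator fun _ => (1 : ℝ≥0∞))] at h1
  have h3 := (lintegral_eq_zero_iff (f := fun γ : Config d => ∫⁻ x,
    ({y} : Set (EucSp d)).indicator (fun _ => (1 : ℝ≥0∞)) x ∂(cfgCount γ))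
    ((Measure.measurable_lintegral hm).comp measurable_cfgCount)).1 h1
  filter_upwards [h3] with γ hγ hy
  simp only [Pi.zero_apply, lintegral_cfgCount] at hγ
  have h3 := ENNReal.tsum_eq_zero.1 hγ ⟨y, hy⟩
  simp at h3

/-- A summand that is dominated outside a ball is summable over a configuration. -/
lemma summable_config_of_bound {d : ℕ} (γ : Config d) (y : EucSp d) {f g : EucSp d → ℝ} {R : ℝ}
    (hfg : ∀ x, R ≤ ‖x‖ → |f x| ≤ g x)
    (hg : Summable fun u : γ.1 => g (y - u.1)) : Summable fun u : γ.1 => f (y - u.1) := by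
  have hK : (γ.1 ∩ Metric.closedBall y R).Finite := γ.2 _ (isCompact_closedBall y R)
  have hfin : ((fun u : γ.1 => u.1) ⁻¹' (γ.1 ∩ Metric.closedBall y R)).Finite :=
    hK.preimage Subtype.val_injective.injOn
  refine Summable.of_norm_bounded_eventually (g := fun u : γ.1 => g (y - u.1)) hg ?_
  refine Filter.mem_of_superset hfin.compl_mem_cofinite fun u hu => ?_
  refine hfg (y - u.1) ?_
  rw [← dist_eq_norm, dist_comm]
  exact (not_le.1 fun hle => hu ⟨u.2, Metric.mem_closedBall.2 hle⟩).le

lemma Setting.ae_summable_realPot {d : ℕ} {s z B ξ : ℝ} {φ : EucSp d → EReal}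
    {μ : Measure (Config d)} {k u : ∀ n : ℕ, (Fin n → EucSp d) → ℝ}
    (h : Setting d s z B ξ φ μ k u) (y : EucSp d) :
    ∀ᵐ γ : Config d ∂μ, Summable fun u : γ.1 => realPot φ (y - u.1) := by
  have := h.prob
  obtain ⟨R, C, hRC⟩ := h.bddOutside
  have hintg : ∫⁻ x, ENNReal.ofReal |Real.exp (-realPot φ (y - x)) - 1| ≠ ⊤ := by
    rw [lintegral_sub_left_eq_self (fun x => ENNReal.ofReal |Real.exp (-realPot φ x) - 1|) y]
    exact h.lintegral_exp_neg_sub_one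
  have h1 := ae_summable h.corr h.hξ.le h.ruelle
    (h := fun x => Real.exp (-realPot φ (y - x)) - 1)
    ((((measurable_realPot h.pp).comp (measurable_const.sub measurable_id)).neg).exp.sub_const _)
    hintg
  filter_upwards [h1] with γ hγ
  refine summable_config_of_bound γ y (R := max R 1)
    (g := fun x => Real.exp C * ‖Real.exp (-realPot φ x) - 1‖) (fun x hx => ?_)
    (hγ.mul_left _)
  obtain ⟨r, hr, hrC⟩ := hRC x ((le_max_left _ _).trans hx)
  have hx0 : x ≠ 0 := by
    rintro rfl
    have := (le_max_right R 1).trans hx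
    norm_num at this
  have hpr : realPot φ x = r := by rw [realPot, if_neg hx0, hr, EReal.toReal_coe]
  rw [hpr, Real.norm_eq_abs]
  have hC0 : 1 ≤ Real.exp C := Real.one_le_exp ((abs_nonneg r).trans hrC)
  rcases le_total r 0 with hr0 | hr0
  · have h2 := Real.add_one_le_exp (-r)
    rw [abs_of_nonpos hr0, abs_of_nonneg (by linarith)]
    nlinarith
  · have h2 := Real.add_one_le_exp r
    have h3 : Real.exp r ≤ Real.exp C := Real.exp_le_exp.2 ((le_abs_self r).trans hrC)
    have h4 : Real.exp (-r) ≤ 1 := Real.exp_le_one_iff.2 (by linarith)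
    have h5 : Real.exp r * Real.exp (-r) = 1 := by rw [← Real.exp_add]; simp
    rw [abs_of_nonneg hr0, abs_of_nonpos (by linarith)]
    nlinarith

lemma energy_eq_of_summable {d : ℕ} {φ : EucSp d → EReal} (hφ : IsPairPotential φ) {y : EucSp d}
    {γ : Config d} (hy : y ∉ γ.1) (hs : Summable fun u : γ.1 => realPot φ (y - u.1)) :
    energy φ y γ.1 = ((∑' u : γ.1, realPot φ (y - u.1) : ℝ) : EReal) := by
  have h1 : ∀ u : γ.1, (φ (y - u.1)).toReal = realPot φ (y - u.1) := fun u => by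
    rw [realPot, if_neg]
    rintro h
    rw [sub_eq_zero] at h
    exact hy (h ▸ u.2)
  have h2 : ∀ u ∈ γ.1, φ (y - u) ≠ ⊤ := fun u hu =>
    hφ.finite_off _ fun h => hy (by rw [sub_eq_zero] at h; exact h ▸ hu)
  simp only [energy, h1]
  rw [if_pos ⟨h2, hs⟩]

lemma energy_eq_top {d : ℕ} {φ : EucSp d → EReal} {y : EucSp d}
    {γ : Config d} (hy : y ∉ γ.1) (hs : ¬ Summable fun u : γ.1 => realPot φ (y - u.1)) :
    energy φ y γ.1 = ⊤ := by
  have h1 : ∀ u : γ.1, (φ (y - u.1)).toReal = realPot φ (y - u.1) := fun u => by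
    rw [realPot, if_neg]
    rintro h
    rw [sub_eq_zero] at h
    exact hy (h ▸ u.2)
  simp only [energy, h1]
  rw [if_neg fun h => hs h.2]

lemma tsum_neg_realPot_le {d : ℕ} {φ : EucSp d → EReal} {y : EucSp d}
    {γ : Config d} (hs : Summable fun u : γ.1 => realPot φ (y - u.1)) {t : ℝ} (ht0 : 0 ≤ t)
    (ht1 : t ≤ 1) :
    -(t * ∑' u : γ.1, realPot φ (y - u.1)) ≤ ∑' u : γ.1, negPot φ (y - u.1) := by
  have hs2 : Summable fun u : γ.1 => negPot φ (y - u.1) :=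
    hs.abs.of_nonneg_of_le (fun u => negPot_nonneg φ _) fun u =>
      max_le (neg_le_abs _) (abs_nonneg _)
  have h1 : -∑' u : γ.1, realPot φ (y - u.1) ≤ ∑' u : γ.1, negPot φ (y - u.1) := by
    rw [← tsum_neg]
    exact hs.neg.tsum_le_tsum (fun u => neg_realPot_le φ _) hs2
  have h2 : 0 ≤ ∑' u : γ.1, negPot φ (y - u.1) := tsum_nonneg fun u => negPot_nonneg φ _
  nlinarith

lemma rexp_energy_le {d : ℕ} {s : ℝ} (hs0 : 0 ≤ s) (hs1 : s < 1) {φ : EucSp d → EReal}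
    (hφ : IsPairPotential φ) {y : EucSp d} {γ : Config d} (hy : y ∉ γ.1) :
    rexp (((s - 1 : ℝ) : EReal) * energy φ y γ.1)
      ≤ Real.exp (∑' u : γ.1, negPot φ (y - u.1)) := by
  by_cases hs : Summable fun u : γ.1 => realPot φ (y - u.1)
  · rw [energy_eq_of_summable hφ hy hs, ← EReal.coe_mul, rexp_coe]
    have := tsum_neg_realPot_le hs (t := 1 - s) (by linarith) (by linarith)
    exact Real.exp_le_exp.2 (by linarith)
  · rw [energy_eq_top hy hs, EReal.coe_mul_top_of_neg (by linarith), rexp_bot]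
    exact (Real.exp_pos _).le

lemma eexp_mul_rexp_sq_le {d : ℕ} {s : ℝ} (hs0 : 0 ≤ s) (hs1 : s ≤ 1 / 2) {φ : EucSp d → EReal}
    (hφ : IsPairPotential φ) {y : EucSp d} {γ : Config d} (hy : y ∉ γ.1) :
    eexp (-(energy φ y γ.1)) * ENNReal.ofReal (rexp ((s : EReal) * energy φ y γ.1) ^ 2)
      ≤ ENNReal.ofReal (Real.exp (∑' u : γ.1, negPot φ (y - u.1))) := by
  by_cases hs : Summable fun u : γ.1 => realPot φ (y - u.1)
  · rw [energy_eq_of_summable hφ hy hs, ← EReal.coe_mul, rexp_coe, ← EReal.coe_neg]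
    have h0 : ∀ r : ℝ, eexp (r : EReal) = ENNReal.ofReal (Real.exp r) := fun r => by
      rw [eexp, if_neg (EReal.coe_ne_top r), if_neg (EReal.coe_ne_bot r), EReal.toReal_coe]
    rw [h0, ← ENNReal.ofReal_mul (Real.exp_pos _).le, sq, ← Real.exp_add, ← Real.exp_add]
    have := tsum_neg_realPot_le hs (t := 1 - 2 * s) (by linarith) (by linarith)
    exact ENNReal.ofReal_le_ofReal (Real.exp_le_exp.2 (by linarith))
  · rw [energy_eq_top hy hs]
    simp [eexp]

lemma Setting.ae_rexp_energy_eq {d : ℕ} {s z B ξ : ℝ} {φ : EucSp d → EReal}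
    {μ : Measure (Config d)} {k u : ∀ n : ℕ, (Fin n → EucSp d) → ℝ}
    (h : Setting d s z B ξ φ μ k u) (y : EucSp d) :
    ∀ᵐ γ : Config d ∂μ, y ∉ γ.1 ∧ (Summable fun u : γ.1 => ‖mayer s φ (y - u.1)‖) ∧
      rexp (((s - 1 : ℝ) : EReal) * energy φ y γ.1) = cfgProd (fun x => mayer s φ (y - x)) γ ∧
      0 < rexp (((s - 1 : ℝ) : EReal) * energy φ y γ.1) := by
  have := h.prob
  have hintg : ∫⁻ x, ENNReal.ofReal |mayer s φ (y - x)| ≠ ⊤ := by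
    rw [lintegral_sub_left_eq_self (fun x => ENNReal.ofReal |mayer s φ x|) y]
    exact h.lintegral_mayer
  filter_upwards [h.ae_notMem y, h.ae_summable_realPot y, ae_summable h.corr h.hξ.le h.ruelle
    (h := fun x => mayer s φ (y - x)) ((measurable_mayer h.pp).comp
      (measurable_const.sub measurable_id)) hintg] with γ h1 h2 h3
  refine ⟨h1, h3, ?_⟩
  rw [energy_eq_of_summable h.pp h1 h2, ← EReal.coe_mul, rexp_coe]
  refine ⟨?_, Real.exp_pos _⟩
  rw [← tsum_mul_left]
  exact cfgProd_exp (q := fun x => (s - 1) * realPot φ (y - x)) (h2.mul_left _) h3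

lemma energy_zero {d : ℕ} {φ : EucSp d → EReal} (hφ : IsPairPotential φ) {γ : Config d}
    (h0 : (0 : EucSp d) ∉ γ.1) : energy φ 0 γ.1 = totPhi φ γ.1 := by
  have h1 : ∀ u ∈ γ.1, φ (0 - u) = φ u := fun u hu => by
    rw [zero_sub, hφ.even u fun h => h0 (h ▸ hu)]
  have h2 : ∀ u : γ.1, φ (0 - u.1) = φ u.1 := fun u => h1 u.1 u.2
  have h3 : (∀ u ∈ γ.1, φ (0 - u) ≠ ⊤) ↔ ∀ u ∈ γ.1, φ u ≠ ⊤ :=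
    forall₂_congr fun u hu => by rw [h1 u hu]
  simp only [energy, totPhi, h2, h3]

/-- The factor `exp((s - 1) E(y, γ))`. -/
def jumpFactor {d : ℕ} (s : ℝ) (φ : EucSp d → EReal) (y : EucSp d) (γ : Config d) : ℝ :=
  rexp (((s - 1 : ℝ) : EReal) * energy φ y γ.1)

lemma measurable_const_mul_ereal (r : ℝ) : Measurable fun u : EReal => (r : EReal) * u := by
  fun_prop

lemma measurable_jumpFactor {d : ℕ} (s : ℝ) {φ : EucSp d → EReal} (hφ : Measurable φ) :
    Measurable fun p : EucSp d × Config d => jumpFactor s φ p.1 p.2 :=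
  measurable_rexp.comp ((measurable_const_mul_ereal _).comp
    (measurable_energy hφ measurable_snd measurable_fst))

lemma corrGen_shift {d : ℕ} {k : ∀ n : ℕ, (Fin n → EucSp d) → ℝ} (hti : TransInvFns k)
    (h : EucSp d → ℝ) (a : EucSp d) : corrGen k (fun x => h (x - a)) = corrGen k h := by
  refine tsum_congr fun n => ?_
  congr 1
  rw [← integral_add_right_eq_self _ (fun _ : Fin n => a)]
  refine integral_congr_ae (Eventually.of_forall fun x => ?_)
  have := corrExt_add hti n a x
  simp only [Pi.add_apply, add_sub_cancel_right]
  rw [← this]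
  rfl

lemma mayer_sub_comm {d : ℕ} {s : ℝ} {φ : EucSp d → EReal} (hφ : IsPairPotential φ)
    (x y : EucSp d) : mayer s φ (y - x) = mayer s φ (x - y) := by
  rw [← mayer_neg hφ, neg_sub]

lemma Setting.lintegral_mayer_sub {d : ℕ} {s z B ξ : ℝ} {φ : EucSp d → EReal}
    {μ : Measure (Config d)} {k u : ∀ n : ℕ, (Fin n → EucSp d) → ℝ}
    (h : Setting d s z B ξ φ μ k u) (y : EucSp d) :
    ∫⁻ x, ENNReal.ofReal |mayer s φ (x - y)| ≠ ⊤ := by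
  rw [lintegral_sub_right_eq_self (fun x => ENNReal.ofReal |mayer s φ x|) y]
  exact h.lintegral_mayer

lemma Setting.ae_jumpFactor {d : ℕ} {s z B ξ : ℝ} {φ : EucSp d → EReal}
    {μ : Measure (Config d)} {k u : ∀ n : ℕ, (Fin n → EucSp d) → ℝ}
    (h : Setting d s z B ξ φ μ k u) (y : EucSp d) :
    ∀ᵐ γ : Config d ∂μ, y ∉ γ.1 ∧ (Summable fun u : γ.1 => ‖mayer s φ (u.1 - y)‖) ∧
      jumpFactor s φ y γ = cfgProd (fun x => mayer s φ (x - y)) γ ∧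
      0 < jumpFactor s φ y γ := by
  filter_upwards [h.ae_rexp_energy_eq y] with γ hγ
  simp only [mayer_sub_comm h.pp _ y] at hγ
  exact hγ

lemma Setting.integral_jumpFactor {d : ℕ} {s z B ξ : ℝ} {φ : EucSp d → EReal}
    {μ : Measure (Config d)} {k u : ∀ n : ℕ, (Fin n → EucSp d) → ℝ}
    (h : Setting d s z B ξ φ μ k u) (y : EucSp d) :
    ∫ γ, jumpFactor s φ y γ ∂μ = corrGen k (mayer s φ) := by
  have := h.prob
  rw [integral_congr_ae ((h.ae_jumpFactor y).mono fun γ hγ => hγ.2.2.1),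
    (integral_cfgProd h.corr h.hξ.le h.ruelle (h := fun x => mayer s φ (x - y))
      ((measurable_mayer h.pp).comp (measurable_id.sub measurable_const))
      (h.lintegral_mayer_sub y)).2]
  exact corrGen_shift h.ti _ y

lemma Setting.lintegral_jumpFactor_pow_le {d : ℕ} {s z B ξ : ℝ} {φ : EucSp d → EReal}
    {μ : Measure (Config d)} {k u : ∀ n : ℕ, (Fin n → EucSp d) → ℝ}
    (h : Setting d s z B ξ φ μ k u) (p : ℕ) :
    ∃ m : ℝ, ∀ y : EucSp d,
      ∫⁻ γ, ENNReal.ofReal (jumpFactor s φ y γ ^ p) ∂μ ≤ ENNReal.ofReal m := by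
  obtain ⟨m, hm⟩ := h.exp_moment (t := p) (Nat.cast_nonneg p)
  refine ⟨m, fun y => le_trans (lintegral_mono_ae ?_) (hm y)⟩
  filter_upwards [h.ae_notMem y] with γ hγ
  refine ENNReal.ofReal_le_ofReal ?_
  rw [Real.exp_nat_mul]
  exact pow_le_pow_left₀ (rexp_nonneg _)
    (rexp_energy_le h.hs0 (by linarith [h.hs1]) h.pp hγ) p

lemma Setting.memLp_jumpFactor {d : ℕ} {s z B ξ : ℝ} {φ : EucSp d → EReal}
    {μ : Measure (Config d)} {k u : ∀ n : ℕ, (Fin n → EucSp d) → ℝ}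
    (h : Setting d s z B ξ φ μ k u) (y : EucSp d) : MemLp (jumpFactor s φ y) 2 μ := by
  have hm : Measurable (jumpFactor s φ y) :=
    (measurable_jumpFactor s h.pp.meas).comp measurable_prodMk_left
  rw [memLp_two_iff_integrable_sq hm.aestronglyMeasurable]
  refine ⟨(hm.pow_const 2).aestronglyMeasurable, ?_⟩
  obtain ⟨m, hm⟩ := h.lintegral_jumpFactor_pow_le 2
  rw [hasFiniteIntegral_iff_ofReal (Eventually.of_forall fun γ => sq_nonneg _)]
  exact (hm y).trans_lt ENNReal.ofReal_lt_top

lemma Setting.integral_totPhi {d : ℕ} {s z B ξ : ℝ} {φ : EucSp d → EReal}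
    {μ : Measure (Config d)} {k u : ∀ n : ℕ, (Fin n → EucSp d) → ℝ}
    (h : Setting d s z B ξ φ μ k u) :
    ∫ γ, rexp (((s - 1 : ℝ) : EReal) * totPhi φ γ.1) ∂μ = corrGen k (mayer s φ) := by
  rw [← h.integral_jumpFactor 0]
  refine integral_congr_ae ?_
  filter_upwards [h.ae_notMem 0] with γ hγ
  rw [jumpFactor, energy_zero h.pp hγ]

lemma Setting.corrGen_mayer_pos {d : ℕ} {s z B ξ : ℝ} {φ : EucSp d → EReal}
    {μ : Measure (Config d)} {k u : ∀ n : ℕ, (Fin n → EucSp d) → ℝ}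
    (h : Setting d s z B ξ φ μ k u) : 0 < corrGen k (mayer s φ) := by
  have := h.prob
  rw [← h.integral_jumpFactor 0, integral_pos_iff_support_of_nonneg (f := jumpFactor s φ 0) (fun γ => rexp_nonneg _)
    ((h.memLp_jumpFactor 0).integrable (by norm_num))]
  refine pos_iff_ne_zero.2 fun h0 => ?_
  have h1 : ∀ᵐ γ ∂μ, γ ∉ Function.support (jumpFactor s φ 0) := measure_eq_zero_iff_ae_notMem.1 h0
  obtain ⟨γ, hγ1, hγ2⟩ := (h1.and (h.ae_jumpFactor 0)).exists
  exact hγ1 hγ2.2.2.2.ne'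

/-- The contribution of the block `b` to the cluster expansion at the points `x`. -/
def blockVal {d N : ℕ} (u : ∀ n : ℕ, (Fin n → EucSp d) → ℝ) (x : Fin N → EucSp d)
    (b : Finset (Fin N)) : ℝ :=
  u b.card (fun i => x (b.orderIsoOfFin rfl i).1)

lemma blockVal_eq {d N m : ℕ} (u : ∀ n : ℕ, (Fin n → EucSp d) → ℝ) (x : Fin N → EucSp d)
    {b : Finset (Fin N)} (hm : b.card = m) {f : Fin m → Fin N} (hf : StrictMono f)
    (hb : ∀ i, f i ∈ b) : blockVal u x b = u m (fun i => x (f i)) := by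
  subst hm
  rw [Finset.orderEmbOfFin_unique rfl hb hf]
  rfl

lemma blockVal_map {d n N : ℕ} (u : ∀ n : ℕ, (Fin n → EucSp d) → ℝ) (x : Fin N → EucSp d)
    (e : Fin n ↪o Fin N) (b : Finset (Fin n)) :
    blockVal u x (b.map e.toEmbedding) = blockVal u (fun i => x (e i)) b := by
  rw [blockVal_eq u x (m := b.card) (Finset.card_map _) (f := fun i => e (b.orderEmbOfFin rfl i))
    (e.strictMono.comp (b.orderEmbOfFin rfl).strictMono) fun i =>
      Finset.mem_map_of_mem _ (b.orderEmbOfFin_mem rfl i)]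
  rfl

/-- The partitions of the finite set `T` into nonempty blocks. -/
def parts {N : ℕ} (T : Finset (Fin N)) : Finset (Finset (Finset (Fin N))) :=
  Finset.univ.filter fun P => (∀ b ∈ P, b.Nonempty) ∧
    (P : Set (Finset (Fin N))).PairwiseDisjoint id ∧ P.sup id = T

lemma mem_parts {N : ℕ} {T : Finset (Fin N)} {P : Finset (Finset (Fin N))} :
    P ∈ parts T ↔ (∀ b ∈ P, b.Nonempty) ∧
      (P : Set (Finset (Fin N))).PairwiseDisjoint id ∧ P.sup id = T := by
  simp [parts]

lemma subset_of_mem_parts {N : ℕ} {T : Finset (Fin N)} {P : Finset (Finset (Fin N))}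
    (hP : P ∈ parts T) {b : Finset (Fin N)} (hb : b ∈ P) : b ⊆ T :=
  (mem_parts.1 hP).2.2 ▸ Finset.le_sup (f := id) hb

/-- Sum over the partitions of `T` of the products of the block values. -/
def partSum {N : ℕ} (U : Finset (Fin N) → ℝ) (T : Finset (Fin N)) : ℝ :=
  ∑ P ∈ parts T, ∏ b ∈ P, U b

lemma partSum_empty {N : ℕ} (U : Finset (Fin N) → ℝ) : partSum U ∅ = 1 := by
  have h : parts (∅ : Finset (Fin N)) = {∅} := by
    ext P
    rw [mem_parts, Finset.mem_singleton]
    constructor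
    · rintro ⟨h1, -, h3⟩
      refine Finset.eq_empty_of_forall_notMem fun b hb => ?_
      have h4 : b ⊆ ∅ := h3 ▸ Finset.le_sup (f := id) hb
      obtain ⟨i, hi⟩ := h1 b hb
      exact absurd (h4 hi) (Finset.notMem_empty i)
    · rintro rfl
      simp
  simp [partSum, h]

lemma partSum_map {n N : ℕ} (U : Finset (Fin N) → ℝ) (e : Fin n ↪o Fin N)
    (T : Finset (Fin n)) :
    partSum (fun b => U (b.map e.toEmbedding)) T = partSum U (T.map e.toEmbedding) := by
  have hinj : Function.Injective fun b : Finset (Fin n) => b.map e.toEmbedding :=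
    Finset.map_injective _
  have hback : ∀ b : Finset (Fin N), b ⊆ T.map e.toEmbedding →
      (Finset.univ.filter fun i => e i ∈ b).map e.toEmbedding = b := by
    intro b hb
    ext j
    simp only [Finset.mem_map, Finset.mem_filter, Finset.mem_univ, true_and]
    constructor
    · rintro ⟨i, hi, rfl⟩
      exact hi
    · intro hj
      obtain ⟨i, -, rfl⟩ := Finset.mem_map.1 (hb hj)
      exact ⟨i, hj, rfl⟩
  have hforth : ∀ b : Finset (Fin n),
      (Finset.univ.filter fun i => e i ∈ b.map e.toEmbedding) = b := by
    intro b
    ext i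
    simp
  have hsup : ∀ P : Finset (Finset (Fin n)),
      (P.image fun b => b.map e.toEmbedding).sup id = (P.sup id).map e.toEmbedding := by
    intro P
    ext j
    simp only [Finset.mem_sup, Finset.mem_map, id, Finset.mem_image]
    constructor
    · rintro ⟨_, ⟨b, hb, rfl⟩, hj⟩
      obtain ⟨i, hi, rfl⟩ := Finset.mem_map.1 hj
      exact ⟨i, ⟨b, hb, hi⟩, rfl⟩
    · rintro ⟨i, ⟨b, hb, hi⟩, rfl⟩
      exact ⟨_, ⟨b, hb, rfl⟩, Finset.mem_map_of_mem _ hi⟩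
  have hiff : ∀ P : Finset (Finset (Fin n)),
      (P.image fun b => b.map e.toEmbedding) ∈ parts (T.map e.toEmbedding) ↔ P ∈ parts T := by
    intro P
    rw [mem_parts, mem_parts, hsup, (Finset.map_injective _).eq_iff]
    simp only [Finset.forall_mem_image, Finset.map_nonempty]
    refine and_congr_right fun _ => and_congr_left fun _ => ?_
    rw [Finset.coe_image, Set.InjOn.pairwiseDisjoint_image (hinj.injOn)]
    simp [Set.PairwiseDisjoint, Set.Pairwise, Function.onFun]
  refine Finset.sum_bij (fun P _ => P.image fun b => b.map e.toEmbedding)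
    (fun P hP => (hiff P).2 hP) (fun P _ Q _ h => Finset.image_injective hinj h) ?_ ?_
  · intro Q hQ
    have hQ' : (Q.image fun b => Finset.univ.filter fun i => e i ∈ b).image
        (fun b => b.map e.toEmbedding) = Q := by
      rw [Finset.image_image]
      conv_rhs => rw [← Finset.image_id (s := Q)]
      exact Finset.image_congr fun b hb => hback b (subset_of_mem_parts hQ hb)
    exact ⟨_, (hiff _).1 (hQ'.symm ▸ hQ), hQ'⟩
  · intro P _
    rw [Finset.prod_image hinj.injOn]

/-- Products of partition sums over complementary sets are sums over partitions without blocks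
that meet both sets. -/
lemma partSum_mul_compl {N : ℕ} (U : Finset (Fin N) → ℝ) (S : Finset (Fin N)) :
    partSum U S * partSum U Sᶜ
      = ∑ P ∈ (parts Finset.univ).filter (fun P => ∀ b ∈ P, b ⊆ S ∨ b ⊆ Sᶜ), ∏ b ∈ P, U b := by
  rw [partSum, partSum, Finset.sum_mul_sum, ← Finset.sum_product']
  have key : ∀ b : Finset (Fin N), b.Nonempty → b ⊆ S → b ⊆ Sᶜ → False := by
    rintro b ⟨i, hi⟩ h1 h2
    exact Finset.mem_compl.1 (h2 hi) (h1 hi)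
  refine Finset.sum_bij' (fun p _ => p.1 ∪ p.2)
    (fun P _ => (P.filter (· ⊆ S), P.filter (· ⊆ Sᶜ))) ?_ ?_ ?_ ?_ ?_
  · rintro ⟨P, Q⟩ h
    obtain ⟨hP, hQ⟩ := Finset.mem_product.1 h
    simp only at hP hQ ⊢
    rw [Finset.mem_filter, mem_parts]
    refine ⟨⟨?_, ?_, ?_⟩, ?_⟩
    · intro b hb
      rcases Finset.mem_union.1 hb with hb | hb
      exacts [(mem_parts.1 hP).1 b hb, (mem_parts.1 hQ).1 b hb]
    · intro b hb c hc hbc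
      rcases Finset.mem_union.1 hb with hb | hb <;> rcases Finset.mem_union.1 hc with hc | hc
      · exact (mem_parts.1 hP).2.1 hb hc hbc
      · exact Finset.disjoint_of_subset_left (subset_of_mem_parts hP hb)
          (Finset.disjoint_of_subset_right (subset_of_mem_parts hQ hc) disjoint_compl_right)
      · exact Finset.disjoint_of_subset_left (subset_of_mem_parts hQ hb)
          (Finset.disjoint_of_subset_right (subset_of_mem_parts hP hc) disjoint_compl_left)
      · exact (mem_parts.1 hQ).2.1 hb hc hbc
    · rw [Finset.sup_union, (mem_parts.1 hP).2.2, (mem_parts.1 hQ).2.2]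
      exact Finset.union_compl S
    · intro b hb
      rcases Finset.mem_union.1 hb with hb | hb
      exacts [Or.inl (subset_of_mem_parts hP hb), Or.inr (subset_of_mem_parts hQ hb)]
  · intro P h
    obtain ⟨hP, hS⟩ := Finset.mem_filter.1 h
    have hun : ∀ i, ∃ b ∈ P, i ∈ b := fun i => by
      have : i ∈ P.sup id := (mem_parts.1 hP).2.2 ▸ Finset.mem_univ i
      simpa [Finset.mem_sup] using this
    have hsub : ∀ R : Finset (Fin N), (∀ i ∈ R, ∀ b ∈ P, i ∈ b → b ⊆ R) →
        P.filter (· ⊆ R) ∈ parts R := by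
      intro R hR
      refine mem_parts.2 ⟨fun b hb => (mem_parts.1 hP).1 b (Finset.mem_filter.1 hb).1,
        (mem_parts.1 hP).2.1.subset (Finset.coe_subset.2 (Finset.filter_subset _ _)), ?_⟩
      refine le_antisymm (Finset.sup_le fun b hb => (Finset.mem_filter.1 hb).2) fun i hi => ?_
      obtain ⟨b, hb, hib⟩ := hun i
      exact Finset.mem_sup.2 ⟨b, Finset.mem_filter.2 ⟨hb, hR i hi b hb hib⟩, hib⟩
    refine Finset.mem_product.2 ⟨hsub S fun i hi b hb hib => (hS b hb).resolve_right fun h2 =>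
      Finset.mem_compl.1 (h2 hib) hi, hsub Sᶜ fun i hi b hb hib => (hS b hb).resolve_left
      fun h2 => Finset.mem_compl.1 hi (h2 hib)⟩
  · rintro ⟨P, Q⟩ h
    obtain ⟨hP, hQ⟩ := Finset.mem_product.1 h
    simp only at hP hQ ⊢
    rw [Prod.mk.injEq]
    constructor
    · ext b
      simp only [Finset.mem_filter, Finset.mem_union]
      constructor
      · rintro ⟨hb | hb, h2⟩
        · exact hb
        · exact (key b ((mem_parts.1 hQ).1 b hb) h2 (subset_of_mem_parts hQ hb)).elim
      · exact fun hb => ⟨Or.inl hb, subset_of_mem_parts hP hb⟩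
    · ext b
      simp only [Finset.mem_filter, Finset.mem_union]
      constructor
      · rintro ⟨hb | hb, h2⟩
        · exact (key b ((mem_parts.1 hP).1 b hb) (subset_of_mem_parts hP hb) h2).elim
        · exact hb
      · exact fun hb => ⟨Or.inr hb, subset_of_mem_parts hQ hb⟩
  · intro P h
    obtain ⟨hP, hS⟩ := Finset.mem_filter.1 h
    ext b
    simp only [Finset.mem_filter, Finset.mem_union]
    constructor
    · rintro (h | h) <;> exact h.1
    · exact fun hb => (hS b hb).imp (fun h => ⟨hb, h⟩) fun h => ⟨hb, h⟩
  · rintro ⟨P, Q⟩ h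
    obtain ⟨hP, hQ⟩ := Finset.mem_product.1 h
    simp only at hP hQ ⊢
    rw [Finset.prod_union]
    refine Finset.disjoint_left.2 fun b hb hb2 =>
      key b ((mem_parts.1 hP).1 b hb) (subset_of_mem_parts hP hb) (subset_of_mem_parts hQ hb2)

lemma corrExt_eq_partSum_univ {d : ℕ} {k u : ∀ n : ℕ, (Fin n → EucSp d) → ℝ} (h : IsUrsell k u)
    (N : ℕ) (x : Fin N → EucSp d) :
    corrExt k N x = partSum (blockVal u x) Finset.univ := by
  rcases Nat.eq_zero_or_pos N with rfl | hN
  · rw [Finset.univ_eq_empty, partSum_empty, corrExt, if_pos rfl]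
  · rw [corrExt, if_neg hN.ne', h N hN x, partSum, parts, Finset.sum_filter]
    refine Finset.sum_congr rfl fun P _ => ?_
    unfold IsPartOfUniv
    congr

/-- The correlation function of the points with indices in `T`. -/
def corrOn {d N : ℕ} (k : ∀ n : ℕ, (Fin n → EucSp d) → ℝ) (x : Fin N → EucSp d)
    (T : Finset (Fin N)) : ℝ :=
  corrExt k T.card (fun i => x (T.orderEmbOfFin rfl i))

lemma corrOn_eq_partSum {d : ℕ} {k u : ∀ n : ℕ, (Fin n → EucSp d) → ℝ} (h : IsUrsell k u)
    {N : ℕ} (x : Fin N → EucSp d) (T : Finset (Fin N)) :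
    corrOn k x T = partSum (blockVal u x) T := by
  rw [corrOn, corrExt_eq_partSum_univ h]
  have h1 : (Finset.univ : Finset (Fin T.card)).map (T.orderEmbOfFin rfl).toEmbedding = T := by
    rw [Finset.map_orderEmbOfFin_univ]
  conv_rhs => rw [← h1]
  rw [← partSum_map]
  congr 1
  funext b
  exact (blockVal_map u x _ b).symm

lemma corrExt_sub_corrOn {d : ℕ} {k u : ∀ n : ℕ, (Fin n → EucSp d) → ℝ} (h : IsUrsell k u)
    {N : ℕ} (x : Fin N → EucSp d) (S : Finset (Fin N)) :
    corrExt k N x - corrOn k x S * corrOn k x Sᶜ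
      = ∑ P ∈ (parts Finset.univ).filter (fun P => ¬ ∀ b ∈ P, b ⊆ S ∨ b ⊆ Sᶜ),
        ∏ b ∈ P, blockVal u x b := by
  rw [corrExt_eq_partSum_univ h, corrOn_eq_partSum h, corrOn_eq_partSum h, partSum_mul_compl,
    partSum, sub_eq_iff_eq_add, add_comm, Finset.sum_filter_add_sum_filter_not]

lemma ursell_eq_sub {d : ℕ} {k u : ∀ n : ℕ, (Fin n → EucSp d) → ℝ} (h : IsUrsell k u)
    {n : ℕ} (hn : 0 < n) (x : Fin n → EucSp d) :
    u n x = k n x - ∑ P ∈ (parts Finset.univ).erase {Finset.univ}, ∏ b ∈ P, blockVal u x b := by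
  have hne : (Finset.univ : Finset (Fin n)).Nonempty := ⟨⟨0, hn⟩, Finset.mem_univ _⟩
  have h1 : ({Finset.univ} : Finset (Finset (Fin n))) ∈ parts Finset.univ := by
    rw [mem_parts]
    simp [hne]
  have h2 := corrExt_eq_partSum_univ h n x
  rw [corrExt, if_neg hn.ne', partSum, ← Finset.add_sum_erase _ _ h1, Finset.prod_singleton,
    blockVal_eq u x (f := fun i => i) (Finset.card_fin n) strictMono_id
      (fun i => Finset.mem_univ _)] at h2
  rw [h2]
  ring

lemma card_lt_of_mem_parts_erase {n : ℕ} {P : Finset (Finset (Fin n))}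
    (hP : P ∈ (parts Finset.univ).erase {Finset.univ}) {b : Finset (Fin n)} (hb : b ∈ P) :
    0 < b.card ∧ b.card < n := by
  obtain ⟨hne, hP⟩ := Finset.mem_erase.1 hP
  obtain ⟨h1, h2, h3⟩ := mem_parts.1 hP
  refine ⟨Finset.card_pos.2 (h1 b hb), ?_⟩
  by_contra hcon
  have hbu : b = Finset.univ := by
    rw [← Finset.card_eq_iff_eq_univ, Fintype.card_fin]
    exact le_antisymm (by simpa using Finset.card_le_univ b) (not_lt.1 hcon)
  refine hne (Finset.eq_singleton_iff_unique_mem.2 ⟨hbu ▸ hb, fun c hc => ?_⟩)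
  by_contra hcu
  have hd : Disjoint c b := h2 hc hb (by rw [hbu]; exact hcu)
  obtain ⟨i, hi⟩ := h1 c hc
  exact Finset.disjoint_left.1 hd hi (hbu ▸ Finset.mem_univ i)

lemma ursell_regular {d : ℕ} {μ : Measure (Config d)} {k u : ∀ n : ℕ, (Fin n → EucSp d) → ℝ}
    (hk : HasCorrFns μ k) {ξ : ℝ} (hR : RuelleBound k ξ) (hti : TransInvFns k)
    (h : IsUrsell k u) (n : ℕ) : 0 < n →
    Measurable (u n) ∧ (∃ C : ℝ, ∀ x, |u n x| ≤ C) ∧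
      ∀ (a : EucSp d) (x : Fin n → EucSp d), u n (fun i => x i + a) = u n x := by
  induction n using Nat.strong_induction_on with
  | _ n ih =>
  intro hn
  have hfun : u n = fun x => k n x -
      ∑ P ∈ (parts Finset.univ).erase {Finset.univ}, ∏ b ∈ P, blockVal u x b :=
    funext fun x => ursell_eq_sub h hn x
  have hblock : ∀ P ∈ (parts (Finset.univ : Finset (Fin n))).erase {Finset.univ}, ∀ b ∈ P,
      Measurable (u b.card) ∧ (∃ C : ℝ, ∀ x, |u b.card x| ≤ C) ∧
      ∀ (a : EucSp d) (x : Fin b.card → EucSp d), u b.card (fun i => x i + a) = u b.card x :=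
    fun P hP b hb => ih b.card (card_lt_of_mem_parts_erase hP hb).2
      (card_lt_of_mem_parts_erase hP hb).1
  refine ⟨?_, ?_, ?_⟩
  · rw [hfun]
    refine (hk.1 n).1.sub (Finset.measurable_sum _ fun P hP => Finset.measurable_prod _
      fun b hb => ?_)
    exact (hblock P hP b hb).1.comp (measurable_pi_lambda _ fun i => measurable_pi_apply _)
  · have hb : ∀ P ∈ (parts (Finset.univ : Finset (Fin n))).erase {Finset.univ},
        ∃ C : ℝ, ∀ x : Fin n → EucSp d, |∏ b ∈ P, blockVal u x b| ≤ C := by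
      intro P hP
      choose! C hC using fun b hb => (hblock P hP b hb).2.1
      refine ⟨∏ b ∈ P, C b, fun x => ?_⟩
      rw [Finset.abs_prod]
      exact Finset.prod_le_prod (fun b _ => abs_nonneg _) fun b hb => hC b hb _
    choose! C hC using hb
    refine ⟨ξ ^ n + ∑ P ∈ (parts (Finset.univ : Finset (Fin n))).erase {Finset.univ}, C P,
      fun x => ?_⟩
    rw [hfun]
    refine (abs_sub _ _).trans (add_le_add ?_ ((Finset.abs_sum_le_sum_abs _ _).trans
      (Finset.sum_le_sum fun P hP => hC P hP x)))
    rw [abs_of_nonneg ((hk.1 n).2.1 x)]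
    exact hR n hn x
  · intro a x
    rw [hfun]
    simp only
    rw [hti n a x]
    congr 1
    refine Finset.sum_congr rfl fun P hP => Finset.prod_congr rfl fun b hb => ?_
    exact (hblock P hP b hb).2.2 a _

lemma measurePreserving_split {E : Type*} [MeasureSpace E] [SigmaFinite (volume : Measure E)]
    {N m n : ℕ} (S : Finset (Fin N)) (hm : S.card = m) (hn : Sᶜ.card = n) :
    MeasurePreserving (fun x : Fin N → E =>
      ((fun i => x (S.orderEmbOfFin hm i), fun i => x (Sᶜ.orderEmbOfFin hn i)) :
        (Fin m → E) × (Fin n → E))) volume volume := by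
  have h1 := (volume_measurePreserving_piCongrLeft (fun _ : Fin N => E)
    (finSumEquivOfFinset hm hn)).symm
  have h2 := volume_measurePreserving_sumPiEquivProdPi (fun _ : Fin m ⊕ Fin n => E)
  exact h2.comp h1

lemma lintegral_split {E : Type*} [MeasureSpace E] [SigmaFinite (volume : Measure E)]
    {N m n : ℕ} (S : Finset (Fin N)) (hm : S.card = m) (hn : Sᶜ.card = n)
    {F : (Fin m → E) → ℝ≥0∞} {G : (Fin n → E) → ℝ≥0∞} (hF : Measurable F) (hG : Measurable G) :
    ∫⁻ x : Fin N → E, F (fun i => x (S.orderEmbOfFin hm i)) *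
        G (fun i => x (Sᶜ.orderEmbOfFin hn i)) = (∫⁻ y, F y) * ∫⁻ y, G y := by
  have h := (measurePreserving_split (E := E) S hm hn).lintegral_comp
    (f := fun p => F p.1 * G p.2) ((hF.comp measurable_fst).mul (hG.comp measurable_snd))
  rw [h, Measure.volume_eq_prod, lintegral_prod_mul hF.aemeasurable hG.aemeasurable]

lemma integral_split {E : Type*} [MeasureSpace E] [SigmaFinite (volume : Measure E)]
    {N m n : ℕ} (S : Finset (Fin N)) (hm : S.card = m) (hn : Sᶜ.card = n)
    {F : (Fin m → E) → ℝ} {G : (Fin n → E) → ℝ} (hF : Measurable F) (hG : Measurable G) :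
    ∫ x : Fin N → E, F (fun i => x (S.orderEmbOfFin hm i)) *
        G (fun i => x (Sᶜ.orderEmbOfFin hn i)) = (∫ y, F y) * ∫ y, G y := by
  have h := measurePreserving_split (E := E) S hm hn
  have hm : Measurable fun p : (Fin m → E) × (Fin n → E) => F p.1 * G p.2 :=
    (hF.comp measurable_fst).mul (hG.comp measurable_snd)
  rw [← integral_prod_mul, ← Measure.volume_eq_prod, ← h.map_eq,
    integral_map h.measurable.aemeasurable hm.aestronglyMeasurable]

lemma prod_orderEmb {N m n : ℕ} {M : Type*} [CommMonoid M] (S : Finset (Fin N)) (hm : S.card = m)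
    (hn : Sᶜ.card = n) (f : Fin N → M) :
    ∏ i, f i = (∏ i, f (S.orderEmbOfFin hm i)) * ∏ i, f (Sᶜ.orderEmbOfFin hn i) := by
  rw [← (finSumEquivOfFinset hm hn).prod_comp, Fintype.prod_sum_type]
  rfl

lemma prod_le_two {ι : Type*} [Fintype ι] {f : ι → ℝ≥0∞} {W : ℝ≥0∞}
    (hW : 1 ≤ W) (hf : ∀ i, f i ≤ W) {p q : ι} (hpq : p ≠ q) :
    ∏ i, f i ≤ W ^ Fintype.card ι * (f p * f q) := by
  rw [← Finset.mul_prod_erase _ _ (Finset.mem_univ p), ← Finset.mul_prod_erase _ _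
    (Finset.mem_erase.2 ⟨hpq.symm, Finset.mem_univ q⟩), ← mul_assoc, mul_comm (_ ^ _)]
  gcongr
  refine (Finset.prod_le_pow_card _ _ W fun i _ => hf i).trans (pow_le_pow_right₀ hW ?_)
  exact Finset.card_le_univ _

lemma lintegral_anchor {d m : ℕ} {w : EucSp d → ℝ≥0∞} (hw : Measurable w)
    {v : (Fin (m + 1) → EucSp d) → ℝ≥0∞} (hv : Measurable v)
    (hti : ∀ (a : EucSp d) (x), v (fun i => x i + a) = v x) (p : Fin (m + 1)) :
    ∫⁻ z : Fin (m + 1) → EucSp d, w (z p) * v z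
      = (∫⁻ t, w t) * ∫⁻ y : Fin m → EucSp d, v (Fin.cons 0 y) := by
  have hf : Measurable fun z : Fin (m + 1) → EucSp d => w (z p) * v z :=
    (hw.comp (measurable_pi_apply p)).mul hv
  have hcons : ∀ {α : Type} [MeasurableSpace α] {f : α → EucSp d} {g : α → Fin m → EucSp d},
      Measurable f → Measurable g → Measurable fun a => (Fin.cons (f a) (g a) :
        Fin (m + 1) → EucSp d) := by
    intro α _ f g hf hg
    refine measurable_pi_lambda _ fun i => ?_
    refine Fin.cases ?_ (fun j => ?_) i
    · simpa using hf
    · have := (measurable_pi_apply j).comp hg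
      simpa [Function.comp_def] using this
  have h1 := (volume_preserving_piFinSuccAbove (fun _ : Fin (m + 1) => EucSp d) 0).symm
  have h0 := lintegral_prod (μ := (volume : Measure (EucSp d)))
    (ν := (volume : Measure (Fin m → EucSp d))) _ (hf.comp h1.measurable).aemeasurable
  rw [← h1.lintegral_comp hf, Measure.volume_eq_prod]
  refine h0.trans ?_
  simp only [Function.comp_apply]
  have h2 : ∀ (t : EucSp d) (y : Fin m → EucSp d),
      (MeasurableEquiv.piFinSuccAbove (fun _ : Fin (m + 1) => EucSp d) 0).symm (t, y)
        = Fin.cons t y := fun t y => by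
    simp [MeasurableEquiv.piFinSuccAbove_symm_apply, Fin.insertNthEquiv]
  simp only [h2]
  have h3 : ∀ t : EucSp d, ∫⁻ y : Fin m → EucSp d, w ((Fin.cons t y : Fin (m + 1) → EucSp d) p) *
      v (Fin.cons t y) = ∫⁻ y : Fin m → EucSp d,
        w ((Fin.cons 0 y : Fin (m + 1) → EucSp d) p + t) * v (Fin.cons 0 y) := by
    intro t
    rw [← lintegral_add_right_eq_self _ (fun _ : Fin m => t)]
    refine lintegral_congr fun y => ?_
    have h4 : (Fin.cons t (y + fun _ => t) : Fin (m + 1) → EucSp d)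
        = fun i => (Fin.cons 0 y : Fin (m + 1) → EucSp d) i + t := by
      funext i
      refine Fin.cases ?_ (fun j => ?_) i <;> simp
    rw [h4, hti]
  simp only [h3]
  have hc0 : Measurable fun y : Fin m → EucSp d => (Fin.cons 0 y : Fin (m + 1) → EucSp d) :=
    hcons measurable_const measurable_id
  rw [lintegral_lintegral_swap]
  · have h5 : ∀ y : Fin m → EucSp d, ∫⁻ t : EucSp d,
        w ((Fin.cons 0 y : Fin (m + 1) → EucSp d) p + t) * v (Fin.cons 0 y)
          = (∫⁻ t, w t) * v (Fin.cons 0 y) := fun y => by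
      rw [lintegral_mul_const _ (f := fun t => w ((Fin.cons 0 y : Fin (m + 1) → EucSp d) p + t))
        (hw.comp (measurable_const.add measurable_id)), lintegral_add_left_eq_self w]
    simp_rw [h5]
    rw [lintegral_const_mul _ (f := fun y => v (Fin.cons 0 y)) (hv.comp hc0)]
  · refine Measurable.aemeasurable ?_
    refine Measurable.mul (hw.comp ?_) (hv.comp (hc0.comp measurable_snd))
    exact ((measurable_pi_apply p).comp (hc0.comp measurable_snd)).add measurable_fst

/-- Shift by `Y` of the coordinates outside `S`. -/
def offShift {d N : ℕ} (S : Finset (Fin N)) (Y : EucSp d) (i : Fin N) : EucSp d :=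
  if i ∈ S then 0 else Y

lemma measurable_offShift {d N : ℕ} (S : Finset (Fin N)) (i : Fin N) :
    Measurable fun Y : EucSp d => offShift S Y i := by
  unfold offShift
  split_ifs
  · exact measurable_const
  · exact measurable_id

lemma lintegral_block_ne_top {d N : ℕ} {u : ∀ n : ℕ, (Fin n → EucSp d) → ℝ}
    (hu : ∀ n, 0 < n → Measurable (u n))
    (hti : ∀ n, 0 < n → ∀ (a : EucSp d) (x : Fin n → EucSp d), u n (fun i => x i + a) = u n x)
    (hintg : ∀ m : ℕ, ∫⁻ y : Fin (m + 1) → EucSp d,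
      ENNReal.ofReal |u (m + 2) (Fin.cons 0 y)| ≠ ⊤)
    {w : EucSp d → ℝ≥0∞} (hw : Measurable w) {W : ℝ≥0∞} (hW1 : 1 ≤ W) (hWt : W ≠ ⊤)
    (hwW : ∀ x, w x ≤ W) (hwi : ∫⁻ x, w x ≠ ⊤)
    {S b : Finset (Fin N)} {i j : Fin N} (hib : i ∈ b) (hiS : i ∈ S) (hjb : j ∈ b)
    (hjS : j ∉ S) :
    ∫⁻ Y : EucSp d, ∫⁻ x : Fin N → EucSp d, (∏ l, w (x l - offShift S Y l)) *
      ENNReal.ofReal |blockVal u x b| ≠ ⊤ := by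
  have hij : i ≠ j := fun h => hjS (h ▸ hiS)
  obtain ⟨m, hm⟩ : ∃ m, b.card = m + 2 := by
    have : 1 < b.card := Finset.one_lt_card.2 ⟨i, hib, j, hjb, hij⟩
    exact ⟨b.card - 2, by omega⟩
  have hum := hu (m + 2) (by omega)
  obtain ⟨p, hp⟩ : ∃ p, b.orderEmbOfFin hm p = i := by
    have : i ∈ Set.range (b.orderEmbOfFin hm) := by rw [Finset.range_orderEmbOfFin]; exact hib
    exact this
  obtain ⟨q, hq⟩ : ∃ q, b.orderEmbOfFin hm q = j := by
    have : j ∈ Set.range (b.orderEmbOfFin hm) := by rw [Finset.range_orderEmbOfFin]; exact hjb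
    exact this
  have hpq : p ≠ q := fun h => hij (by rw [← hp, ← hq, h])
  have hbv : ∀ x : Fin N → EucSp d, blockVal u x b = u (m + 2) fun l => x (b.orderEmbOfFin hm l) :=
    fun x => blockVal_eq u x hm (b.orderEmbOfFin hm).strictMono fun l => b.orderEmbOfFin_mem hm l
  have hshift : ∀ c : EucSp d, ∫⁻ t, w (t - c) = ∫⁻ t, w t := fun c =>
    lintegral_sub_right_eq_self w c
  have hin : ∀ Y : EucSp d, ∫⁻ x : Fin N → EucSp d, (∏ l, w (x l - offShift S Y l)) *
      ENNReal.ofReal |blockVal u x b| ≤ (∫⁻ z : Fin (m + 2) → EucSp d,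
        W ^ (m + 2) * (w (z p) * w (z q - Y) * ENNReal.ofReal |u (m + 2) z|)) *
          (∫⁻ t, w t) ^ bᶜ.card := by
    intro Y
    have h1 : ∀ x : Fin N → EucSp d, (∏ l, w (x l - offShift S Y l)) *
        ENNReal.ofReal |blockVal u x b|
        = ((∏ l, w (x (b.orderEmbOfFin hm l) - offShift S Y (b.orderEmbOfFin hm l))) *
            ENNReal.ofReal |u (m + 2) fun l => x (b.orderEmbOfFin hm l)|) *
          ∏ l, w (x (bᶜ.orderEmbOfFin rfl l) - offShift S Y (bᶜ.orderEmbOfFin rfl l)) := by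
      intro x
      rw [hbv, prod_orderEmb b hm rfl]
      ring
    simp_rw [h1]
    rw [lintegral_split (E := EucSp d) b hm rfl
      (F := fun z => (∏ l, w (z l - offShift S Y (b.orderEmbOfFin hm l))) *
            ENNReal.ofReal |u (m + 2) z|)
      (G := fun z => ∏ l, w (z l - offShift S Y (bᶜ.orderEmbOfFin rfl l)))]
    · rw [lintegral_prod_pi_fin _ (fun l t => w (t - offShift S Y (bᶜ.orderEmbOfFin rfl l)))
        fun l => hw.comp (measurable_id.sub_const _)]
      simp_rw [hshift]
      rw [Finset.prod_const, Finset.card_univ, Fintype.card_fin]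
      refine mul_le_mul_left (lintegral_mono fun z => ?_) _
      have h2 := prod_le_two hW1 (f := fun l => w (z l - offShift S Y (b.orderEmbOfFin hm l)))
        (fun l => hwW _) hpq
      simp only [Fintype.card_fin, hp, hq] at h2
      have h5 : ∏ l, w (z l - offShift S Y (b.orderEmbOfFin hm l))
          ≤ W ^ (m + 2) * (w (z p) * w (z q - Y)) := by
        simpa [offShift, hiS, hjS] using h2
      exact (mul_le_mul_left h5 _).trans_eq (mul_assoc _ _ _)
    · exact (Finset.measurable_prod _ fun l _ =>
        hw.comp ((measurable_pi_apply l).sub_const _)).mul hum.abs.ennreal_ofReal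
    · exact Finset.measurable_prod _ fun l _ => hw.comp ((measurable_pi_apply l).sub_const _)
  refine ne_top_of_le_ne_top ?_ (lintegral_mono hin)
  rw [lintegral_mul_const' _ _ (ENNReal.pow_ne_top hwi)]
  refine ENNReal.mul_ne_top ?_ (ENNReal.pow_ne_top hwi)
  rw [lintegral_lintegral_swap]
  · have h3 : ∀ z : Fin (m + 2) → EucSp d, ∫⁻ Y : EucSp d,
        W ^ (m + 2) * (w (z p) * w (z q - Y) * ENNReal.ofReal |u (m + 2) z|)
          = W ^ (m + 2) * (∫⁻ t, w t) * (w (z p) * ENNReal.ofReal |u (m + 2) z|) := by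
      intro z
      have h4 : ∀ Y : EucSp d, W ^ (m + 2) * (w (z p) * w (z q - Y) *
          ENNReal.ofReal |u (m + 2) z|)
          = W ^ (m + 2) * (w (z p) * ENNReal.ofReal |u (m + 2) z|) * w (z q - Y) :=
        fun Y => by ring
      simp_rw [h4]
      rw [lintegral_const_mul _ (f := fun Y => w (z q - Y))
        (hw.comp (measurable_const.sub measurable_id)),
        lintegral_sub_left_eq_self w]
      ring
    simp_rw [h3]
    rw [lintegral_const_mul _ (f := fun z => w (z p) * ENNReal.ofReal |u (m + 2) z|)
        ((hw.comp (measurable_pi_apply p)).mul hum.abs.ennreal_ofReal),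
      lintegral_anchor hw (v := fun z => ENNReal.ofReal |u (m + 2) z|) hum.abs.ennreal_ofReal
        (fun a x => by rw [hti _ (by omega)]) p]
    exact ENNReal.mul_ne_top (ENNReal.mul_ne_top (ENNReal.pow_ne_top hWt) hwi)
      (ENNReal.mul_ne_top hwi (hintg m))
  · refine Measurable.aemeasurable ?_
    refine Measurable.const_mul (Measurable.mul (Measurable.mul (hw.comp ?_) (hw.comp ?_))
      (hum.abs.ennreal_ofReal.comp measurable_snd)) _
    · exact (measurable_pi_apply p).comp measurable_snd
    · exact ((measurable_pi_apply q).comp measurable_snd).sub measurable_fst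

lemma measurable_blockVal {d N : ℕ} {u : ∀ n : ℕ, (Fin n → EucSp d) → ℝ} {b : Finset (Fin N)}
    (hu : Measurable (u b.card)) : Measurable fun x : Fin N → EucSp d => blockVal u x b :=
  hu.comp (measurable_pi_lambda _ fun _ => measurable_pi_apply _)

lemma measurable_prod_offShift {d N : ℕ} {w : EucSp d → ℝ≥0∞} (hw : Measurable w)
    (S : Finset (Fin N)) : Measurable fun p : EucSp d × (Fin N → EucSp d) =>
      ∏ l, w (p.2 l - offShift S p.1 l) :=
  Finset.measurable_prod _ fun l _ => hw.comp
    (((measurable_pi_apply l).comp measurable_snd).sub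
      ((measurable_offShift S l).comp measurable_fst))

lemma lintegral_mixed_ne_top {d N : ℕ} {μ : Measure (Config d)} {ξ : ℝ}
    {k u : ∀ n : ℕ, (Fin n → EucSp d) → ℝ} (hk : HasCorrFns μ k) (hR : RuelleBound k ξ)
    (hti : TransInvFns k) (hU : IsUrsell k u)
    (hintg : ∀ m : ℕ, ∫⁻ y : Fin (m + 1) → EucSp d,
      ENNReal.ofReal |u (m + 2) (Fin.cons 0 y)| ≠ ⊤)
    {w : EucSp d → ℝ≥0∞} (hw : Measurable w) {W : ℝ≥0∞} (hW1 : 1 ≤ W) (hWt : W ≠ ⊤)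
    (hwW : ∀ x, w x ≤ W) (hwi : ∫⁻ x, w x ≠ ⊤) (S : Finset (Fin N)) :
    ∫⁻ Y : EucSp d, ∫⁻ x : Fin N → EucSp d, (∏ l, w (x l - offShift S Y l)) *
      ENNReal.ofReal |corrExt k N x - corrOn k x S * corrOn k x Sᶜ| ≠ ⊤ := by
  have hreg := fun n (hn : 0 < n) => ursell_regular hk hR hti hU n hn
  set Q : Finset (Finset (Finset (Fin N))) :=
    (parts Finset.univ).filter (fun P => ¬ ∀ b ∈ P, b ⊆ S ∨ b ⊆ Sᶜ) with hQ
  have hne : ∀ P ∈ Q, ∀ b ∈ P, 0 < b.card := fun P hP b hb =>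
    Finset.card_pos.2 ((mem_parts.1 (Finset.mem_filter.1 hP).1).1 b hb)
  have hmP : ∀ P ∈ Q, Measurable fun x : Fin N → EucSp d =>
      ENNReal.ofReal |∏ b ∈ P, blockVal u x b| := fun P hP =>
    (Finset.measurable_prod _ fun b hb =>
      measurable_blockVal (hreg _ (hne P hP b hb)).1).abs.ennreal_ofReal
  have hjm : ∀ P ∈ Q, Measurable fun p : EucSp d × (Fin N → EucSp d) =>
      (∏ l, w (p.2 l - offShift S p.1 l)) * ENNReal.ofReal |∏ b ∈ P, blockVal u p.2 b| :=
    fun P hP => (measurable_prod_offShift hw S).mul ((hmP P hP).comp measurable_snd)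
  have hle : ∀ Y : EucSp d, ∫⁻ x : Fin N → EucSp d, (∏ l, w (x l - offShift S Y l)) *
      ENNReal.ofReal |corrExt k N x - corrOn k x S * corrOn k x Sᶜ| ≤ ∑ P ∈ Q,
        ∫⁻ x : Fin N → EucSp d, (∏ l, w (x l - offShift S Y l)) *
          ENNReal.ofReal |∏ b ∈ P, blockVal u x b| := by
    intro Y
    have hs : ∀ P ∈ Q, Measurable fun x : Fin N → EucSp d =>
        (∏ l, w (x l - offShift S Y l)) * ENNReal.ofReal |∏ b ∈ P, blockVal u x b| :=
      fun P hP => (hjm P hP).comp measurable_prodMk_left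
    rw [← lintegral_finsetSum _ hs]
    refine lintegral_mono fun x => ?_
    rw [corrExt_sub_corrOn hU, ← Finset.mul_sum,
      ← ENNReal.ofReal_sum_of_nonneg fun _ _ => abs_nonneg _]
    gcongr
    exact Finset.abs_sum_le_sum_abs _ _
  refine ne_top_of_le_ne_top ?_ (lintegral_mono hle)
  rw [lintegral_finsetSum _ fun P hP => (hjm P hP).lintegral_prod_right']
  refine ENNReal.sum_ne_top.2 fun P hP => ?_
  have hP2 := (Finset.mem_filter.1 hP).2
  push Not at hP2
  obtain ⟨b, hb, hbS, hbS'⟩ := hP2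
  obtain ⟨j, hjb, hjS⟩ := Finset.not_subset.1 hbS
  obtain ⟨i, hib, hiS⟩ := Finset.not_subset.1 hbS'
  rw [Finset.mem_compl, not_not] at hiS
  have hC : ∀ c : Finset (Fin N), ∃ C : ℝ, 0 < c.card → ∀ x, |u c.card x| ≤ C := fun c => by
    by_cases hc : 0 < c.card
    · obtain ⟨C, hC⟩ := (hreg _ hc).2.1
      exact ⟨C, fun _ => hC⟩
    · exact ⟨0, fun h => absurd h hc⟩
  choose C hC using hC
  set K := ENNReal.ofReal (∏ c ∈ P.erase b, C c)
  have hb1 : ∀ x : Fin N → EucSp d, ENNReal.ofReal |∏ b ∈ P, blockVal u x b|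
      ≤ K * ENNReal.ofReal |blockVal u x b| := by
    intro x
    rw [← Finset.mul_prod_erase _ _ hb, abs_mul, Finset.abs_prod, mul_comm,
      ENNReal.ofReal_mul (Finset.prod_nonneg fun _ _ => abs_nonneg _)]
    refine mul_le_mul_left (ENNReal.ofReal_le_ofReal (Finset.prod_le_prod
      (fun _ _ => abs_nonneg _) fun c hc => ?_)) _
    exact hC c (hne P hP c (Finset.mem_of_mem_erase hc)) _
  have hfin := lintegral_block_ne_top (fun n hn => (hreg n hn).1) (fun n hn => (hreg n hn).2.2)
    hintg hw hW1 hWt hwW hwi hib hiS hjb hjS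
  refine ne_top_of_le_ne_top (ENNReal.mul_ne_top (ENNReal.ofReal_ne_top (r := _)) hfin)
    (?_ : _ ≤ K * _)
  rw [← lintegral_const_mul']
  · refine lintegral_mono fun Y => ?_
    rw [← lintegral_const_mul' _ _ ENNReal.ofReal_ne_top]
    refine lintegral_mono fun x => ?_
    calc _ ≤ (∏ l, w (x l - offShift S Y l)) * (K * ENNReal.ofReal |blockVal u x b|) := by
          gcongr
          exact hb1 x
      _ = _ := by ring
  · exact ENNReal.ofReal_ne_top

lemma corrOn_measurable {d N : ℕ} {μ : Measure (Config d)} {k : ∀ n : ℕ, (Fin n → EucSp d) → ℝ}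
    (hk : HasCorrFns μ k) (S : Finset (Fin N)) :
    Measurable fun x : Fin N → EucSp d => corrOn k x S :=
  (corrExt_measurable hk _).comp (measurable_pi_lambda _ fun _ => measurable_pi_apply _)

lemma corrOn_nonneg {d N : ℕ} {μ : Measure (Config d)} {k : ∀ n : ℕ, (Fin n → EucSp d) → ℝ}
    (hk : HasCorrFns μ k) (S : Finset (Fin N)) (x : Fin N → EucSp d) : 0 ≤ corrOn k x S :=
  corrExt_nonneg hk _ _

lemma corrOn_mul_corrOn_le {d N : ℕ} {μ : Measure (Config d)} {k : ∀ n : ℕ, (Fin n → EucSp d) → ℝ}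
    {ξ : ℝ} (hk : HasCorrFns μ k) (hξ : 0 ≤ ξ) (hR : RuelleBound k ξ) (S : Finset (Fin N))
    (x : Fin N → EucSp d) : corrOn k x S * corrOn k x Sᶜ ≤ ξ ^ N := by
  calc _ ≤ ξ ^ S.card * ξ ^ Sᶜ.card :=
        mul_le_mul (corrExt_le hR _ _) (corrExt_le hR _ _) (corrOn_nonneg hk _ _) (by positivity)
    _ = ξ ^ N := by
        rw [← pow_add, Finset.card_add_card_compl, Fintype.card_fin]

lemma integral_shift_corr {d : ℕ} {k : ∀ n : ℕ, (Fin n → EucSp d) → ℝ} (hti : TransInvFns k)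
    (h : EucSp d → ℝ) (a : EucSp d) (n : ℕ) :
    ∫ x : Fin n → EucSp d, (∏ i, h (x i - a)) * corrExt k n x
      = ∫ x : Fin n → EucSp d, (∏ i, h (x i)) * corrExt k n x := by
  rw [← integral_add_right_eq_self _ (fun _ : Fin n => a)]
  refine integral_congr_ae (Eventually.of_forall fun x => ?_)
  have := corrExt_add hti n a x
  simp only [Pi.add_apply, add_sub_cancel_right]
  rw [← this]
  rfl

lemma summable_corrGen {d : ℕ} {μ : Measure (Config d)} {k : ∀ n : ℕ, (Fin n → EucSp d) → ℝ}
    {ξ : ℝ} (hk : HasCorrFns μ k) (hξ : 0 ≤ ξ) (hR : RuelleBound k ξ) {h : EucSp d → ℝ}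
    (hh : Measurable h) (hintg : ∫⁻ x, ENNReal.ofReal |h x| ≠ ⊤) :
    Summable fun n : ℕ => ‖(n.factorial : ℝ)⁻¹ *
      ∫ x : Fin n → EucSp d, (∏ i, h (x i)) * corrExt k n x‖ := by
  set T := ENNReal.ofReal ξ * ∫⁻ x, ENNReal.ofReal |h x| with hT
  have hTt : T ≠ ⊤ := ENNReal.mul_ne_top ENNReal.ofReal_ne_top hintg
  refine Summable.of_nonneg_of_le (fun _ => norm_nonneg _) (fun n => ?_)
    (Real.summable_pow_div_factorial T.toReal)
  rw [norm_mul, norm_inv, Real.norm_natCast, inv_mul_eq_div]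
  gcongr
  refine (norm_integral_le_lintegral_norm _).trans ?_
  rw [← ENNReal.toReal_pow]
  refine ENNReal.toReal_mono (ENNReal.pow_ne_top hTt) (le_trans (le_of_eq ?_)
    (lintegral_prod_mul_corr_le hξ hR hh.abs.ennreal_ofReal n))
  refine lintegral_congr fun x => ?_
  rw [norm_mul, Real.norm_eq_abs, Real.norm_eq_abs, Finset.abs_prod,
    abs_of_nonneg (corrExt_nonneg hk n x),
    ENNReal.ofReal_mul (Finset.prod_nonneg fun _ _ => abs_nonneg _),
    ENNReal.ofReal_prod_of_nonneg fun _ _ => abs_nonneg _]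

set_option maxHeartbeats 1000000 in
lemma integral_corrOn_mul {d N : ℕ} {μ : Measure (Config d)}
    {k : ∀ n : ℕ, (Fin n → EucSp d) → ℝ} {ξ : ℝ} (hk : HasCorrFns μ k)
    (hR : RuelleBound k ξ) (hti : TransInvFns k) {h : EucSp d → ℝ}
    (hh : Measurable h) (hintg : ∫⁻ x, ENNReal.ofReal |h x| ≠ ⊤) (S : Finset (Fin N))
    (Y : EucSp d) :
    Integrable (fun x : Fin N → EucSp d =>
        (∏ i, h (x i - offShift S Y i)) * (corrOn k x S * corrOn k x Sᶜ)) ∧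
      ∫ x : Fin N → EucSp d, (∏ i, h (x i - offShift S Y i)) * (corrOn k x S * corrOn k x Sᶜ)
        = (∫ x : Fin S.card → EucSp d, (∏ i, h (x i)) * corrExt k S.card x) *
          ∫ x : Fin (N - S.card) → EucSp d, (∏ i, h (x i)) * corrExt k (N - S.card) x := by
  have hsint : ∀ a : EucSp d, ∫⁻ x, ENNReal.ofReal |h (x - a)| ≠ ⊤ := fun a => by
    rw [lintegral_sub_right_eq_self (fun x => ENNReal.ofReal |h x|) a]
    exact hintg
  have hsm : ∀ a : EucSp d, Measurable fun x => h (x - a) := fun a =>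
    hh.comp (measurable_id.sub_const a)
  have hF : Integrable fun x : Fin S.card → EucSp d => (∏ i, h (x i - 0)) * corrExt k S.card x :=
    integrable_prod_mul_corr hk hR (fun _ => hsm 0) fun _ => hsint 0
  have hG : Integrable fun x : Fin Sᶜ.card → EucSp d =>
      (∏ i, h (x i - Y)) * corrExt k Sᶜ.card x :=
    integrable_prod_mul_corr hk hR (fun _ => hsm Y) fun _ => hsint Y
  have hFm : ∀ (n : ℕ) (a : EucSp d), Measurable fun x : Fin n → EucSp d =>
      (∏ i, h (x i - a)) * corrExt k n x := fun n a =>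
    (Finset.measurable_prod _ fun i _ => (hsm a).comp (measurable_pi_apply i)).mul
      (corrExt_measurable hk n)
  have heq : (fun x : Fin N → EucSp d =>
      (∏ i, h (x i - offShift S Y i)) * (corrOn k x S * corrOn k x Sᶜ)) = fun x =>
      ((∏ i, h (x (S.orderEmbOfFin rfl i) - 0)) *
        corrExt k S.card fun i => x (S.orderEmbOfFin rfl i)) *
      ((∏ i, h (x (Sᶜ.orderEmbOfFin rfl i) - Y)) *
        corrExt k Sᶜ.card fun i => x (Sᶜ.orderEmbOfFin rfl i)) := by
    funext x
    rw [prod_orderEmb S rfl rfl]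
    have h1 : ∀ i, offShift S Y (S.orderEmbOfFin rfl i) = 0 := fun i =>
      if_pos (S.orderEmbOfFin_mem rfl i)
    have h2 : ∀ i, offShift S Y (Sᶜ.orderEmbOfFin rfl i) = Y := fun i =>
      if_neg (Finset.mem_compl.1 (Sᶜ.orderEmbOfFin_mem rfl i))
    simp only [h1, h2, corrOn]
    ring
  rw [heq]
  constructor
  · have := hF.mul_prod hG
    rw [← Measure.volume_eq_prod] at this
    exact (measurePreserving_split (E := EucSp d) S rfl rfl).integrable_comp_of_integrable this
  · rw [integral_split (E := EucSp d) S rfl rfl (hFm _ 0) (hFm _ Y), integral_shift_corr hti,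
      integral_shift_corr hti]
    have hc : Sᶜ.card = N - S.card := by rw [Finset.card_compl, Fintype.card_fin]
    rw [hc]

/-- `(1 + h(x)) (1 + h(x - Y)) - 1`. -/
def pairFn {d : ℕ} (h : EucSp d → ℝ) (Y x : EucSp d) : ℝ := h x + h (x - Y) + h x * h (x - Y)

/-- The `N`-th term in the cluster expansion of a covariance. -/
def covFn {d : ℕ} (k : ∀ n : ℕ, (Fin n → EucSp d) → ℝ) (h : EucSp d → ℝ) (N : ℕ) (Y : EucSp d)
    (x : Fin N → EucSp d) : ℝ :=
  (∏ i, pairFn h Y (x i)) * corrExt k N x -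
    ∑ S : Finset (Fin N), (∏ i, h (x i - offShift S Y i)) * (corrOn k x S * corrOn k x Sᶜ)

/-- The `L¹` norm of the `N`-th term in the cluster expansion of a covariance. -/
def covTerm {d : ℕ} (k : ∀ n : ℕ, (Fin n → EucSp d) → ℝ) (h : EucSp d → ℝ) (N : ℕ)
    (Y : EucSp d) : ℝ≥0∞ :=
  ∫⁻ x : Fin N → EucSp d, ENNReal.ofReal |covFn k h N Y x|

lemma measurable_pairFn {d : ℕ} {h : EucSp d → ℝ} (hh : Measurable h) :
    Measurable fun p : EucSp d × EucSp d => pairFn h p.1 p.2 := by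
  unfold pairFn
  have h1 : Measurable fun p : EucSp d × EucSp d => h (p.2 - p.1) :=
    hh.comp (measurable_snd.sub measurable_fst)
  have h2 : Measurable fun p : EucSp d × EucSp d => h p.2 := hh.comp measurable_snd
  exact (h2.add h1).add (h2.mul h1)

lemma measurable_covFn {d : ℕ} {μ : Measure (Config d)} {k : ∀ n : ℕ, (Fin n → EucSp d) → ℝ}
    (hk : HasCorrFns μ k) {h : EucSp d → ℝ} (hh : Measurable h) (N : ℕ) :
    Measurable fun p : EucSp d × (Fin N → EucSp d) => covFn k h N p.1 p.2 := by
  unfold covFn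
  refine Measurable.sub (Measurable.mul ?_ ((corrExt_measurable hk N).comp measurable_snd)) ?_
  · exact Finset.measurable_prod _ fun i _ => (measurable_pairFn hh).comp
      (measurable_fst.prodMk ((measurable_pi_apply i).comp measurable_snd))
  · refine Finset.measurable_sum _ fun S _ => Measurable.mul ?_
      (((corrOn_measurable hk S).comp measurable_snd).mul
        ((corrOn_measurable hk Sᶜ).comp measurable_snd))
    exact Finset.measurable_prod _ fun l _ => hh.comp
      (((measurable_pi_apply l).comp measurable_snd).sub
        ((measurable_offShift S l).comp measurable_fst))

lemma measurable_covTerm {d : ℕ} {μ : Measure (Config d)} {k : ∀ n : ℕ, (Fin n → EucSp d) → ℝ}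
    (hk : HasCorrFns μ k) {h : EucSp d → ℝ} (hh : Measurable h) (N : ℕ) :
    Measurable (covTerm k h N) :=
  (measurable_covFn hk hh N).abs.ennreal_ofReal.lintegral_prod_right'

lemma lintegral_pairFn_le {d : ℕ} {h : EucSp d → ℝ} (hh : Measurable h) {W : ℝ}
    (hW : ∀ x, |h x| ≤ W) (Y : EucSp d) :
    ∫⁻ x, (ENNReal.ofReal (|h x| + |h (x - Y)|) + ENNReal.ofReal (|h x| * |h (x - Y)|))
      ≤ (2 + ENNReal.ofReal W) * ∫⁻ x, ENNReal.ofReal |h x| := by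
  have h1 : Measurable fun x => ENNReal.ofReal |h x| := hh.abs.ennreal_ofReal
  have h2 : Measurable fun x => ENNReal.ofReal |h (x - Y)| :=
    h1.comp (measurable_id.sub_const Y)
  calc _ ≤ ∫⁻ x : EucSp d, ((1 + ENNReal.ofReal W) * ENNReal.ofReal |h x| + ENNReal.ofReal |h (x - Y)|) := by
        refine lintegral_mono fun x => ?_
        rw [ENNReal.ofReal_add (abs_nonneg _) (abs_nonneg _), ENNReal.ofReal_mul (abs_nonneg _)]
        have := ENNReal.ofReal_le_ofReal (hW (x - Y))
        calc _ ≤ ENNReal.ofReal |h x| + ENNReal.ofReal |h (x - Y)|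
              + ENNReal.ofReal |h x| * ENNReal.ofReal W := by gcongr
          _ = _ := by ring
    _ = (1 + ENNReal.ofReal W) * (∫⁻ x : EucSp d, ENNReal.ofReal |h x|)
          + ∫⁻ x : EucSp d, ENNReal.ofReal |h (x - Y)| := by
        rw [lintegral_add_right _ h2, lintegral_const_mul _ h1]
    _ = _ := by
        rw [lintegral_sub_right_eq_self (fun x => ENNReal.ofReal |h x|) Y]
        ring

lemma abs_pairFn_le {d : ℕ} (h : EucSp d → ℝ) (Y x : EucSp d) :
    ENNReal.ofReal |pairFn h Y x| ≤
      ENNReal.ofReal (|h x| + |h (x - Y)|) + ENNReal.ofReal (|h x| * |h (x - Y)|) := by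
  rw [← ENNReal.ofReal_add (by positivity) (by positivity), ← abs_mul]
  refine ENNReal.ofReal_le_ofReal ((abs_add_le _ _).trans ?_)
  gcongr
  exact abs_add_le _ _

lemma lintegral_abs_pairFn_ne_top {d : ℕ} {h : EucSp d → ℝ} (hh : Measurable h) {W : ℝ}
    (hW : ∀ x, |h x| ≤ W) (hintg : ∫⁻ x, ENNReal.ofReal |h x| ≠ ⊤) (Y : EucSp d) :
    ∫⁻ x, ENNReal.ofReal |pairFn h Y x| ≠ ⊤ :=
  ne_top_of_le_ne_top (ENNReal.mul_ne_top (ENNReal.add_ne_top.2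
    ⟨ENNReal.ofNat_ne_top, ENNReal.ofReal_ne_top⟩) hintg)
    ((lintegral_mono (abs_pairFn_le h Y)).trans (lintegral_pairFn_le hh hW Y))

lemma abs_corrGen_sub_sq_le {d : ℕ} {μ : Measure (Config d)}
    {k : ∀ n : ℕ, (Fin n → EucSp d) → ℝ} {ξ : ℝ} (hk : HasCorrFns μ k) (hξ : 0 ≤ ξ)
    (hR : RuelleBound k ξ) (hti : TransInvFns k) {h : EucSp d → ℝ}
    (hh : Measurable h) {W : ℝ} (hW : ∀ x, |h x| ≤ W)
    (hintg : ∫⁻ x, ENNReal.ofReal |h x| ≠ ⊤) (Y : EucSp d) :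
    ENNReal.ofReal |corrGen k (pairFn h Y) - corrGen k h ^ 2|
      ≤ ∑' N : ℕ, (N.factorial : ℝ≥0∞)⁻¹ * covTerm k h N Y := by
  have hpm : Measurable (pairFn h Y) := (measurable_pairFn hh).comp measurable_prodMk_left
  have hpi := lintegral_abs_pairFn_ne_top hh hW hintg Y
  have s1 := summable_corrGen hk hξ hR hpm hpi
  have s2 := summable_corrGen hk hξ hR hh hintg
  have hint1 := fun N : ℕ => integrable_prod_mul_corr (n := N) hk hR (fun _ => hpm) fun _ => hpi
  have hcauchy : ∀ N : ℕ, ∑ kl ∈ Finset.HasAntidiagonal.antidiagonal N,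
      (kl.1.factorial : ℝ)⁻¹ * (∫ x : Fin kl.1 → EucSp d, (∏ i, h (x i)) * corrExt k kl.1 x) *
      ((kl.2.factorial : ℝ)⁻¹ * ∫ x : Fin kl.2 → EucSp d, (∏ i, h (x i)) * corrExt k kl.2 x)
      = (N.factorial : ℝ)⁻¹ * ∑ S : Finset (Fin N), ∫ x : Fin N → EucSp d,
        (∏ i, h (x i - offShift S Y i)) * (corrOn k x S * corrOn k x Sᶜ) := by
    intro N
    simp_rw [fun S : Finset (Fin N) => (integral_corrOn_mul hk hR hti hh hintg S Y).2]
    rw [← Finset.powerset_univ, Finset.sum_powerset_apply_card (fun m : ℕ =>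
      (∫ x : Fin m → EucSp d, (∏ i, h (x i)) * corrExt k m x) *
          ∫ x : Fin (N - m) → EucSp d, (∏ i, h (x i)) * corrExt k (N - m) x),
      Finset.card_univ, Fintype.card_fin, Finset.Nat.sum_antidiagonal_eq_sum_range_succ_mk,
      Finset.mul_sum]
    refine Finset.sum_congr rfl fun m hm => ?_
    have hmN : m ≤ N := Nat.lt_succ_iff.1 (Finset.mem_range.1 hm)
    rw [nsmul_eq_mul, Nat.cast_choose ℝ hmN]
    have := Nat.factorial_ne_zero N
    field_simp
  have hterm : ∀ N : ℕ, (N.factorial : ℝ)⁻¹ *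
      (∫ x : Fin N → EucSp d, (∏ i, pairFn h Y (x i)) * corrExt k N x) -
      (N.factorial : ℝ)⁻¹ * ∑ S : Finset (Fin N), ∫ x : Fin N → EucSp d,
        (∏ i, h (x i - offShift S Y i)) * (corrOn k x S * corrOn k x Sᶜ)
      = (N.factorial : ℝ)⁻¹ * ∫ x : Fin N → EucSp d, covFn k h N Y x := by
    intro N
    have hi := fun S : Finset (Fin N) => (integral_corrOn_mul hk hR hti hh hintg S Y).1
    unfold covFn
    rw [integral_sub (hint1 N) (integrable_finsetSum _ fun S _ => hi S),
      integral_finsetSum _ fun S _ => hi S, mul_sub]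
  rw [sq, corrGen, corrGen, tsum_mul_tsum_eq_tsum_sum_antidiagonal_of_summable_norm s2 s2]
  have s3 := (summable_norm_sum_mul_antidiagonal_of_summable_norm s2 s2).of_norm
  rw [← s1.of_norm.tsum_sub s3]
  simp_rw [hcauchy, hterm]
  rw [← Real.enorm_eq_ofReal_abs]
  refine enorm_tsum_le_tsum_enorm.trans (ENNReal.tsum_le_tsum fun N => ?_)
  rw [enorm_mul]
  refine mul_le_mul' (le_of_eq ?_) ((enorm_integral_le_lintegral_enorm _).trans (le_of_eq ?_))
  · rw [Real.enorm_eq_ofReal (by positivity), ENNReal.ofReal_inv_of_pos (by positivity),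
      ENNReal.ofReal_natCast]
  · simp_rw [Real.enorm_eq_ofReal_abs]
    rfl

lemma covTerm_le {d : ℕ} {μ : Measure (Config d)} {k : ∀ n : ℕ, (Fin n → EucSp d) → ℝ}
    {ξ : ℝ} (hk : HasCorrFns μ k) (hξ : 0 ≤ ξ) (hR : RuelleBound k ξ) {h : EucSp d → ℝ}
    (hh : Measurable h) {W : ℝ} (hW : ∀ x, |h x| ≤ W) (N : ℕ) (Y : EucSp d) :
    covTerm k h N Y ≤ 2 * (ENNReal.ofReal ξ *
      ((2 + ENNReal.ofReal W) * ∫⁻ x, ENNReal.ofReal |h x|)) ^ N := by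
  set I := ∫⁻ x : EucSp d, ENNReal.ofReal |h x| with hI
  have hpm : Measurable (pairFn h Y) := (measurable_pairFn hh).comp measurable_prodMk_left
  have hm1 : Measurable fun x : Fin N → EucSp d =>
      (∏ i, ENNReal.ofReal |pairFn h Y (x i)|) * ENNReal.ofReal (corrExt k N x) :=
    (Finset.measurable_prod _ fun i _ =>
      hpm.abs.ennreal_ofReal.comp (measurable_pi_apply i)).mul
      (corrExt_measurable hk N).ennreal_ofReal
  have hm2 : ∀ S : Finset (Fin N), Measurable fun x : Fin N → EucSp d =>
      ∏ i, ENNReal.ofReal |h (x i - offShift S Y i)| := fun S =>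
    Finset.measurable_prod _ fun i _ =>
      hh.abs.ennreal_ofReal.comp ((measurable_pi_apply i).sub_const _)
  have hm3 : ∀ S : Finset (Fin N), Measurable fun x : Fin N → EucSp d =>
      (∏ i, ENNReal.ofReal |h (x i - offShift S Y i)|) * ENNReal.ofReal (ξ ^ N) :=
    fun S => (hm2 S).mul_const _
  have hS : ∀ S : Finset (Fin N), ∫⁻ x : Fin N → EucSp d,
      (∏ i, ENNReal.ofReal |h (x i - offShift S Y i)|) * ENNReal.ofReal (ξ ^ N)
        = (ENNReal.ofReal ξ * I) ^ N := fun S => by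
    rw [lintegral_mul_const _ (hm2 S),
      lintegral_prod_pi_fin _ (fun i t => ENNReal.ofReal |h (t - offShift S Y i)|)
        fun i => hh.abs.ennreal_ofReal.comp (measurable_id.sub_const _)]
    have hsh : ∀ i, ∫⁻ t, ENNReal.ofReal |h (t - offShift S Y i)| = I := fun i =>
      lintegral_sub_right_eq_self (fun x => ENNReal.ofReal |h x|) (offShift S Y i)
    simp only [hsh]
    rw [Finset.prod_const, Finset.card_univ, Fintype.card_fin, ENNReal.ofReal_pow hξ, mul_comm,
      mul_pow]
  have hpt : ∀ x : Fin N → EucSp d, ENNReal.ofReal |covFn k h N Y x| ≤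
      (∏ i, ENNReal.ofReal |pairFn h Y (x i)|) * ENNReal.ofReal (corrExt k N x) +
        ∑ S : Finset (Fin N),
          (∏ i, ENNReal.ofReal |h (x i - offShift S Y i)|) * ENNReal.ofReal (ξ ^ N) := by
    intro x
    have h1 : |covFn k h N Y x| ≤ (∏ i, |pairFn h Y (x i)|) * corrExt k N x +
        ∑ S : Finset (Fin N), (∏ i, |h (x i - offShift S Y i)|) * ξ ^ N := by
      refine (abs_sub _ _).trans (add_le_add (le_of_eq ?_)
        ((Finset.abs_sum_le_sum_abs _ _).trans (Finset.sum_le_sum fun S _ => ?_)))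
      · rw [abs_mul, Finset.abs_prod, abs_of_nonneg (corrExt_nonneg hk N x)]
      · rw [abs_mul, Finset.abs_prod, abs_of_nonneg
          (mul_nonneg (corrOn_nonneg hk S x) (corrOn_nonneg hk Sᶜ x))]
        gcongr
        exact corrOn_mul_corrOn_le hk hξ hR S x
    refine (ENNReal.ofReal_le_ofReal h1).trans (le_of_eq ?_)
    have hp : ∀ g : Fin N → ℝ, 0 ≤ ∏ i, |g i| := fun g => Finset.prod_nonneg fun _ _ => abs_nonneg _
    rw [ENNReal.ofReal_add (mul_nonneg (hp fun i => pairFn h Y (x i)) (corrExt_nonneg hk N x))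
        (Finset.sum_nonneg fun S _ =>
        mul_nonneg (hp fun i => h (x i - offShift S Y i)) (pow_nonneg hξ N)),
      ENNReal.ofReal_mul (hp fun i => pairFn h Y (x i)),
      ENNReal.ofReal_prod_of_nonneg (f := fun i => |pairFn h Y (x i)|) fun _ _ => abs_nonneg _,
      ENNReal.ofReal_sum_of_nonneg fun S _ =>
        mul_nonneg (hp fun i => h (x i - offShift S Y i)) (pow_nonneg hξ N)]
    refine congrArg _ (Finset.sum_congr rfl fun S _ => ?_)
    rw [ENNReal.ofReal_mul (hp fun i => h (x i - offShift S Y i)),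
      ENNReal.ofReal_prod_of_nonneg (f := fun i => |h (x i - offShift S Y i)|)
        fun _ _ => abs_nonneg _]
  have hA : (ENNReal.ofReal ξ * ∫⁻ x, ENNReal.ofReal |pairFn h Y x|) ^ N
      ≤ (ENNReal.ofReal ξ * ((2 + ENNReal.ofReal W) * I)) ^ N := by
    gcongr
    exact (lintegral_mono (abs_pairFn_le h Y)).trans (lintegral_pairFn_le hh hW Y)
  have hB : ∑ _S : Finset (Fin N), (ENNReal.ofReal ξ * I) ^ N
      ≤ (ENNReal.ofReal ξ * ((2 + ENNReal.ofReal W) * I)) ^ N := by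
    rw [Finset.sum_const, Finset.card_univ, Fintype.card_finset, Fintype.card_fin, nsmul_eq_mul]
    push_cast
    rw [← mul_pow]
    gcongr ?_ ^ N
    calc (2 : ℝ≥0∞) * (ENNReal.ofReal ξ * I) = ENNReal.ofReal ξ * ((2 + 0) * I) := by ring
      _ ≤ _ := by gcongr; exact bot_le
  calc covTerm k h N Y ≤ ∫⁻ x : Fin N → EucSp d,
        ((∏ i, ENNReal.ofReal |pairFn h Y (x i)|) * ENNReal.ofReal (corrExt k N x) +
        ∑ S : Finset (Fin N),
          (∏ i, ENNReal.ofReal |h (x i - offShift S Y i)|) * ENNReal.ofReal (ξ ^ N)) :=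
        lintegral_mono hpt
    _ = (∫⁻ x : Fin N → EucSp d,
          (∏ i, ENNReal.ofReal |pairFn h Y (x i)|) * ENNReal.ofReal (corrExt k N x)) +
        ∑ S : Finset (Fin N), ∫⁻ x : Fin N → EucSp d,
          (∏ i, ENNReal.ofReal |h (x i - offShift S Y i)|) * ENNReal.ofReal (ξ ^ N) := by
        rw [lintegral_add_left hm1, lintegral_finsetSum _ fun S _ => hm3 S]
    _ ≤ _ := by
        simp_rw [hS]
        rw [two_mul]
        exact add_le_add ((lintegral_prod_mul_corr_le hξ hR hpm.abs.ennreal_ofReal N).trans hA) hB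

lemma abs_prod_add_sub_prod_le {ι : Type*} [DecidableEq ι] (s : Finset ι) (a v : ι → ℝ) :
    |∏ i ∈ s, (a i + v i) - ∏ i ∈ s, a i| ≤
      ∑ i ∈ s, ∏ j ∈ s, if j = i then |v j| else |a j| + |v j| := by
  induction s using Finset.induction_on with
  | empty => simp
  | insert c s hc ih =>
    rw [Finset.prod_insert hc, Finset.prod_insert hc, Finset.sum_insert hc, Finset.prod_insert hc,
      if_pos rfl]
    have h1 : (a c + v c) * ∏ i ∈ s, (a i + v i) - a c * ∏ i ∈ s, a i
        = v c * ∏ i ∈ s, (a i + v i) + a c * (∏ i ∈ s, (a i + v i) - ∏ i ∈ s, a i) := by ring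
    rw [h1]
    refine (abs_add_le _ _).trans (add_le_add ?_ ?_)
    · rw [abs_mul, Finset.abs_prod]
      refine mul_le_mul_of_nonneg_left (Finset.prod_le_prod (fun _ _ => abs_nonneg _)
        fun j hj => ?_) (abs_nonneg _)
      rw [if_neg (fun hjc : j = c => hc (hjc ▸ hj))]
      exact abs_add_le _ _
    · rw [abs_mul]
      refine (mul_le_mul_of_nonneg_left ih (abs_nonneg _)).trans ?_
      rw [Finset.mul_sum]
      refine Finset.sum_le_sum fun i hi => ?_
      rw [Finset.prod_insert hc, if_neg (fun hci : c = i => hc (hci ▸ hi))]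
      refine mul_le_mul_of_nonneg_right (le_add_of_nonneg_right (abs_nonneg _))
        (Finset.prod_nonneg fun j _ => ?_)
      split_ifs <;> positivity

lemma covFn_eq {d N : ℕ} (k : ∀ n : ℕ, (Fin n → EucSp d) → ℝ) (h : EucSp d → ℝ) (Y : EucSp d)
    (x : Fin N → EucSp d) :
    covFn k h N Y x = (∏ i, (h (x i) + h (x i - Y) + h (x i) * h (x i - Y)) -
        ∏ i, (h (x i) + h (x i - Y))) * corrExt k N x +
      ∑ S : Finset (Fin N), (∏ i, h (x i - offShift S Y i)) *
        (corrExt k N x - corrOn k x S * corrOn k x Sᶜ) := by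
  have h1 : ∏ i, (h (x i) + h (x i - Y))
      = ∑ S : Finset (Fin N), ∏ i, h (x i - offShift S Y i) := by
    rw [Fintype.prod_add]
    refine Finset.sum_congr rfl fun S _ => ?_
    rw [← Finset.prod_mul_prod_compl S]
    congr 1
    · refine Finset.prod_congr rfl fun i hi => ?_
      rw [offShift, if_pos hi, sub_zero]
    · refine Finset.prod_congr rfl fun i hi => ?_
      rw [offShift, if_neg (Finset.mem_compl.1 hi)]
  simp only [covFn, pairFn, mul_sub, Finset.sum_sub_distrib, ← Finset.sum_mul, h1, sub_mul]
  ring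

set_option maxHeartbeats 2000000 in
lemma lintegral_covTerm_ne_top {d : ℕ} {μ : Measure (Config d)}
    {k u : ∀ n : ℕ, (Fin n → EucSp d) → ℝ} {ξ : ℝ} (hk : HasCorrFns μ k)
    (hR : RuelleBound k ξ) (hti : TransInvFns k) (hU : IsUrsell k u)
    (huint : ∀ m : ℕ, ∫⁻ y : Fin (m + 1) → EucSp d,
      ENNReal.ofReal |u (m + 2) (Fin.cons 0 y)| ≠ ⊤) {h : EucSp d → ℝ}
    (hh : Measurable h) {W : ℝ} (hW : ∀ x, |h x| ≤ W)
    (hintg : ∫⁻ x, ENNReal.ofReal |h x| ≠ ⊤) (N : ℕ) :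
    ∫⁻ Y, covTerm k h N Y ≠ ⊤ := by
  set I := ∫⁻ x : EucSp d, ENNReal.ofReal |h x| with hI
  set G := (2 + ENNReal.ofReal W) * I with hG
  have hGt : G ≠ ⊤ := ENNReal.mul_ne_top (ENNReal.add_ne_top.2
    ⟨ENNReal.ofNat_ne_top, ENNReal.ofReal_ne_top⟩) hintg
  set v : EucSp d → EucSp d → ℝ := fun Y t => |h t * h (t - Y)| with hv
  set g : EucSp d → EucSp d → ℝ := fun Y t => |h t + h (t - Y)| + |h t * h (t - Y)| with hg
  have hs : Measurable fun p : EucSp d × EucSp d => h (p.2 - p.1) :=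
    hh.comp (measurable_snd.sub measurable_fst)
  have hs' : Measurable fun p : EucSp d × EucSp d => h p.2 := hh.comp measurable_snd
  have hvm : Measurable fun p : EucSp d × EucSp d => v p.1 p.2 := (hs'.mul hs).abs
  have hgm : Measurable fun p : EucSp d × EucSp d => g p.1 p.2 :=
    (hs'.add hs).abs.add (hs'.mul hs).abs
  have hW1 : ∀ x, ENNReal.ofReal |h x| ≤ 1 + ENNReal.ofReal W := fun x =>
    (ENNReal.ofReal_le_ofReal (hW x)).trans le_add_self
  have hmix := fun S : Finset (Fin N) => lintegral_mixed_ne_top hk hR hti hU huint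
    hh.abs.ennreal_ofReal (le_self_add : (1 : ℝ≥0∞) ≤ 1 + ENNReal.ofReal W)
    (ENNReal.add_ne_top.2 ⟨ENNReal.one_ne_top, ENNReal.ofReal_ne_top⟩) hW1 hintg S
  set Mx : Finset (Fin N) → EucSp d → (Fin N → EucSp d) → ℝ≥0∞ := fun S Y x =>
    (∏ l, ENNReal.ofReal |h (x l - offShift S Y l)|) *
      ENNReal.ofReal |corrExt k N x - corrOn k x S * corrOn k x Sᶜ| with hMx
  have hMm : ∀ S, Measurable fun p : EucSp d × (Fin N → EucSp d) => Mx S p.1 p.2 := fun S =>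
    (measurable_prod_offShift hh.abs.ennreal_ofReal S).mul
      ((((corrExt_measurable hk N).sub ((corrOn_measurable hk S).mul
        (corrOn_measurable hk Sᶜ))).abs.ennreal_ofReal).comp measurable_snd)
  set P : Fin N → EucSp d → (Fin N → EucSp d) → ℝ≥0∞ := fun i Y x =>
    ∏ j, if j = i then ENNReal.ofReal (v Y (x j)) else ENNReal.ofReal (g Y (x j)) with hP
  have hPm : ∀ i, Measurable fun p : EucSp d × (Fin N → EucSp d) => P i p.1 p.2 := by
    intro i
    refine Finset.measurable_prod _ fun j _ => ?_
    have hj : Measurable fun p : EucSp d × (Fin N → EucSp d) => (p.1, p.2 j) :=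
      measurable_fst.prodMk ((measurable_pi_apply j).comp measurable_snd)
    split_ifs
    · exact (hvm.comp hj).ennreal_ofReal
    · exact (hgm.comp hj).ennreal_ofReal
  have hpt : ∀ Y (x : Fin N → EucSp d), ENNReal.ofReal |covFn k h N Y x| ≤
      ENNReal.ofReal (ξ ^ N) * (∑ i, P i Y x) + ∑ S, Mx S Y x := by
    intro Y x
    rw [covFn_eq]
    refine (ENNReal.ofReal_le_ofReal (abs_add_le _ _)).trans
      (ENNReal.ofReal_add_le.trans (add_le_add ?_ ?_))
    · rw [abs_mul, mul_comm, ENNReal.ofReal_mul (abs_nonneg _),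
        abs_of_nonneg (corrExt_nonneg hk N x)]
      refine mul_le_mul' (ENNReal.ofReal_le_ofReal (corrExt_le hR N x)) ?_
      refine (ENNReal.ofReal_le_ofReal (abs_prod_add_sub_prod_le Finset.univ
        (fun i => h (x i) + h (x i - Y)) fun i => h (x i) * h (x i - Y))).trans (le_of_eq ?_)
      have hnn : ∀ i j : Fin N, 0 ≤ if j = i then |h (x j) * h (x j - Y)| else
          |h (x j) + h (x j - Y)| + |h (x j) * h (x j - Y)| := fun i j => by
        split_ifs <;> positivity
      rw [ENNReal.ofReal_sum_of_nonneg fun i _ => Finset.prod_nonneg fun j _ => hnn i j]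
      refine Finset.sum_congr rfl fun i _ => ?_
      rw [ENNReal.ofReal_prod_of_nonneg fun j _ => hnn i j]
      refine Finset.prod_congr rfl fun j _ => ?_
      split_ifs <;> rfl
    · refine (ENNReal.ofReal_le_ofReal (Finset.abs_sum_le_sum_abs _ _)).trans (le_of_eq ?_)
      rw [ENNReal.ofReal_sum_of_nonneg fun _ _ => abs_nonneg _]
      refine Finset.sum_congr rfl fun S _ => ?_
      rw [abs_mul, Finset.abs_prod,
        ENNReal.ofReal_mul (Finset.prod_nonneg fun _ _ => abs_nonneg _),
        ENNReal.ofReal_prod_of_nonneg fun _ _ => abs_nonneg _]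
  have hPle : ∀ i Y, ∫⁻ x, P i Y x ≤ (∫⁻ t, ENNReal.ofReal (v Y t)) *
      G ^ (Finset.univ.erase i).card := by
    intro i Y
    have hvY : Measurable fun t => ENNReal.ofReal (v Y t) :=
      (hvm.comp measurable_prodMk_left).ennreal_ofReal
    have hgY : Measurable fun t => ENNReal.ofReal (g Y t) :=
      (hgm.comp measurable_prodMk_left).ennreal_ofReal
    have h1 := lintegral_prod_pi_fin N (fun (j : Fin N) t =>
      if j = i then ENNReal.ofReal (v Y t) else ENNReal.ofReal (g Y t))
      fun j => by split_ifs <;> assumption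
    refine h1.le.trans ?_
    rw [← Finset.mul_prod_erase _ _ (Finset.mem_univ i)]
    simp only [if_true]
    refine mul_le_mul' le_rfl (Finset.prod_le_pow_card _ _ G fun j hj => ?_)
    simp only [if_neg (Finset.ne_of_mem_erase hj)]
    refine le_trans (lintegral_mono fun t => ?_) (lintegral_pairFn_le hh hW Y)
    refine ENNReal.ofReal_add_le.trans (add_le_add
      (ENNReal.ofReal_le_ofReal (abs_add_le _ _)) (by rw [abs_mul]))
  have hvI : ∫⁻ Y, ∫⁻ t, ENNReal.ofReal (v Y t) ≠ ⊤ := by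
    rw [lintegral_lintegral_swap hvm.ennreal_ofReal.aemeasurable]
    have h1 : ∀ t, ∫⁻ Y, ENNReal.ofReal (v Y t) = ENNReal.ofReal |h t| * I := fun t => by
      simp only [hv, abs_mul, ENNReal.ofReal_mul (abs_nonneg _)]
      rw [lintegral_const_mul' _ _ ENNReal.ofReal_ne_top,
        lintegral_sub_left_eq_self (fun t => ENNReal.ofReal |h t|)]
    simp_rw [h1]
    rw [lintegral_mul_const' _ _ hintg]
    exact ENNReal.mul_ne_top hintg hintg
  have hsplit : ∀ Y, covTerm k h N Y ≤ ENNReal.ofReal (ξ ^ N) * (∑ i, ∫⁻ x, P i Y x) +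
      ∑ S, ∫⁻ x, Mx S Y x := by
    intro Y
    have hPY : ∀ i, Measurable fun x => P i Y x := fun i => (hPm i).comp measurable_prodMk_left
    have hMY : ∀ S, Measurable fun x => Mx S Y x := fun S =>
      Measurable.of_uncurry_left (f := Mx S) (hMm S)
    clear_value P Mx
    refine (lintegral_mono (hpt Y)).trans (le_of_eq ?_)
    rw [lintegral_add_right _ (Finset.measurable_sum _ fun S _ => hMY S),
      lintegral_const_mul' _ _ ENNReal.ofReal_ne_top,
      lintegral_finsetSum _ fun i _ => hPY i, lintegral_finsetSum _ fun S _ => hMY S]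
  refine ne_top_of_le_ne_top ?_ (lintegral_mono hsplit)
  have hPI : ∀ i, Measurable fun Y => ∫⁻ x, P i Y x := fun i => (hPm i).lintegral_prod_right'
  have hMI : ∀ S, Measurable fun Y => ∫⁻ x, Mx S Y x := fun S => (hMm S).lintegral_prod_right'
  rw [lintegral_add_right _ (Finset.measurable_sum _ fun S _ => hMI S),
    lintegral_const_mul' _ _ ENNReal.ofReal_ne_top,
    lintegral_finsetSum _ fun i _ => hPI i, lintegral_finsetSum _ fun S _ => hMI S]
  refine ENNReal.add_ne_top.2 ⟨ENNReal.mul_ne_top ENNReal.ofReal_ne_top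
    (ENNReal.sum_ne_top.2 fun i _ => ?_), ENNReal.sum_ne_top.2 fun S _ => hmix S⟩
  refine ne_top_of_le_ne_top ?_ (lintegral_mono (hPle i))
  rw [lintegral_mul_const' _ _ (ENNReal.pow_ne_top hGt)]
  exact ENNReal.mul_ne_top hvI (ENNReal.pow_ne_top hGt)

lemma sq_lintegral_mul_le {E : Type*} [MeasurableSpace E] {ν : Measure E} [SFinite ν]
    {α f : E → ℝ≥0∞} (hα : Measurable α) (hf : Measurable f) :
    (∫⁻ y, α y * f y ∂ν) ^ 2 ≤ 2 * (∫⁻ y, α y ∂ν) * ∫⁻ y, α y * f y ^ 2 ∂ν := by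
  have hαf : Measurable fun y => α y * f y := hα.mul hf
  have hαf2 : Measurable fun y => α y * f y ^ 2 := hα.mul (hf.pow_const 2)
  rw [sq, ← lintegral_prod_mul hαf.aemeasurable hαf.aemeasurable]
  have hab : ∀ a b : ℝ≥0∞, a * b ≤ a ^ 2 + b ^ 2 := fun a b => by
    rcases le_total a b with h | h
    · calc a * b ≤ b * b := by gcongr
        _ ≤ _ := by rw [← sq]; exact le_add_self
    · calc a * b ≤ a * a := by gcongr
        _ ≤ _ := by rw [← sq]; exact le_self_add
  calc ∫⁻ p : E × E, α p.1 * f p.1 * (α p.2 * f p.2) ∂ν.prod ν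
      ≤ ∫⁻ p : E × E, (α p.1 * f p.1 ^ 2 * α p.2 + α p.1 * (α p.2 * f p.2 ^ 2)) ∂ν.prod ν := by
        refine lintegral_mono fun p => ?_
        calc _ = α p.1 * α p.2 * (f p.1 * f p.2) := by ring
          _ ≤ α p.1 * α p.2 * (f p.1 ^ 2 + f p.2 ^ 2) := by gcongr; exact hab _ _
          _ = _ := by ring
    _ = _ := by
        have hm : Measurable fun p : E × E => α p.1 * f p.1 ^ 2 * α p.2 :=
          (hαf2.comp measurable_fst).mul (hα.comp measurable_snd)
        rw [lintegral_add_left hm,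
          lintegral_prod_mul hαf2.aemeasurable hα.aemeasurable,
          lintegral_prod_mul hα.aemeasurable hαf2.aemeasurable]
        ring

lemma lintegral_ofReal_sq_integral_le {Ω E : Type*} [MeasurableSpace Ω] [MeasurableSpace E]
    {μ : Measure Ω} [SFinite μ] {ν : Measure E} [SFinite ν] {g : E → Ω → ℝ}
    (hg : Measurable (Function.uncurry g)) {C : ℝ≥0∞} (hCt : C ≠ ⊤)
    (hC : ∀ y, ∫⁻ ω, ENNReal.ofReal (g y ω ^ 2) ∂μ ≤ C) {α : E → ℝ} (hα : Measurable α)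
    (hα0 : ∀ y, 0 ≤ α y) (hαi : ∫⁻ y, ENNReal.ofReal (α y) ∂ν ≠ ⊤) {K : E → E → ℝ≥0∞}
    (hK : ∀ y y', ENNReal.ofReal |∫ ω, g y ω * g y' ω ∂μ| ≤ K y y') :
    ∫⁻ ω, ENNReal.ofReal ((∫ y, α y * g y ω ∂ν) ^ 2) ∂μ
      ≤ ∫⁻ p : E × E, ENNReal.ofReal (α p.1) * ENNReal.ofReal (α p.2) * K p.1 p.2 ∂ν.prod ν := by
  set Φ : Ω × (E × E) → ℝ := fun q => α q.2.1 * g q.2.1 q.1 * (α q.2.2 * g q.2.2 q.1) with hΦ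
  have hg1 : Measurable fun q : Ω × (E × E) => g q.2.1 q.1 :=
    hg.comp ((measurable_fst.comp measurable_snd).prodMk measurable_fst)
  have hg2 : Measurable fun q : Ω × (E × E) => g q.2.2 q.1 :=
    hg.comp ((measurable_snd.comp measurable_snd).prodMk measurable_fst)
  have hα1 : Measurable fun q : Ω × (E × E) => α q.2.1 :=
    hα.comp (measurable_fst.comp measurable_snd)
  have hα2 : Measurable fun q : Ω × (E × E) => α q.2.2 :=
    hα.comp (measurable_snd.comp measurable_snd)
  have hΦm : Measurable Φ := (hα1.mul hg1).mul (hα2.mul hg2)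
  have hαp : ∫⁻ p : E × E, ENNReal.ofReal (α p.1) * ENNReal.ofReal (α p.2) ∂ν.prod ν ≠ ⊤ := by
    rw [lintegral_prod_mul hα.ennreal_ofReal.aemeasurable hα.ennreal_ofReal.aemeasurable]
    exact ENNReal.mul_ne_top hαi hαi
  have hgm : ∀ y, Measurable (g y) := fun y => hg.comp measurable_prodMk_left
  have hgg : ∀ y y', ∫⁻ ω, ENNReal.ofReal |g y ω * g y' ω| ∂μ ≤ C + C := fun y y' => by
    calc _ ≤ ∫⁻ ω, (ENNReal.ofReal (g y ω ^ 2) + ENNReal.ofReal (g y' ω ^ 2)) ∂μ := by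
          refine lintegral_mono fun ω => ?_
          rw [← ENNReal.ofReal_add (sq_nonneg _) (sq_nonneg _)]
          refine ENNReal.ofReal_le_ofReal (abs_le.2 ⟨?_, ?_⟩) <;>
            nlinarith [sq_nonneg (g y ω + g y' ω), sq_nonneg (g y ω - g y' ω)]
      _ ≤ _ := by
          rw [lintegral_add_left ((hgm y).pow_const 2).ennreal_ofReal]
          exact add_le_add (hC y) (hC y')
  have hΦi : Integrable Φ (μ.prod (ν.prod ν)) := by
    refine ⟨hΦm.aestronglyMeasurable, ?_⟩
    rw [hasFiniteIntegral_iff_norm, lintegral_prod_symm _ hΦm.norm.ennreal_ofReal.aemeasurable]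
    refine lt_of_le_of_lt (lintegral_mono (g := fun p : E × E => ENNReal.ofReal (α p.1) *
      ENNReal.ofReal (α p.2) * (C + C)) fun p => ?_) ?_
    · have h1 : ∀ ω, ENNReal.ofReal ‖Φ (ω, p)‖ = ENNReal.ofReal (α p.1) *
          ENNReal.ofReal (α p.2) * ENNReal.ofReal |g p.1 ω * g p.2 ω| := fun ω => by
        rw [← ENNReal.ofReal_mul (hα0 _), ← ENNReal.ofReal_mul (mul_nonneg (hα0 _) (hα0 _)),
          Real.norm_eq_abs]
        congr 1
        rw [hΦ]
        simp only [abs_mul, abs_of_nonneg (hα0 _)]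
        ring
      simp_rw [h1]
      rw [lintegral_const_mul' _ _ (ENNReal.mul_ne_top ENNReal.ofReal_ne_top ENNReal.ofReal_ne_top)]
      gcongr
      exact hgg _ _
    · have hCC : C + C ≠ ⊤ := ENNReal.add_ne_top.2 ⟨hCt, hCt⟩
      rw [lintegral_mul_const' _ _ hCC]
      exact (ENNReal.mul_ne_top hαp hCC).lt_top
  have hsq : ∀ ω, (∫ y, α y * g y ω ∂ν) ^ 2 = ∫ p, Φ (ω, p) ∂ν.prod ν := fun ω => by
    rw [sq, ← integral_prod_mul]
  have hin : Integrable (fun ω => (∫ y, α y * g y ω ∂ν) ^ 2) μ := by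
    simp_rw [hsq]
    exact hΦi.integral_prod_left
  rw [← ofReal_integral_eq_lintegral_ofReal hin (Eventually.of_forall fun ω => sq_nonneg _)]
  simp_rw [hsq]
  rw [integral_integral_swap (f := fun ω p => Φ (ω, p)) hΦi]
  refine (ENNReal.ofReal_le_ofReal (le_abs_self _)).trans ?_
  rw [← Real.enorm_eq_ofReal_abs]
  refine (enorm_integral_le_lintegral_enorm _).trans (lintegral_mono fun p => ?_)
  have h2 : ∫ ω, Φ (ω, p) ∂μ = α p.1 * α p.2 * ∫ ω, g p.1 ω * g p.2 ω ∂μ := by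
    rw [← integral_const_mul]
    refine integral_congr_ae (Eventually.of_forall fun ω => ?_)
    simp only [hΦ]
    ring
  rw [h2, enorm_mul, enorm_mul, Real.enorm_eq_ofReal (hα0 _), Real.enorm_eq_ofReal (hα0 _),
    Real.enorm_eq_ofReal_abs]
  gcongr
  exact hK _ _

lemma Setting.integral_cfgProd_shift {d : ℕ} {s z B ξ : ℝ} {φ : EucSp d → EReal}
    {μ : Measure (Config d)} {k u : ∀ n : ℕ, (Fin n → EucSp d) → ℝ}
    (h : Setting d s z B ξ φ μ k u) (y : EucSp d) {p : EucSp d → ℝ} (hpm : Measurable p)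
    (hpi : ∫⁻ x, ENNReal.ofReal |p x| ≠ ⊤) :
    ∫ γ, cfgProd (fun x => p (x - y)) γ ∂μ = corrGen k p := by
  have := h.prob
  have hm : Measurable fun x => p (x - y) := hpm.comp (measurable_id.sub_const y)
  have hpi' : ∫⁻ x, ENNReal.ofReal |p (x - y)| ≠ ⊤ := by
    rw [lintegral_sub_right_eq_self (fun x => ENNReal.ofReal |p x|) y]
    exact hpi
  rw [(integral_cfgProd h.corr h.hξ.le h.ruelle hm hpi').2, corrGen_shift h.ti]

lemma Setting.ae_jumpFactor_mul {d : ℕ} {s z B ξ : ℝ} {φ : EucSp d → EReal}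
    {μ : Measure (Config d)} {k u : ∀ n : ℕ, (Fin n → EucSp d) → ℝ}
    (h : Setting d s z B ξ φ μ k u) (y y' : EucSp d) :
    ∀ᵐ γ ∂μ, jumpFactor s φ y γ * jumpFactor s φ y' γ
      = cfgProd (fun x => pairFn (mayer s φ) (y' - y) (x - y)) γ := by
  have hf : (fun x => pairFn (mayer s φ) (y' - y) (x - y)) = fun x => mayer s φ (x - y) +
      mayer s φ (x - y') + mayer s φ (x - y) * mayer s φ (x - y') := by
    funext x
    simp only [pairFn, sub_sub_sub_cancel_right]
  rw [hf]
  filter_upwards [h.ae_jumpFactor y, h.ae_jumpFactor y'] with γ h1 h2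
  obtain ⟨-, hs1, e1, -⟩ := h1
  obtain ⟨-, hs2, e2, -⟩ := h2
  rw [e1, e2]
  exact cfgProd_mul (h₁ := fun x => mayer s φ (x - y)) (h₂ := fun x => mayer s φ (x - y')) hs1 hs2

lemma Setting.integral_jumpFactor_mul {d : ℕ} {s z B ξ : ℝ} {φ : EucSp d → EReal}
    {μ : Measure (Config d)} {k u : ∀ n : ℕ, (Fin n → EucSp d) → ℝ}
    (h : Setting d s z B ξ φ μ k u) (y y' : EucSp d) :
    ∫ γ, jumpFactor s φ y γ * jumpFactor s φ y' γ ∂μ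
      = corrGen k (pairFn (mayer s φ) (y' - y)) := by
  have hwm : Measurable (mayer s φ) := measurable_mayer h.pp
  have hW := abs_mayer_le_const h.hs0 (by linarith [h.hs1]) h.pp h.hB h.stable
  have hpm : Measurable (pairFn (mayer s φ) (y' - y)) := by
    have := measurable_pairFn hwm
    exact Measurable.comp (f := fun x => (y' - y, x)) this measurable_prodMk_left
  rw [integral_congr_ae (h.ae_jumpFactor_mul y y')]
  exact h.integral_cfgProd_shift y hpm (lintegral_abs_pairFn_ne_top hwm hW h.lintegral_mayer _)

lemma Setting.cov_jumpFactor_le {d : ℕ} {s z B ξ : ℝ} {φ : EucSp d → EReal}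
    {μ : Measure (Config d)} {k u : ∀ n : ℕ, (Fin n → EucSp d) → ℝ}
    (h : Setting d s z B ξ φ μ k u) (y y' : EucSp d) :
    ENNReal.ofReal |∫ γ, (jumpFactor s φ y γ - corrGen k (mayer s φ)) *
        (jumpFactor s φ y' γ - corrGen k (mayer s φ)) ∂μ|
      ≤ ∑' N : ℕ, (N.factorial : ℝ≥0∞)⁻¹ * covTerm k (mayer s φ) N (y' - y) := by
  have := h.prob
  set w := mayer s φ with hw
  set M := corrGen k w with hM
  have hwm : Measurable w := measurable_mayer h.pp
  have hW := abs_mayer_le_const h.hs0 (by linarith [h.hs1]) h.pp h.hB h.stable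
  have hwi := h.lintegral_mayer
  have i1 := (h.memLp_jumpFactor y).integrable (by norm_num)
  have i2 := (h.memLp_jumpFactor y').integrable (by norm_num)
  have i12 : Integrable (fun γ => jumpFactor s φ y γ * jumpFactor s φ y' γ) μ :=
    (h.memLp_jumpFactor y).integrable_mul (h.memLp_jumpFactor y')
  have hprod := h.integral_jumpFactor_mul y y'
  have hcov : ∫ γ, (jumpFactor s φ y γ - M) * (jumpFactor s φ y' γ - M) ∂μ
      = corrGen k (pairFn w (y' - y)) - M ^ 2 := by
    have h2 : ∀ γ, (jumpFactor s φ y γ - M) * (jumpFactor s φ y' γ - M)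
        = jumpFactor s φ y γ * jumpFactor s φ y' γ - M * jumpFactor s φ y γ
          - M * jumpFactor s φ y' γ + M ^ 2 := fun γ => by ring
    have i3 : Integrable (fun γ => jumpFactor s φ y γ * jumpFactor s φ y' γ -
        M * jumpFactor s φ y γ) μ := i12.sub (i1.const_mul M)
    have i4 : Integrable (fun γ => jumpFactor s φ y γ * jumpFactor s φ y' γ -
        M * jumpFactor s φ y γ - M * jumpFactor s φ y' γ) μ := i3.sub (i2.const_mul M)
    simp_rw [h2]
    rw [integral_add i4 (integrable_const _), integral_sub i3 (i2.const_mul M),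
      integral_sub i12 (i1.const_mul M),
      integral_const_mul, integral_const_mul, h.integral_jumpFactor, h.integral_jumpFactor, hprod,
      integral_const]
    simp only [probReal_univ, smul_eq_mul, one_mul]
    ring
  rw [hcov]
  exact abs_corrGen_sub_sq_le h.corr h.hξ.le h.ruelle h.ti hwm hW hwi _

/-- The bound on the variance of a spatial average of the jump factor. -/
lemma Setting.exists_variance_bound {d : ℕ} {s z B ξ : ℝ} {φ : EucSp d → EReal}
    {μ : Measure (Config d)} {k u : ∀ n : ℕ, (Fin n → EucSp d) → ℝ}
    (h : Setting d s z B ξ φ μ k u) :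
    ∃ (R : ℕ → ℝ≥0∞) (D : ℝ≥0∞), (∀ N, R N ≠ ⊤) ∧ D ≠ ⊤ ∧
      ∀ (α : EucSp d → ℝ) (m : ℝ≥0∞), Measurable α → (∀ y, 0 ≤ α y) →
        (∀ y, ENNReal.ofReal (α y) ≤ m) → ∫⁻ y, ENNReal.ofReal (α y) ≠ ⊤ →
        ∫⁻ γ, ENNReal.ofReal
            ((∫ y, α y * (jumpFactor s φ y γ - corrGen k (mayer s φ))) ^ 2) ∂μ
          ≤ ∑' N : ℕ, (N.factorial : ℝ≥0∞)⁻¹ * min ((∫⁻ y, ENNReal.ofReal (α y)) * (m * R N))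
            ((∫⁻ y, ENNReal.ofReal (α y)) ^ 2 * (2 * D ^ N)) := by
  have := h.prob
  set w := mayer s φ with hw
  set M := corrGen k w with hM
  have hwm : Measurable w := measurable_mayer h.pp
  have hW := abs_mayer_le_const h.hs0 (by linarith [h.hs1]) h.pp h.hB h.stable
  have hwi := h.lintegral_mayer
  set D : ℝ≥0∞ := ENNReal.ofReal ξ * ((2 + ENNReal.ofReal (Real.exp (2 * B) + 1)) *
    ∫⁻ x, ENNReal.ofReal |w x|) with hD
  have huint : ∀ m : ℕ, ∫⁻ y : Fin (m + 1) → EucSp d,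
      ENNReal.ofReal |u (m + 2) (Fin.cons 0 y)| ≠ ⊤ := fun m => by
    have := (h.ursellInt m).2
    rw [hasFiniteIntegral_iff_norm] at this
    exact this.ne
  refine ⟨fun N => ∫⁻ Y, covTerm k w N Y, D, fun N => lintegral_covTerm_ne_top h.corr h.ruelle
    h.ti h.ursell huint hwm hW hwi N, ENNReal.mul_ne_top ENNReal.ofReal_ne_top
    (ENNReal.mul_ne_top (ENNReal.add_ne_top.2 ⟨ENNReal.ofNat_ne_top, ENNReal.ofReal_ne_top⟩) hwi),
    fun α m hα hα0 hαm hαi => ?_⟩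
  have hjm := measurable_jumpFactor s h.pp.meas
  obtain ⟨c2, hc2⟩ := h.lintegral_jumpFactor_pow_le 2
  have hC : ∀ y, ∫⁻ γ, ENNReal.ofReal ((jumpFactor s φ y γ - M) ^ 2) ∂μ
      ≤ 2 * ENNReal.ofReal c2 + ENNReal.ofReal (2 * M ^ 2) := fun y => by
    have hjy : Measurable fun γ => ENNReal.ofReal (jumpFactor s φ y γ ^ 2) :=
      ((hjm.comp measurable_prodMk_left).pow_const 2).ennreal_ofReal
    calc _ ≤ ∫⁻ γ, (2 * ENNReal.ofReal (jumpFactor s φ y γ ^ 2) + ENNReal.ofReal (2 * M ^ 2)) ∂μ := by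
          refine lintegral_mono fun γ => ?_
          rw [← ENNReal.ofReal_ofNat 2, ← ENNReal.ofReal_mul (by norm_num),
            ← ENNReal.ofReal_add (by positivity) (by positivity)]
          refine ENNReal.ofReal_le_ofReal ?_
          nlinarith [sq_nonneg (jumpFactor s φ y γ + M)]
      _ ≤ _ := by
          rw [lintegral_add_right _ measurable_const, lintegral_const_mul _ hjy, lintegral_const,
            measure_univ, mul_one]
          gcongr
          exact hc2 y
  have hgm : Measurable (Function.uncurry fun (y : EucSp d) (γ : Config d) =>
      jumpFactor s φ y γ - M) := hjm.sub_const M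
  refine (lintegral_ofReal_sq_integral_le hgm (ENNReal.add_ne_top.2
    ⟨ENNReal.mul_ne_top ENNReal.ofNat_ne_top ENNReal.ofReal_ne_top, ENNReal.ofReal_ne_top⟩) hC
    hα hα0 hαi h.cov_jumpFactor_le).trans ?_
  have hcm : ∀ N, Measurable fun p : EucSp d × EucSp d => covTerm k w N (p.2 - p.1) := fun N =>
    (measurable_covTerm h.corr hwm N).comp (measurable_snd.sub measurable_fst)
  have hαα : Measurable fun p : EucSp d × EucSp d =>
      ENNReal.ofReal (α p.1) * ENNReal.ofReal (α p.2) :=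
    (hα.ennreal_ofReal.comp measurable_fst).mul (hα.ennreal_ofReal.comp measurable_snd)
  have hexp : ∀ p : EucSp d × EucSp d, ENNReal.ofReal (α p.1) * ENNReal.ofReal (α p.2) *
      ∑' N : ℕ, (N.factorial : ℝ≥0∞)⁻¹ * covTerm k w N (p.2 - p.1)
      = ∑' N : ℕ, (N.factorial : ℝ≥0∞)⁻¹ * (ENNReal.ofReal (α p.1) * ENNReal.ofReal (α p.2) *
        covTerm k w N (p.2 - p.1)) := fun p => by
    rw [← ENNReal.tsum_mul_left]
    exact tsum_congr fun N => by ring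
  refine (lintegral_congr hexp).trans_le ?_
  have hprodm : ∀ N, Measurable fun p : EucSp d × EucSp d => ENNReal.ofReal (α p.1) *
      ENNReal.ofReal (α p.2) * covTerm k w N (p.2 - p.1) := fun N => hαα.mul (hcm N)
  have hprodm' : ∀ N : ℕ, AEMeasurable (fun p : EucSp d × EucSp d =>
      (N.factorial : ℝ≥0∞)⁻¹ * (ENNReal.ofReal (α p.1) *
      ENNReal.ofReal (α p.2) * covTerm k w N (p.2 - p.1))) (volume.prod volume) := fun N =>
    ((hprodm N).const_mul _).aemeasurable
  rw [lintegral_tsum hprodm']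
  refine ENNReal.tsum_le_tsum fun N => ?_
  rw [lintegral_const_mul _ (hprodm N)]
  refine mul_le_mul' le_rfl (le_min ?_ ?_)
  · rw [lintegral_prod _ (hprodm N).aemeasurable]
    calc _ ≤ ∫⁻ y, ENNReal.ofReal (α y) * (m * ∫⁻ Y, covTerm k w N Y) := by
          refine lintegral_mono fun y => ?_
          have h1 : ∀ y', ENNReal.ofReal (α y) * ENNReal.ofReal (α y') * covTerm k w N (y' - y)
              ≤ ENNReal.ofReal (α y) * m * covTerm k w N (y' - y) := fun y' => by
            gcongr
            exact hαm y'
          refine (lintegral_mono h1).trans (le_of_eq ?_)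
          have hcy : Measurable fun y' => covTerm k w N (y' - y) :=
            (measurable_covTerm h.corr hwm N).comp (measurable_id.sub_const y)
          rw [lintegral_const_mul _ hcy, lintegral_sub_right_eq_self (covTerm k w N) y, mul_assoc]
      _ = _ := lintegral_mul_const _ hα.ennreal_ofReal
  · have h1 : ∀ p : EucSp d × EucSp d, ENNReal.ofReal (α p.1) * ENNReal.ofReal (α p.2) *
        covTerm k w N (p.2 - p.1) ≤ ENNReal.ofReal (α p.1) * ENNReal.ofReal (α p.2) *
          (2 * D ^ N) := fun p => by
      gcongr
      exact covTerm_le h.corr h.hξ.le h.ruelle hwm hW N _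
    refine (lintegral_mono h1).trans (le_of_eq ?_)
    rw [lintegral_mul_const _ hαα, lintegral_prod_mul hα.ennreal_ofReal.aemeasurable
      hα.ennreal_ofReal.aemeasurable, sq]

lemma jumpFactor_nonneg {d : ℕ} (s : ℝ) (φ : EucSp d → EReal) (y : EucSp d) (γ : Config d) :
    0 ≤ jumpFactor s φ y γ := rexp_nonneg _

lemma Setting.lintegral_average_pow_four_le {d : ℕ} {s z B ξ : ℝ} {φ : EucSp d → EReal}
    {μ : Measure (Config d)} {k u : ∀ n : ℕ, (Fin n → EucSp d) → ℝ}
    (h : Setting d s z B ξ φ μ k u) :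
    ∃ m : ℝ, ∀ α : EucSp d → ℝ, Measurable α → (∀ y, 0 ≤ α y) →
      ∫⁻ γ, ENNReal.ofReal ((∫ y, α y * jumpFactor s φ y γ) ^ 4) ∂μ
        ≤ 8 * (∫⁻ y, ENNReal.ofReal (α y)) ^ 4 * ENNReal.ofReal m := by
  have := h.prob
  obtain ⟨m, hm⟩ := h.lintegral_jumpFactor_pow_le 4
  refine ⟨m, fun α hα hα0 => ?_⟩
  set c := ∫⁻ y, ENNReal.ofReal (α y) with hc
  have hjm := measurable_jumpFactor s h.pp.meas
  have hαm : Measurable fun y => ENNReal.ofReal (α y) := hα.ennreal_ofReal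
  have hpt : ∀ γ : Config d, ENNReal.ofReal ((∫ y, α y * jumpFactor s φ y γ) ^ 4)
      ≤ 8 * c ^ 3 * ∫⁻ y, ENNReal.ofReal (α y) * ENNReal.ofReal (jumpFactor s φ y γ ^ 4) :=
    fun γ => by
    have hψ : Measurable fun y => ENNReal.ofReal (jumpFactor s φ y γ) :=
      (hjm.comp measurable_prodMk_right).ennreal_ofReal
    have hψ2 : Measurable fun y => ENNReal.ofReal (jumpFactor s φ y γ) ^ 2 := hψ.pow_const 2
    have h0 : 0 ≤ ∫ y, α y * jumpFactor s φ y γ :=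
      integral_nonneg fun y => mul_nonneg (hα0 y) (jumpFactor_nonneg _ _ _ _)
    have h1 : ENNReal.ofReal (∫ y, α y * jumpFactor s φ y γ)
        ≤ ∫⁻ y, ENNReal.ofReal (α y) * ENNReal.ofReal (jumpFactor s φ y γ) := by
      rw [← Real.enorm_eq_ofReal h0]
      refine (enorm_integral_le_lintegral_enorm _).trans (le_of_eq (lintegral_congr fun y => ?_))
      rw [enorm_mul, Real.enorm_eq_ofReal (hα0 y), Real.enorm_eq_ofReal (jumpFactor_nonneg _ _ _ _)]
    calc ENNReal.ofReal ((∫ y, α y * jumpFactor s φ y γ) ^ 4)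
        = ((ENNReal.ofReal (∫ y, α y * jumpFactor s φ y γ)) ^ 2) ^ 2 := by
          rw [ENNReal.ofReal_pow h0, ← pow_mul]
      _ ≤ ((∫⁻ y, ENNReal.ofReal (α y) * ENNReal.ofReal (jumpFactor s φ y γ)) ^ 2) ^ 2 := by
          gcongr
      _ ≤ (2 * c * ∫⁻ y, ENNReal.ofReal (α y) * ENNReal.ofReal (jumpFactor s φ y γ) ^ 2) ^ 2 := by
          gcongr
          exact sq_lintegral_mul_le hαm hψ
      _ = 4 * c ^ 2 *
          (∫⁻ y, ENNReal.ofReal (α y) * ENNReal.ofReal (jumpFactor s φ y γ) ^ 2) ^ 2 := by ring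
      _ ≤ 4 * c ^ 2 * (2 * c *
          ∫⁻ y, ENNReal.ofReal (α y) * (ENNReal.ofReal (jumpFactor s φ y γ) ^ 2) ^ 2) := by
          gcongr
          exact sq_lintegral_mul_le hαm hψ2
      _ = _ := by
          simp_rw [← pow_mul, ← ENNReal.ofReal_pow (jumpFactor_nonneg _ _ _ _)]
          ring
  have hψ4 : Measurable fun p : Config d × EucSp d => ENNReal.ofReal (α p.2) *
      ENNReal.ofReal (jumpFactor s φ p.2 p.1 ^ 4) :=
    (hαm.comp measurable_snd).mul ((hjm.comp measurable_swap).pow_const 4).ennreal_ofReal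
  have hI : Measurable fun γ : Config d => ∫⁻ y, ENNReal.ofReal (α y) *
      ENNReal.ofReal (jumpFactor s φ y γ ^ 4) := hψ4.lintegral_prod_right'
  refine (lintegral_mono hpt).trans ?_
  rw [lintegral_const_mul _ hI,
    lintegral_lintegral_swap (f := fun (γ : Config d) y => ENNReal.ofReal (α y) *
      ENNReal.ofReal (jumpFactor s φ y γ ^ 4)) hψ4.aemeasurable]
  calc _ ≤ 8 * c ^ 3 * ∫⁻ y, ENNReal.ofReal (α y) * ENNReal.ofReal m := by
        gcongr with y
        have hψy : Measurable fun γ => ENNReal.ofReal (jumpFactor s φ y γ ^ 4) :=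
          ((hjm.comp measurable_prodMk_left).pow_const 4).ennreal_ofReal
        rw [lintegral_const_mul _ hψy]
        gcongr
        exact hm y
    _ = _ := by
        rw [lintegral_mul_const _ hαm, ← hc]
        ring

lemma Setting.ae_integral_sub {d : ℕ} {s z B ξ : ℝ} {φ : EucSp d → EReal}
    {μ : Measure (Config d)} {k u : ∀ n : ℕ, (Fin n → EucSp d) → ℝ}
    (h : Setting d s z B ξ φ μ k u) {α : EucSp d → ℝ} (hα : Integrable α) (hαm : Measurable α)
    (hα0 : ∀ y, 0 ≤ α y) (M : ℝ) :
    ∀ᵐ γ ∂μ, ∫ y, α y * (jumpFactor s φ y γ - M)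
      = (∫ y, α y * jumpFactor s φ y γ) - (∫ y, α y) * M := by
  have := h.prob
  obtain ⟨m, hm⟩ := h.lintegral_jumpFactor_pow_le 1
  simp only [pow_one] at hm
  have hjm := measurable_jumpFactor s h.pp.meas
  have hψ : Measurable fun p : Config d × EucSp d => ENNReal.ofReal (α p.2) *
      ENNReal.ofReal (jumpFactor s φ p.2 p.1) :=
    (hαm.ennreal_ofReal.comp measurable_snd).mul (hjm.comp measurable_swap).ennreal_ofReal
  have hI : Measurable fun γ : Config d => ∫⁻ y, ENNReal.ofReal (α y) *
      ENNReal.ofReal (jumpFactor s φ y γ) := hψ.lintegral_prod_right'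
  have hfin : ∫⁻ γ, (∫⁻ y : EucSp d, ENNReal.ofReal (α y) *
      ENNReal.ofReal (jumpFactor s φ y γ)) ∂μ ≠ ⊤ := by
    rw [lintegral_lintegral_swap (f := fun (γ : Config d) y => ENNReal.ofReal (α y) *
      ENNReal.ofReal (jumpFactor s φ y γ)) hψ.aemeasurable]
    have hle : ∫⁻ y : EucSp d, ∫⁻ γ : Config d, ENNReal.ofReal (α y) * ENNReal.ofReal (jumpFactor s φ y γ) ∂μ
        ≤ ∫⁻ y : EucSp d, ENNReal.ofReal (α y) * ENNReal.ofReal m := by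
      refine lintegral_mono fun y => ?_
      have hψy : Measurable fun γ => ENNReal.ofReal (jumpFactor s φ y γ) :=
        (hjm.comp measurable_prodMk_left).ennreal_ofReal
      rw [lintegral_const_mul _ hψy]
      gcongr
      exact hm y
    refine ne_top_of_le_ne_top ?_ hle
    rw [lintegral_mul_const _ hαm.ennreal_ofReal]
    refine ENNReal.mul_ne_top ?_ ENNReal.ofReal_ne_top
    rw [← ofReal_integral_eq_lintegral_ofReal hα (Eventually.of_forall hα0)]
    exact ENNReal.ofReal_ne_top
  filter_upwards [ae_lt_top hI hfin] with γ hγ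
  have hi : Integrable (fun y => α y * jumpFactor s φ y γ) := by
    refine ⟨(hαm.mul (hjm.comp measurable_prodMk_right)).aestronglyMeasurable, ?_⟩
    rw [hasFiniteIntegral_iff_enorm]
    refine lt_of_le_of_lt (le_of_eq (lintegral_congr fun y => ?_)) hγ
    rw [enorm_mul, Real.enorm_eq_ofReal (hα0 y), Real.enorm_eq_ofReal (jumpFactor_nonneg _ _ _ _)]
  simp_rw [mul_sub]
  rw [integral_sub hi (hα.mul_const M), integral_mul_const]

lemma tendsto_tsum_min_zero {c D : ℝ≥0∞} (hc : c ≠ ⊤) (hD : D ≠ ⊤) {R : ℕ → ℝ≥0∞}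
    (hR : ∀ N, R N ≠ ⊤) {ι : Type*} {l : Filter ι} [l.IsCountablyGenerated] {m : ι → ℝ≥0∞}
    (hm : Tendsto m l (𝓝 0)) :
    Tendsto (fun i => ∑' N : ℕ, (N.factorial : ℝ≥0∞)⁻¹ * min (c * (m i * R N))
      (c ^ 2 * (2 * D ^ N))) l (𝓝 0) := by
  have key : Tendsto (fun i => ∫⁻ N : ℕ, (N.factorial : ℝ≥0∞)⁻¹ * min (c * (m i * R N))
      (c ^ 2 * (2 * D ^ N)) ∂Measure.count) l (𝓝 (∫⁻ _ : ℕ, 0 ∂Measure.count)) := by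
    refine tendsto_lintegral_filter_of_dominated_convergence
      (fun N : ℕ => (N.factorial : ℝ≥0∞)⁻¹ * (c ^ 2 * (2 * D ^ N)))
      (Eventually.of_forall fun i => measurable_of_countable _)
      (Eventually.of_forall fun i => Eventually.of_forall fun N => ?_) ?_
      (Eventually.of_forall fun N => ?_)
    · gcongr
      exact min_le_right _ _
    · rw [lintegral_count]
      have h1 : ∀ N : ℕ, (N.factorial : ℝ≥0∞)⁻¹ * (c ^ 2 * (2 * D ^ N))
          = c ^ 2 * 2 * ((N.factorial : ℝ≥0∞)⁻¹ * ENNReal.ofReal D.toReal ^ N) := fun N => by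
        rw [ENNReal.ofReal_toReal hD]
        ring
      simp_rw [h1]
      rw [ENNReal.tsum_mul_left, tsum_inv_factorial_mul_pow _ ENNReal.toReal_nonneg]
      exact ENNReal.mul_ne_top (ENNReal.mul_ne_top (ENNReal.pow_ne_top hc) ENNReal.ofNat_ne_top)
        ENNReal.ofReal_ne_top
    · have hf : (N.factorial : ℝ≥0∞)⁻¹ ≠ ⊤ :=
        ENNReal.inv_ne_top.2 (by exact_mod_cast N.factorial_ne_zero)
      have h2 : Tendsto (fun i => (N.factorial : ℝ≥0∞)⁻¹ * (c * (m i * R N))) l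
          (𝓝 ((N.factorial : ℝ≥0∞)⁻¹ * (c * (0 * R N)))) :=
        ENNReal.Tendsto.const_mul (ENNReal.Tendsto.const_mul
          (ENNReal.Tendsto.mul_const hm (Or.inr (hR N))) (Or.inr hc)) (Or.inr hf)
      rw [zero_mul, mul_zero, mul_zero] at h2
      refine tendsto_of_tendsto_of_tendsto_of_le_of_le tendsto_const_nhds h2 (fun _ => zero_le)
        fun i => ?_
      gcongr
      exact min_le_left _ _
  simpa only [lintegral_count, lintegral_zero, tsum_zero] using key

lemma integrable_aScaled_sub {d : ℕ} {a : EucSp d → ℝ} (ha : GoodA a) {ε : ℝ} (hε : 0 < ε)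
    (x : EucSp d) : Integrable fun y => aScaled a ε (x - y) := by
  have h1 : Integrable (aScaled a ε) := (ha.int.comp_smul hε.ne').const_mul _
  exact h1.comp_sub_left x

lemma integral_aScaled_sub {d : ℕ} (a : EucSp d → ℝ) {ε : ℝ} (hε : 0 < ε)
    (x : EucSp d) : ∫ y, aScaled a ε (x - y) = ∫ y, a y := by
  rw [integral_sub_left_eq_self (aScaled a ε) volume x]
  unfold aScaled
  rw [integral_const_mul, Measure.integral_comp_smul, finrank_euclideanSpace_fin,
    abs_of_pos (by positivity), smul_eq_mul, ← mul_assoc, mul_inv_cancel₀ (by positivity), one_mul]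

lemma measurable_aScaled {d : ℕ} {a : EucSp d → ℝ} (ha : GoodA a) (ε : ℝ) :
    Measurable (aScaled a ε) := (ha.meas.comp (measurable_const_smul ε)).const_mul _

/-- The averaged jump factor is close to one in `L²`, uniformly in the base point, and has
uniformly bounded fourth moments. -/
lemma Setting.exists_deviation_bounds {d : ℕ} {s z B ξ : ℝ} {φ : EucSp d → EReal}
    {μ : Measure (Config d)} {k u : ∀ n : ℕ, (Fin n → EucSp d) → ℝ}
    (h : Setting d s z B ξ φ μ k u) {a : EucSp d → ℝ} (ha : GoodA a)
    (hnorm : NormalizedA s a φ μ) :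
    ∃ (T : ℝ → ℝ≥0∞) (C : ℝ≥0∞), Tendsto T (𝓝[>] 0) (𝓝 0) ∧ C ≠ ⊤ ∧ ∀ ε > 0, ∀ x : EucSp d,
      ∫⁻ γ, ENNReal.ofReal (((∫ y, aScaled a ε (x - y) * jumpFactor s φ y γ) - 1) ^ 2) ∂μ ≤ T ε ∧
      ∫⁻ γ, ENNReal.ofReal (((∫ y, aScaled a ε (x - y) * jumpFactor s φ y γ) - 1) ^ 4) ∂μ
        ≤ C := by
  have := h.prob
  obtain ⟨R, D, hR, hD, hvar⟩ := h.exists_variance_bound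
  obtain ⟨m4, hm4⟩ := h.lintegral_average_pow_four_le
  obtain ⟨Ca, hCa⟩ := ha.bdd
  have hM := h.corrGen_mayer_pos
  have hintA : (∫ y, a y) * corrGen k (mayer s φ) = 1 := by
    rw [show (∫ y, a y) = _ from hnorm, h.integral_totPhi, inv_mul_cancel₀ hM.ne']
  set c : ℝ≥0∞ := ENNReal.ofReal (∫ y, a y) with hc
  have hα0 : ∀ ε > (0 : ℝ), ∀ x y : EucSp d, 0 ≤ aScaled a ε (x - y) := fun ε hε x y =>
    mul_nonneg (pow_nonneg hε.le _) (ha.nonneg _)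
  have hαc : ∀ ε > (0 : ℝ), ∀ x : EucSp d, ∫⁻ y, ENNReal.ofReal (aScaled a ε (x - y)) = c :=
    fun ε hε x => by
    rw [← ofReal_integral_eq_lintegral_ofReal (integrable_aScaled_sub ha hε x)
      (Eventually.of_forall (hα0 ε hε x)), integral_aScaled_sub a hε]
  have hαm : ∀ (ε : ℝ) (x : EucSp d), Measurable fun y => aScaled a ε (x - y) := fun ε x =>
    (measurable_aScaled ha ε).comp (measurable_id.const_sub x)
  refine ⟨fun ε => ∑' N : ℕ, (N.factorial : ℝ≥0∞)⁻¹ *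
    min (c * (ENNReal.ofReal (ε ^ d * Ca) * R N)) (c ^ 2 * (2 * D ^ N)),
    8 * c ^ 4 * ENNReal.ofReal m4 + 1, ?_, ?_, fun ε hε x => ⟨?_, ?_⟩⟩
  · refine tendsto_tsum_min_zero ENNReal.ofReal_ne_top hD hR ?_
    have h1 : Tendsto (fun ε : ℝ => ENNReal.ofReal (ε ^ d * Ca)) (𝓝[>] 0)
        (𝓝 (ENNReal.ofReal (0 ^ d * Ca))) :=
      ((ENNReal.continuous_ofReal.comp ((continuous_pow d).mul_const Ca)).tendsto 0).mono_left
        nhdsWithin_le_nhds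
    rwa [zero_pow h.hd.ne', zero_mul, ENNReal.ofReal_zero] at h1
  · exact ENNReal.add_ne_top.2 ⟨ENNReal.mul_ne_top (ENNReal.mul_ne_top ENNReal.ofNat_ne_top
      (ENNReal.pow_ne_top ENNReal.ofReal_ne_top)) ENNReal.ofReal_ne_top, ENNReal.one_ne_top⟩
  · have hv := hvar (fun y => aScaled a ε (x - y)) (ENNReal.ofReal (ε ^ d * Ca)) (hαm ε x)
      (hα0 ε hε x) (fun y => ENNReal.ofReal_le_ofReal
        (mul_le_mul_of_nonneg_left (hCa _) (pow_nonneg hε.le _)))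
      (by rw [hαc ε hε x]; exact ENNReal.ofReal_ne_top)
    rw [hαc ε hε x] at hv
    refine le_trans (le_of_eq (lintegral_congr_ae ?_)) hv
    filter_upwards [h.ae_integral_sub (integrable_aScaled_sub ha hε x) (hαm ε x) (hα0 ε hε x)
      (corrGen k (mayer s φ))] with γ hγ
    rw [hγ, integral_aScaled_sub a hε, hintA]
  · have hv := hm4 (fun y => aScaled a ε (x - y)) (hαm ε x) (hα0 ε hε x)
    rw [hαc ε hε x] at hv
    calc _ ≤ ∫⁻ γ, (ENNReal.ofReal ((∫ y, aScaled a ε (x - y) * jumpFactor s φ y γ) ^ 4) + 1) ∂μ := by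
          refine lintegral_mono fun γ => ?_
          have h0 : 0 ≤ ∫ y, aScaled a ε (x - y) * jumpFactor s φ y γ :=
            integral_nonneg fun y => mul_nonneg (hα0 ε hε x y) (jumpFactor_nonneg _ _ _ _)
          rw [← ENNReal.ofReal_one, ← ENNReal.ofReal_add (by positivity) zero_le_one]
          refine ENNReal.ofReal_le_ofReal ?_
          generalize (∫ y, aScaled a ε (x - y) * jumpFactor s φ y γ) = t at h0
          nlinarith [mul_nonneg h0 (sq_nonneg (t - 1)), mul_nonneg h0 (sq_nonneg t)]
      _ ≤ _ := by
          rw [lintegral_add_right _ measurable_const, lintegral_const, measure_univ, mul_one]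
          gcongr

lemma finite_preimage_of_isCompact {d : ℕ} (γ : Config d) {K : Set (EucSp d)} (hK : IsCompact K) :
    {u : γ.1 | u.1 ∈ K}.Finite := by
  refine Set.Finite.of_finite_image ((γ.2 K hK).subset ?_) Subtype.val_injective.injOn
  rintro _ ⟨u, hu, rfl⟩
  exact ⟨u.2, hu⟩

lemma summable_of_vanish {d : ℕ} (γ : Config d) {K : Set (EucSp d)} (hK : IsCompact K)
    {t : γ.1 → ℝ} (ht : ∀ u : γ.1, u.1 ∉ K → t u = 0) : Summable t :=
  summable_of_hasFiniteSupport ((finite_preimage_of_isCompact γ hK).subset fun u hu => by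
    by_contra hn
    exact hu (ht u hn))

lemma Config.countable {d : ℕ} (γ : Config d) : γ.1.Countable := by
  have h : γ.1 = ⋃ n : ℕ, γ.1 ∩ Metric.closedBall 0 (n : ℝ) := by
    rw [← inter_iUnion, Metric.iUnion_closedBall_nat, inter_univ]
  rw [h]
  exact countable_iUnion fun n => (γ.2 _ (isCompact_closedBall _ _)).countable

lemma cpair_eq_del_add {d : ℕ} (γ : Config d) {K : Set (EucSp d)} (hK : IsCompact K)
    {f : EucSp d → ℝ} (hf : ∀ x, x ∉ K → f x = 0) {x : EucSp d} (hx : x ∈ γ.1) :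
    cpair f γ = cpair f (γ.del x) + f x := by
  have h1 : cpair f γ = ∑' y, γ.1.indicator f y := tsum_subtype _ _
  have h2 : cpair f (γ.del x) = ∑' y, (γ.1 \ {x}).indicator f y := tsum_subtype _ _
  have hs : Summable ((γ.1 \ {x}).indicator f) :=
    summable_subtype_iff_indicator.1 (summable_of_vanish (γ.del x) hK fun u hu => hf u.1 hu)
  have h3 : ∀ y, γ.1.indicator f y = (γ.1 \ {x}).indicator f y + (Pi.single x (f x) : EucSp d → ℝ) y :=
    fun y => by
    by_cases hyx : y = x
    · subst hyx
      rw [indicator_of_mem hx, indicator_of_notMem (fun h => h.2 rfl), Pi.single_eq_same, zero_add]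
    · rw [Pi.single_eq_of_ne hyx, add_zero]
      by_cases hy : y ∈ γ.1
      · rw [indicator_of_mem hy, indicator_of_mem (show y ∈ γ.1 \ {x} from ⟨hy, hyx⟩)]
      · rw [indicator_of_notMem hy, indicator_of_notMem fun h => hy h.1]
  have hs' : Summable (Pi.single x (f x) : EucSp d → ℝ) := (hasSum_pi_single x (f x)).summable
  rw [h1, h2, tsum_congr h3, hs.tsum_add hs', tsum_pi_single]

lemma abs_cpair_le {d : ℕ} (γ : Config d) {K : Set (EucSp d)} (hK : IsCompact K)
    {f : EucSp d → ℝ} {c : ℝ} (hf : ∀ x, |f x| ≤ c * K.indicator 1 x) :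
    |cpair f γ| ≤ c * cpair (K.indicator 1) γ := by
  have hf0 : ∀ x, x ∉ K → f x = 0 := fun x hx => by
    have := hf x
    rw [indicator_of_notMem hx, mul_zero] at this
    exact abs_eq_zero.1 (le_antisymm this (abs_nonneg _))
  have hs : Summable fun u : γ.1 => ‖f u.1‖ :=
    summable_of_vanish γ hK fun u hu => by rw [hf0 _ hu, norm_zero]
  have hs' : Summable fun u : γ.1 => c * K.indicator (1 : EucSp d → ℝ) u.1 :=
    summable_of_vanish γ hK fun u hu => by rw [indicator_of_notMem hu, mul_zero]
  calc |cpair f γ| ≤ ∑' u : γ.1, ‖f u.1‖ := norm_tsum_le_tsum_norm hs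
    _ ≤ ∑' u : γ.1, c * K.indicator (1 : EucSp d → ℝ) u.1 := hs.tsum_le_tsum (fun u => hf u.1) hs'
    _ = _ := tsum_mul_left

lemma sq_tsum_le {d : ℕ} (γ : Config d) {K : Set (EucSp d)} (hK : IsCompact K)
    {t : γ.1 → ℝ} (ht : ∀ u : γ.1, u.1 ∉ K → t u = 0) :
    ENNReal.ofReal ((∑' u, t u) ^ 2)
      ≤ ∑' u, ENNReal.ofReal (cpair (K.indicator 1) γ * t u ^ 2) := by
  set S := (finite_preimage_of_isCompact γ hK).toFinset with hS
  have hmem : ∀ u : γ.1, u ∉ S → u.1 ∉ K := fun u hu hk => hu (by simpa [hS] using hk)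
  have h1 : ∑' u, t u = ∑ u ∈ S, t u := tsum_eq_sum fun u hu => ht u (hmem u hu)
  have h2 : cpair (K.indicator 1) γ = (S.card : ℝ) := by
    have : cpair (K.indicator 1) γ = ∑ u ∈ S, K.indicator (1 : EucSp d → ℝ) u.1 :=
      tsum_eq_sum fun u hu => indicator_of_notMem (hmem u hu) _
    rw [this, Finset.sum_congr rfl (g := fun _ => (1 : ℝ)), Finset.sum_const, nsmul_eq_mul, mul_one]
    intro u hu
    have hk : u.1 ∈ K := by simpa [hS] using hu
    rw [indicator_of_mem hk, Pi.one_apply]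
  rw [h1, h2]
  calc _ ≤ ENNReal.ofReal (∑ u ∈ S, (S.card : ℝ) * t u ^ 2) := by
        rw [← Finset.mul_sum]
        exact ENNReal.ofReal_le_ofReal sq_sum_le_card_mul_sum_sq
    _ = ∑ u ∈ S, ENNReal.ofReal ((S.card : ℝ) * t u ^ 2) :=
        ENNReal.ofReal_sum_of_nonneg fun u _ => by positivity
    _ ≤ _ := ENNReal.sum_le_tsum _

lemma measurable_cpair {d : ℕ} {q : EucSp d → ℝ} (hq : ∀ x, 0 ≤ q x) (hqm : Measurable q) :
    Measurable (cpair q) := by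
  have h1 : cpair q = fun γ : Config d => (∑' u : γ.1, ENNReal.ofReal (q u.1)).toReal := by
    funext γ
    rw [ENNReal.tsum_toReal_eq fun _ => ENNReal.ofReal_ne_top]
    exact tsum_congr fun u => (ENNReal.toReal_ofReal (hq _)).symm
  rw [h1]
  exact (measurable_tsum_config measurable_id (f := fun _ x => ENNReal.ofReal (q x))
    (hqm.comp measurable_snd).ennreal_ofReal).ennreal_toReal

/-- The deviation of the averaged jump factor from its mean. -/
def deviation {d : ℕ} (s : ℝ) (φ : EucSp d → EReal) (aa : EucSp d → ℝ) (x : EucSp d)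
    (γ : Config d) : ℝ :=
  (∫ y, aa (x - y) * jumpFactor s φ y γ) - 1

lemma measurable_deviation {d : ℕ} (s : ℝ) {φ : EucSp d → EReal} (hφ : Measurable φ)
    {aa : EucSp d → ℝ} (haa : Measurable aa) :
    Measurable fun p : Config d × EucSp d => deviation s φ aa p.2 p.1 := by
  have hm : Measurable fun q : (Config d × EucSp d) × EucSp d =>
      aa (q.1.2 - q.2) * jumpFactor s φ q.2 q.1.1 :=
    (haa.comp ((measurable_snd.comp measurable_fst).sub measurable_snd)).mul
      ((measurable_jumpFactor s hφ).comp
        (measurable_snd.prodMk (measurable_fst.comp measurable_fst)))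
  exact (hm.stronglyMeasurable.integral_prod_right).measurable.sub_const 1

lemma HepsMinus_sub_H0Minus {d : ℕ} (s : ℝ) (aa : EucSp d → ℝ) (φ : EucSp d → EReal)
    {K : Set (EucSp d)} (hK : IsCompact K) (F : Config d → ℝ) (γ : Config d)
    (hF : ∀ x ∈ γ.1, x ∉ K → Dminus F x γ = 0) :
    HepsMinus s aa φ F γ - H0Minus s φ F γ = -∑' x : γ.1, Dminus F x.1 γ *
      rexp ((s : EReal) * energy φ x.1 (γ.1 \ {x.1})) * deviation s φ aa x.1 (γ.del x.1) := by
  unfold HepsMinus H0Minus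
  rw [neg_sub_neg, ← neg_sub, ← Summable.tsum_sub]
  · congr 1
    refine tsum_congr fun x => ?_
    have h1 : ∀ y, aa (x.1 - y) * rexp ((s : EReal) * energy φ x.1 (γ.1 \ {x.1}) +
        ((s - 1 : ℝ) : EReal) * energy φ y (γ.1 \ {x.1}))
        = rexp ((s : EReal) * energy φ x.1 (γ.1 \ {x.1})) *
          (aa (x.1 - y) * jumpFactor s φ y (γ.del x.1)) := fun y => by
      rw [rexp_add, jumpFactor, Config.del]
      ring
    simp_rw [h1]
    rw [integral_const_mul, deviation]
    ring
  · exact summable_of_vanish γ hK fun u hu => by rw [hF _ u.2 hu, zero_mul]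
  · exact summable_of_vanish γ hK fun u hu => by rw [hF _ u.2 hu, mul_zero]

lemma abs_Dminus_exp_cpair_le {d : ℕ} (γ : Config d) {K : Set (EucSp d)} (hK : IsCompact K)
    {f : EucSp d → ℝ} {c : ℝ} (hc : 0 ≤ c) (hf : ∀ x, |f x| ≤ c * K.indicator 1 x) {x : EucSp d}
    (hx : x ∈ γ.1) :
    |Dminus (fun γ' => Real.exp (cpair f γ')) x γ|
      ≤ 2 * Real.exp (c * (cpair (K.indicator 1) (γ.del x) + 1)) := by
  have hf0 : ∀ x, x ∉ K → f x = 0 := fun x hx => by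
    have := hf x
    rw [indicator_of_notMem hx, mul_zero] at this
    exact abs_eq_zero.1 (le_antisymm this (abs_nonneg _))
  have h1 := le_of_abs_le (abs_cpair_le (γ.del x) hK hf)
  have h2 : f x ≤ c := by
    refine (le_of_abs_le (hf x)).trans (mul_le_of_le_one_right hc ?_)
    exact indicator_le_self' (fun _ _ => zero_le_one) x
  have e1 : Real.exp (cpair f (γ.del x))
      ≤ Real.exp (c * (cpair (K.indicator 1) (γ.del x) + 1)) := Real.exp_le_exp.2 (by linarith)
  have e2 : Real.exp (cpair f γ) ≤ Real.exp (c * (cpair (K.indicator 1) (γ.del x) + 1)) :=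
    Real.exp_le_exp.2 (by rw [cpair_eq_del_add γ hK hf0 hx]; linarith)
  rw [Dminus, abs_le]
  constructor <;> linarith [Real.exp_pos (cpair f (γ.del x)), Real.exp_pos (cpair f γ)]

/-- The density majorizing the squared difference of the death parts. -/
def deathMajorant {d : ℕ} (s : ℝ) (φ : EucSp d → EReal) (aa : EucSp d → ℝ) (K : Set (EucSp d))
    (c : ℝ) (γ : Config d) (x : EucSp d) : ℝ≥0∞ :=
  K.indicator 1 x * ENNReal.ofReal (4 * Real.exp (2 * c)) *
    ENNReal.ofReal (Real.exp ((2 * c + 1) * cpair (K.indicator 1) γ)) *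
    ENNReal.ofReal (rexp ((s : EReal) * energy φ x γ.1) ^ 2) *
    ENNReal.ofReal (deviation s φ aa x γ ^ 2)

lemma indicator_one_nonneg {d : ℕ} (K : Set (EucSp d)) (x : EucSp d) :
    0 ≤ K.indicator (1 : EucSp d → ℝ) x := indicator_nonneg (fun _ _ => zero_le_one) x

lemma measurable_deathMajorant {d : ℕ} (s : ℝ) {φ : EucSp d → EReal} (hφ : Measurable φ)
    {aa : EucSp d → ℝ} (haa : Measurable aa) {K : Set (EucSp d)} (hK : MeasurableSet K) (c : ℝ) :
    Measurable fun p : Config d × EucSp d => deathMajorant s φ aa K c p.1 p.2 := by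
  unfold deathMajorant
  have h1 : Measurable fun p : Config d × EucSp d => (K.indicator 1 p.2 : ℝ≥0∞) :=
    (measurable_one.indicator hK).comp measurable_snd
  have h2 : Measurable fun p : Config d × EucSp d =>
      Real.exp ((2 * c + 1) * cpair (K.indicator 1) p.1) :=
    Real.measurable_exp.comp (((measurable_cpair (indicator_one_nonneg K)
      (measurable_one.indicator hK)).comp measurable_fst).const_mul _)
  have h3 : Measurable fun p : Config d × EucSp d =>
      rexp ((s : EReal) * energy φ p.2 p.1.1) ^ 2 :=
    (measurable_rexp.comp ((measurable_const_mul_ereal s).comp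
      (measurable_energy hφ measurable_fst measurable_snd))).pow_const 2
  exact (((h1.mul_const _).mul h2.ennreal_ofReal).mul h3.ennreal_ofReal).mul
    ((measurable_deviation s hφ haa).pow_const 2).ennreal_ofReal

lemma ofReal_sq_HepsMinus_sub_le {d : ℕ} (s : ℝ) (aa : EucSp d → ℝ) (φ : EucSp d → EReal)
    {K : Set (EucSp d)} (hK : IsCompact K) {f : EucSp d → ℝ} {c : ℝ} (hc : 0 ≤ c)
    (hf : ∀ x, |f x| ≤ c * K.indicator 1 x) (γ : Config d) :
    ENNReal.ofReal ((HepsMinus s aa φ (fun γ' => Real.exp (cpair f γ')) γ -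
        H0Minus s φ (fun γ' => Real.exp (cpair f γ')) γ) ^ 2)
      ≤ ∑' x : γ.1, deathMajorant s φ aa K c (γ.del x.1) x.1 := by
  have hf0 : ∀ x, x ∉ K → f x = 0 := fun x hx => by
    have := hf x
    rw [indicator_of_notMem hx, mul_zero] at this
    exact abs_eq_zero.1 (le_antisymm this (abs_nonneg _))
  have hF : ∀ x ∈ γ.1, x ∉ K → Dminus (fun γ' => Real.exp (cpair f γ')) x γ = 0 := fun x hx hk => by
    rw [Dminus, cpair_eq_del_add γ hK hf0 hx, hf0 x hk, add_zero, sub_self]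
  rw [HepsMinus_sub_H0Minus s aa φ hK _ γ hF, neg_sq]
  refine (sq_tsum_le γ hK fun u hu => by rw [hF _ u.2 hu, zero_mul, zero_mul]).trans
    (ENNReal.tsum_le_tsum fun x => ?_)
  by_cases hx : x.1 ∈ K
  · set D := Dminus (fun γ' => Real.exp (cpair f γ')) x.1 γ with hD
    set r := rexp ((s : EReal) * energy φ x.1 (γ.1 \ {x.1})) with hr
    set V := deviation s φ aa x.1 (γ.del x.1) with hV
    set n := cpair (K.indicator 1) (γ.del x.1) with hn
    have hn0 : 0 ≤ n := tsum_nonneg fun u => indicator_one_nonneg K _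
    have hD2 : D ^ 2 ≤ (2 * Real.exp (c * (n + 1))) ^ 2 :=
      sq_le_sq' (neg_le_of_abs_le (abs_Dminus_exp_cpair_le γ hK hc hf x.2))
        (le_of_abs_le (abs_Dminus_exp_cpair_le γ hK hc hf x.2))
    have hN : cpair (K.indicator 1) γ = n + 1 := by
      rw [cpair_eq_del_add γ hK (fun y hy => indicator_of_notMem hy _) x.2, indicator_of_mem hx,
        Pi.one_apply]
    have hpt : cpair (K.indicator 1) γ * (D * r * V) ^ 2
        ≤ 4 * Real.exp (2 * c) * Real.exp ((2 * c + 1) * n) * r ^ 2 * V ^ 2 := by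
      rw [hN]
      have he : n + 1 ≤ Real.exp n := Real.add_one_le_exp n
      calc (n + 1) * (D * r * V) ^ 2 = (n + 1) * D ^ 2 * (r ^ 2 * V ^ 2) := by ring
        _ ≤ Real.exp n * (2 * Real.exp (c * (n + 1))) ^ 2 * (r ^ 2 * V ^ 2) := by gcongr
        _ = _ := by
          have : Real.exp (c * (n + 1)) ^ 2 * Real.exp n
              = Real.exp (2 * c) * Real.exp ((2 * c + 1) * n) := by
            rw [← Real.exp_nat_mul, ← Real.exp_add, ← Real.exp_add]
            congr 1
            push_cast
            ring
          linear_combination (4 * (r ^ 2 * V ^ 2)) * this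
    refine (ENNReal.ofReal_le_ofReal hpt).trans (le_of_eq ?_)
    rw [deathMajorant, indicator_of_mem hx, Pi.one_apply, one_mul,
      ENNReal.ofReal_mul (by positivity), ENNReal.ofReal_mul (by positivity),
      ENNReal.ofReal_mul (by positivity)]
    rfl
  · rw [hF _ x.2 hx]
    simp

lemma measurable_eexp : Measurable eexp := by
  unfold eexp
  refine Measurable.ite (measurableSet_singleton ⊤) measurable_const ?_
  refine Measurable.ite (measurableSet_singleton ⊥) measurable_const ?_
  exact (Real.measurable_exp.comp measurable_ereal_toReal).ennreal_ofReal

lemma Config.del_ins {d : ℕ} (γ : Config d) {x : EucSp d} (hx : x ∉ γ.1) :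
    (γ.ins x).del x = γ := by
  refine Subtype.ext ?_
  change insert x γ.1 \ {x} = γ.1
  exact insert_sdiff_self_of_notMem hx

/-- A reduced Mecke-type formula obtained from the GNZ identity. -/
lemma Setting.lintegral_tsum_del {d : ℕ} {s z B ξ : ℝ} {φ : EucSp d → EReal}
    {μ : Measure (Config d)} {k u : ∀ n : ℕ, (Fin n → EucSp d) → ℝ}
    (h : Setting d s z B ξ φ μ k u) {G : Config d → EucSp d → ℝ≥0∞}
    (hG : Measurable fun p : Config d × EucSp d => G p.1 p.2) :
    ∫⁻ γ, ∑' x : γ.1, G (γ.del x.1) x.1 ∂μ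
      = ENNReal.ofReal z * ∫⁻ x : EucSp d, ∫⁻ γ, eexp (-(energy φ x γ.1)) * G γ x ∂μ := by
  have := h.prob
  have := nullSingletonClass_eucSp h.hd
  have hm : Measurable (Function.uncurry fun (γ : Config d) (x : EucSp d) => G (γ.del x) x) :=
    hG.comp ((measurable_del measurable_fst measurable_snd).prodMk measurable_snd)
  have hE : Measurable fun p : Config d × EucSp d => eexp (-(energy φ p.2 p.1.1)) * G p.1 p.2 :=
    (measurable_eexp.comp (measurable_energy h.pp.meas measurable_fst measurable_snd).neg).mul hG
  have hEx : ∀ x : EucSp d, Measurable fun γ : Config d => eexp (-(energy φ x γ.1)) * G γ x :=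
    fun x => hE.comp measurable_prodMk_right
  have hEγ : ∀ γ : Config d, Measurable fun x : EucSp d => eexp (-(energy φ x γ.1)) * G γ x :=
    fun γ => hE.comp measurable_prodMk_left
  rw [h.gnz (fun γ x => G (γ.del x) x) hm]
  have h1 : ∀ γ : Config d, ∫⁻ x : EucSp d, ENNReal.ofReal z * eexp (-(energy φ x γ.1)) *
      G ((γ.ins x).del x) x
      = ENNReal.ofReal z * ∫⁻ x : EucSp d, eexp (-(energy φ x γ.1)) * G γ x := fun γ => by
    rw [← lintegral_const_mul _ (hEγ γ)]
    refine lintegral_congr_ae ?_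
    have h0 : ∀ᵐ x : EucSp d, x ∉ γ.1 := 
      measure_eq_zero_iff_ae_notMem.1 (γ.countable.measure_zero volume)
    filter_upwards [h0] with x hx
    rw [γ.del_ins hx, mul_assoc]
  simp_rw [h1]
  have hI : Measurable fun γ : Config d => ∫⁻ x : EucSp d, eexp (-(energy φ x γ.1)) * G γ x :=
    hE.lintegral_prod_right'
  rw [lintegral_const_mul _ hI, lintegral_lintegral_swap
    (f := fun (γ : Config d) (x : EucSp d) => eexp (-(energy φ x γ.1)) * G γ x) hE.aemeasurable]

lemma ofReal_mul_mul_sq_le {p q V L : ℝ} (hp : 0 ≤ p) (hq : 0 ≤ q) (hL : 0 < L) :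
    ENNReal.ofReal p * ENNReal.ofReal q * ENNReal.ofReal (V ^ 2)
      ≤ ENNReal.ofReal L * ENNReal.ofReal (V ^ 2) + ENNReal.ofReal L⁻¹ *
        (ENNReal.ofReal (p ^ 8) + ENNReal.ofReal (q ^ 8) + ENNReal.ofReal (V ^ 4)) := by
  rw [← ENNReal.ofReal_mul hp, ← ENNReal.ofReal_mul (mul_nonneg hp hq),
    ← ENNReal.ofReal_mul hL.le, ← ENNReal.ofReal_add (by positivity) (by positivity),
    ← ENNReal.ofReal_add (by positivity) (by positivity),
    ← ENNReal.ofReal_mul (by positivity), ← ENNReal.ofReal_add (by positivity) (by positivity)]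
  refine ENNReal.ofReal_le_ofReal ?_
  have h1 : p * q ≤ L + L⁻¹ * (p * q) ^ 2 := by
    rw [← sub_nonneg]
    have : L + L⁻¹ * (p * q) ^ 2 - p * q = L⁻¹ * ((p * q) ^ 2 - p * q * L + L ^ 2) := by
      field_simp
      ring
    rw [this]
    refine mul_nonneg (inv_nonneg.2 hL.le) ?_
    nlinarith [sq_nonneg (p * q - L), sq_nonneg (p * q + L)]
  have h2 : (p * q) ^ 2 * V ^ 2 ≤ p ^ 8 + q ^ 8 + V ^ 4 := by
    nlinarith [sq_nonneg ((p * q) ^ 2 - V ^ 2), sq_nonneg (p ^ 4 - q ^ 4), sq_nonneg (p ^ 4),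
      sq_nonneg (q ^ 4), sq_nonneg (V ^ 2)]
  calc p * q * V ^ 2 ≤ (L + L⁻¹ * (p * q) ^ 2) * V ^ 2 := by gcongr
    _ = L * V ^ 2 + L⁻¹ * ((p * q) ^ 2 * V ^ 2) := by ring
    _ ≤ _ := by gcongr

lemma Setting.exists_count_exp_moment {d : ℕ} {s z B ξ : ℝ} {φ : EucSp d → EReal}
    {μ : Measure (Config d)} {k u : ∀ n : ℕ, (Fin n → EucSp d) → ℝ}
    (h : Setting d s z B ξ φ μ k u) {K : Set (EucSp d)} (hK : IsCompact K) {t : ℝ} (ht : 0 ≤ t) :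
    ∃ m : ℝ, ∫⁻ γ, ENNReal.ofReal (Real.exp (t * cpair (K.indicator 1) γ)) ∂μ
      ≤ ENNReal.ofReal m := by
  have := h.prob
  have hm : Measurable fun x : EucSp d => t * K.indicator (1 : EucSp d → ℝ) x :=
    (measurable_one.indicator hK.measurableSet).const_mul t
  have hintg : ∫⁻ x, ENNReal.ofReal (Real.exp (t * K.indicator (1 : EucSp d → ℝ) x) - 1) ≠ ⊤ := by
    have h1 : ∀ x, ENNReal.ofReal (Real.exp (t * K.indicator (1 : EucSp d → ℝ) x) - 1)
        = K.indicator (fun _ => ENNReal.ofReal (Real.exp t - 1)) x := fun x => by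
      by_cases hx : x ∈ K
      · rw [indicator_of_mem hx, indicator_of_mem hx, Pi.one_apply, mul_one]
      · rw [indicator_of_notMem hx, indicator_of_notMem hx, mul_zero, Real.exp_zero, sub_self,
          ENNReal.ofReal_zero]
    simp_rw [h1]
    rw [lintegral_indicator hK.measurableSet, setLIntegral_const]
    exact ENNReal.mul_ne_top ENNReal.ofReal_ne_top hK.measure_lt_top.ne
  have h2 := lintegral_exp_tsum_le h.corr h.hξ.le h.ruelle
    (fun x => mul_nonneg ht (indicator_one_nonneg K x)) hm hintg
  refine ⟨_, le_trans (le_of_eq (lintegral_congr fun γ => ?_)) h2⟩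
  rw [tsum_mul_left]
  rfl

/-- The `L²` distance of the death parts in terms of the deviation of the averaged jump factor. -/
lemma Setting.exists_lintegral_sq_sub_le {d : ℕ} {s z B ξ : ℝ} {φ : EucSp d → EReal}
    {μ : Measure (Config d)} {k u : ∀ n : ℕ, (Fin n → EucSp d) → ℝ}
    (h : Setting d s z B ξ φ μ k u) {f : EucSp d → ℝ} (hf : IsC0 f) {C : ℝ≥0∞} (hC : C ≠ ⊤) :
    ∃ C₀ C₁ : ℝ≥0∞, C₀ ≠ ⊤ ∧ C₁ ≠ ⊤ ∧ ∀ (aa : EucSp d → ℝ) (T : ℝ≥0∞), Measurable aa →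
      (∀ x, ∫⁻ γ, ENNReal.ofReal (deviation s φ aa x γ ^ 2) ∂μ ≤ T) →
      (∀ x, ∫⁻ γ, ENNReal.ofReal (deviation s φ aa x γ ^ 4) ∂μ ≤ C) → ∀ L : ℝ, 0 < L →
      ∫⁻ γ, ENNReal.ofReal ((HepsMinus s aa φ (fun γ' => Real.exp (cpair f γ')) γ -
        H0Minus s φ (fun γ' => Real.exp (cpair f γ')) γ) ^ 2) ∂μ
        ≤ C₀ * (ENNReal.ofReal L * T + ENNReal.ofReal L⁻¹ * C₁) := by
  have := h.prob
  set K := tsupport f with hKdef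
  have hK : IsCompact K := hf.2
  obtain ⟨c, hc⟩ := hf.1.bounded_above_of_compact_support hf.2
  have hc0 : 0 ≤ c := (norm_nonneg _).trans (hc 0)
  have hfc : ∀ x, |f x| ≤ c * K.indicator 1 x := fun x => by
    by_cases hx : x ∈ K
    · rw [indicator_of_mem hx, Pi.one_apply, mul_one]
      exact hc x
    · rw [indicator_of_notMem hx, image_eq_zero_of_notMem_tsupport hx, abs_zero, mul_zero]
  obtain ⟨m1, hm1⟩ := h.exists_count_exp_moment hK (t := 8 * (2 * c + 1)) (by positivity)
  obtain ⟨m2, hm2⟩ := h.exp_moment (t := 8) (by norm_num)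
  refine ⟨ENNReal.ofReal z * (ENNReal.ofReal (4 * Real.exp (2 * c)) * volume K),
    ENNReal.ofReal m1 + ENNReal.ofReal m2 + C,
    ENNReal.mul_ne_top ENNReal.ofReal_ne_top
      (ENNReal.mul_ne_top ENNReal.ofReal_ne_top hK.measure_lt_top.ne),
    ENNReal.add_ne_top.2 ⟨ENNReal.add_ne_top.2 ⟨ENNReal.ofReal_ne_top, ENNReal.ofReal_ne_top⟩, hC⟩,
    fun aa T haa hT hV L hL => ?_⟩
  have hdm := measurable_deviation s h.pp.meas haa
  have hcp : Measurable (cpair (K.indicator (1 : EucSp d → ℝ))) := measurable_cpair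
    (indicator_one_nonneg K) (measurable_one.indicator hK.measurableSet)
  have hfix : ∀ x, ∫⁻ γ, eexp (-(energy φ x γ.1)) * deathMajorant s φ aa K c γ x ∂μ
      ≤ K.indicator 1 x * (ENNReal.ofReal (4 * Real.exp (2 * c)) * (ENNReal.ofReal L * T +
        ENNReal.ofReal L⁻¹ * (ENNReal.ofReal m1 + ENNReal.ofReal m2 + C))) := fun x => by
    have hdx : Measurable fun γ => deviation s φ aa x γ := hdm.comp measurable_prodMk_right
    have hd2 : Measurable fun γ => ENNReal.ofReal (deviation s φ aa x γ ^ 2) :=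
      (hdx.pow_const 2).ennreal_ofReal
    have hd4 : Measurable fun γ => ENNReal.ofReal (deviation s φ aa x γ ^ 4) :=
      (hdx.pow_const 4).ennreal_ofReal
    have hP : Measurable fun γ : Config d =>
        ENNReal.ofReal (Real.exp ((2 * c + 1) * cpair (K.indicator 1) γ) ^ 8) :=
      ((Real.measurable_exp.comp (hcp.const_mul _)).pow_const 8).ennreal_ofReal
    have hneg : Measurable (cpair fun y => negPot φ (x - y)) := measurable_cpair
      (fun y => negPot_nonneg φ _) ((measurable_negPot h.pp).comp (measurable_id.const_sub x))
    have hQ : Measurable fun γ : Config d =>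
        ENNReal.ofReal (Real.exp (cpair (fun y => negPot φ (x - y)) γ) ^ 8) :=
      ((Real.measurable_exp.comp hneg).pow_const 8).ennreal_ofReal
    have hpt : ∀ᵐ γ ∂μ, eexp (-(energy φ x γ.1)) * deathMajorant s φ aa K c γ x
        ≤ K.indicator 1 x * (ENNReal.ofReal (4 * Real.exp (2 * c)) *
          (ENNReal.ofReal L * ENNReal.ofReal (deviation s φ aa x γ ^ 2) + ENNReal.ofReal L⁻¹ *
          (ENNReal.ofReal (Real.exp ((2 * c + 1) * cpair (K.indicator 1) γ) ^ 8) +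
            ENNReal.ofReal (Real.exp (cpair (fun y => negPot φ (x - y)) γ) ^ 8) +
            ENNReal.ofReal (deviation s φ aa x γ ^ 4)))) := by
      filter_upwards [h.ae_notMem x] with γ hγ
      have hE := eexp_mul_rexp_sq_le h.hs0 h.hs1 h.pp hγ
      calc eexp (-(energy φ x γ.1)) * deathMajorant s φ aa K c γ x
          = K.indicator 1 x * (ENNReal.ofReal (4 * Real.exp (2 * c)) *
            (ENNReal.ofReal (Real.exp ((2 * c + 1) * cpair (K.indicator 1) γ)) *
            (eexp (-(energy φ x γ.1)) *
              ENNReal.ofReal (rexp ((s : EReal) * energy φ x γ.1) ^ 2)) *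
            ENNReal.ofReal (deviation s φ aa x γ ^ 2))) := by
            unfold deathMajorant
            ring
        _ ≤ K.indicator 1 x * (ENNReal.ofReal (4 * Real.exp (2 * c)) *
            (ENNReal.ofReal (Real.exp ((2 * c + 1) * cpair (K.indicator 1) γ)) *
            ENNReal.ofReal (Real.exp (cpair (fun y => negPot φ (x - y)) γ)) *
            ENNReal.ofReal (deviation s φ aa x γ ^ 2))) := by
            gcongr
            exact hE
        _ ≤ _ := by
            gcongr
            exact ofReal_mul_mul_sq_le (Real.exp_pos _).le (Real.exp_pos _).le hL
    refine (lintegral_mono_ae hpt).trans ?_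
    have hPQ : Measurable fun γ : Config d =>
        ENNReal.ofReal (Real.exp ((2 * c + 1) * cpair (K.indicator 1) γ) ^ 8) +
        ENNReal.ofReal (Real.exp (cpair (fun y => negPot φ (x - y)) γ) ^ 8) := hP.add hQ
    have hPQV : Measurable fun γ : Config d =>
        ENNReal.ofReal (Real.exp ((2 * c + 1) * cpair (K.indicator 1) γ) ^ 8) +
        ENNReal.ofReal (Real.exp (cpair (fun y => negPot φ (x - y)) γ) ^ 8) +
        ENNReal.ofReal (deviation s φ aa x γ ^ 4) := hPQ.add hd4
    have hind : K.indicator (1 : EucSp d → ℝ≥0∞) x ≠ ⊤ := by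
      by_cases hx : x ∈ K
      · rw [indicator_of_mem hx]
        exact ENNReal.one_ne_top
      · rw [indicator_of_notMem hx]
        exact ENNReal.zero_ne_top
    have hd2L : Measurable fun γ : Config d =>
        ENNReal.ofReal L * ENNReal.ofReal (deviation s φ aa x γ ^ 2) := hd2.const_mul _
    rw [lintegral_const_mul' _ _ hind, lintegral_const_mul' _ _ ENNReal.ofReal_ne_top,
      lintegral_add_left hd2L, lintegral_const_mul _ hd2, lintegral_const_mul _ hPQV,
      lintegral_add_left hPQ, lintegral_add_left hP]
    gcongr
    · exact hT x
    · refine le_trans (le_of_eq (lintegral_congr fun γ => ?_)) hm1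
      rw [← Real.exp_nat_mul]
      congr 2
      push_cast
      ring
    · refine le_trans (le_of_eq (lintegral_congr fun γ => ?_)) (hm2 x)
      rw [← Real.exp_nat_mul]
      rfl
    · exact hV x
  calc _ ≤ ∫⁻ γ, ∑' x : γ.1, deathMajorant s φ aa K c (γ.del x.1) x.1 ∂μ :=
        lintegral_mono fun γ => ofReal_sq_HepsMinus_sub_le s aa φ hK hc0 hfc γ
    _ = ENNReal.ofReal z * ∫⁻ x : EucSp d, ∫⁻ γ, eexp (-(energy φ x γ.1)) *
          deathMajorant s φ aa K c γ x ∂μ :=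
        h.lintegral_tsum_del (measurable_deathMajorant s h.pp.meas haa hK.measurableSet c)
    _ ≤ ENNReal.ofReal z * ∫⁻ x : EucSp d, K.indicator 1 x *
          (ENNReal.ofReal (4 * Real.exp (2 * c)) * (ENNReal.ofReal L * T +
          ENNReal.ofReal L⁻¹ * (ENNReal.ofReal m1 + ENNReal.ofReal m2 + C))) := by
        gcongr with x
        exact hfix x
    _ = _ := by
        have hi : Measurable fun x : EucSp d => (K.indicator 1 x : ℝ≥0∞) :=
          measurable_one.indicator hK.measurableSet
        rw [lintegral_mul_const _ hi, lintegral_indicator_one hK.measurableSet]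
        ring

lemma tendsto_zero_of_le_add_inv {ι : Type*} {l : Filter ι} {S T : ι → ℝ≥0∞} {C₀ C₁ : ℝ≥0∞}
    (h₀ : C₀ ≠ ⊤) (h₁ : C₁ ≠ ⊤) (hT : Tendsto T l (𝓝 0))
    (hS : ∀ᶠ i in l, ∀ L : ℝ, 0 < L →
      S i ≤ C₀ * (ENNReal.ofReal L * T i + ENNReal.ofReal L⁻¹ * C₁)) :
    Tendsto S l (𝓝 0) := by
  refine ENNReal.tendsto_nhds_zero.2 fun δ hδ => ?_
  have hδ2 : 0 < δ / 2 := ENNReal.half_pos hδ.ne'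
  have hL : Tendsto (fun L : ℝ => C₀ * (ENNReal.ofReal L⁻¹ * C₁)) atTop (𝓝 0) := by
    have h1 : Tendsto (fun L : ℝ => ENNReal.ofReal L⁻¹) atTop (𝓝 0) := by
      simpa using ENNReal.tendsto_ofReal tendsto_inv_atTop_zero
    have h2 := ENNReal.Tendsto.const_mul (a := C₀)
      (ENNReal.Tendsto.mul_const (b := C₁) h1 (Or.inr h₁)) (Or.inr h₀)
    rwa [zero_mul, mul_zero] at h2
  obtain ⟨L, hL1, hL2⟩ := ((ENNReal.tendsto_nhds_zero.1 hL _ hδ2).and (eventually_gt_atTop 0)).exists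
  have hT' : Tendsto (fun i => C₀ * (ENNReal.ofReal L * T i)) l (𝓝 0) := by
    have h2 := ENNReal.Tendsto.const_mul (a := C₀)
      (ENNReal.Tendsto.const_mul (a := ENNReal.ofReal L) hT (Or.inr ENNReal.ofReal_ne_top))
      (Or.inr h₀)
    rwa [mul_zero, mul_zero] at h2
  filter_upwards [hS, ENNReal.tendsto_nhds_zero.1 hT' _ hδ2] with i hi hi2
  calc S i ≤ _ := hi L hL2
    _ = C₀ * (ENNReal.ofReal L * T i) + C₀ * (ENNReal.ofReal L⁻¹ * C₁) := mul_add _ _ _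
    _ ≤ δ / 2 + δ / 2 := add_le_add hi2 hL1
    _ = δ := ENNReal.add_halves δ

lemma tendsto_integral_sq_zero {Ω ι : Type*} [MeasurableSpace Ω] {μ : Measure Ω} {l : Filter ι}
    {G : ι → Ω → ℝ} (hG : Tendsto (fun i => ∫⁻ ω, ENNReal.ofReal (G i ω ^ 2) ∂μ) l (𝓝 0)) :
    Tendsto (fun i => ∫ ω, G i ω ^ 2 ∂μ) l (𝓝 0) := by
  have h1 : Tendsto (fun i => ENNReal.ofReal (∫ ω, G i ω ^ 2 ∂μ)) l (𝓝 0) := by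
    refine tendsto_of_tendsto_of_tendsto_of_le_of_le tendsto_const_nhds hG (fun _ => zero_le)
      fun i => ?_
    change ENNReal.ofReal (∫ ω, G i ω ^ 2 ∂μ) ≤ _
    rw [← Real.enorm_eq_ofReal (integral_nonneg fun ω => sq_nonneg _)]
    refine (enorm_integral_le_lintegral_enorm _).trans (le_of_eq (lintegral_congr fun ω => ?_))
    rw [Real.enorm_eq_ofReal (sq_nonneg _)]
  have h2 := (ENNReal.tendsto_toReal ENNReal.zero_ne_top).comp h1
  rw [ENNReal.toReal_zero] at h2
  exact h2.congr fun i => ENNReal.toReal_ofReal (integral_nonneg fun ω => sq_nonneg _)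

/-- under the normalization of `a` and `φ → 0` at infinity, for every
`f ∈ C_0(ℝ^d)`, with `F = e^{⟨f,·⟩}`, one has `H_ε^- F → H_0^- F` in `L²(Γ,μ)`
as `ε → 0+`. -/
theorem statement11 (d : ℕ) (s z B ξ : ℝ) (φ : EucSp d → EReal) (μ : Measure (Config d))
    (k u : ∀ n : ℕ, (Fin n → EucSp d) → ℝ) (hset : Setting d s z B ξ φ μ k u)
    (hvan : PhiVanishes φ)
    (a : EucSp d → ℝ) (ha : GoodA a) (hnorm : NormalizedA s a φ μ)
    (f : EucSp d → ℝ) (hf : IsC0 f) :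
    Tendsto (fun ε : ℝ => ∫ γ,
        (HepsMinus s (aScaled a ε) φ (fun γ' => Real.exp (cpair f γ')) γ -
          H0Minus s φ (fun γ' => Real.exp (cpair f γ')) γ) ^ 2 ∂μ)
      (nhdsWithin (0 : ℝ) (Set.Ioi 0)) (nhds 0) := by
  obtain ⟨T, C, hT, hC, hdev⟩ := hset.exists_deviation_bounds ha hnorm
  obtain ⟨C₀, C₁, h₀, h₁, hle⟩ := hset.exists_lintegral_sq_sub_le hf hC
  refine tendsto_integral_sq_zero (tendsto_zero_of_le_add_inv h₀ h₁ hT ?_)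
  filter_upwards [self_mem_nhdsWithin] with ε hε L hL
  exact hle _ _ (measurable_aScaled ha ε) (fun x => (hdev ε hε x).1) (fun x => (hdev ε hε x).2) L hL

end
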